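/- arXiv:1203.5047 — 6 statements merged into one kernel-verified Lean document; each statement's English description precedes it below -/
import Mathlib

section
/- Let (x₀, ξ₀) ∈ S*, i.e. g(x₀) = 0 and dg(x₀)ξ₀ ≠ 0. Then there exist τ₀ > 0 and a Lipschitz map γ : [−τ₀, τ₀] → ℝ^d × ℝ^d, γ(t) = (x_t, ξ_t), with γ(0) = (x₀, ξ₀), such that for every t ∈ [−τ₀, τ₀] with t ≠ 0 one has g(x_t) ≠ 0, γ is differentiable at t, and ẋ_t = ξ_t, ξ̇_t = −∇V(x_t). Moreover γ is unique: if γ̃ : [−τ₁, τ₁] → ℝ^d × ℝ^d is any Lipschitz map with γ̃(0) = (x₀, ξ₀) satisfying the same properties (g-component nonzero and the Hamiltonian system satisfied for all t ≠ 0), then γ̃ = γ on [−min(τ₀,τ₁), min(τ₀,τ₁)]. -/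
open Set Filter Topology MeasureTheory Metric

section MeanValue

variable {E : Type*} [NormedAddCommGroup E] [NormedSpace ℝ E]

/-- Mean value inequality based at `0`, where differentiability at `0` itself is not required. -/
theorem norm_sub_zero_le_of_hasDerivAt_punctured {f f' : ℝ → E} {C t : ℝ}
    (hcont : ContinuousAt f 0)
    (hderiv : ∀ s, s ≠ 0 → |s| ≤ |t| → HasDerivAt f (f' s) s)
    (hbound : ∀ s, s ≠ 0 → |s| ≤ |t| → ‖f' s‖ ≤ C) :
    ‖f t - f 0‖ ≤ C * |t| := by
  rcases eq_or_ne t 0 with rfl | ht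
  · simp
  have hscale : ∀ u ∈ Ico (0 : ℝ) 1, (1 - u) * t ≠ 0 ∧ |(1 - u) * t| ≤ |t| := by
    intro u hu
    refine ⟨mul_ne_zero (sub_pos.2 hu.2).ne' ht, ?_⟩
    rw [abs_mul, abs_of_pos (sub_pos.2 hu.2)]
    exact mul_le_of_le_one_left (abs_nonneg t) (by linarith [hu.1])
  have hinner : ∀ u : ℝ, HasDerivAt (fun u : ℝ => (1 - u) * t) (-t) u := by
    intro u
    simpa using ((hasDerivAt_id u).const_sub 1).mul_const t
  have hd : ∀ u ∈ Ico (0 : ℝ) 1,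
      HasDerivAt (fun u : ℝ => f ((1 - u) * t)) ((-t) • f' ((1 - u) * t)) u := fun u hu =>
    (hderiv _ (hscale u hu).1 (hscale u hu).2).scomp u (hinner u)
  have hc : ContinuousOn (fun u : ℝ => f ((1 - u) * t)) (Icc 0 1) := by
    intro u hu
    rcases hu.2.lt_or_eq with h | rfl
    · exact (hd u ⟨hu.1, h⟩).continuousAt.continuousWithinAt
    · refine ContinuousAt.continuousWithinAt (ContinuousAt.comp (g := f) ?_ (by fun_prop))
      simpa using hcont
  have key := norm_image_sub_le_of_norm_deriv_right_le_segment (C := C * |t|) hc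
    (fun u hu => (hd u hu).hasDerivWithinAt) (fun u hu => by
      rw [norm_smul, norm_neg, Real.norm_eq_abs, mul_comm]
      exact mul_le_mul_of_nonneg_right (hbound _ (hscale u hu).1 (hscale u hu).2)
        (abs_nonneg t)) 1 (right_mem_Icc.2 zero_le_one)
  simpa [norm_sub_rev] using key

end MeanValue

/-- The force field `a` is defined on `U`, and along the punctured double cone
`{x₀ + s • y | 0 < |s| < τ, ‖y - ξ₀‖ ≤ r}` it is bounded by `M` and is `L`-Lipschitz in the
slope `y`, uniformly in `s`. -/
structure IsConicalField {E : Type*} [NormedAddCommGroup E] [NormedSpace ℝ E]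
    (a : E → E) (U : Set E) (x₀ ξ₀ : E) (r τ M L : ℝ) : Prop where
  radius_pos : 0 < r
  time_pos : 0 < τ
  bound_nonneg : 0 ≤ M
  lipschitz_nonneg : 0 ≤ L
  mem : ∀ s, s ≠ 0 → |s| < τ → ∀ y ∈ closedBall ξ₀ r, x₀ + s • y ∈ U
  norm_le : ∀ s, s ≠ 0 → |s| < τ → ∀ y ∈ closedBall ξ₀ r, ‖a (x₀ + s • y)‖ ≤ M
  norm_sub_le : ∀ s, s ≠ 0 → |s| < τ → ∀ y ∈ closedBall ξ₀ r, ∀ z ∈ closedBall ξ₀ r,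
    ‖a (x₀ + s • y) - a (x₀ + s • z)‖ ≤ L * ‖y - z‖

namespace IsConicalField

variable {E : Type*} [NormedAddCommGroup E] [NormedSpace ℝ E]
  {a : E → E} {U : Set E} {x₀ ξ₀ : E} {r τ M L : ℝ}

theorem mono (h : IsConicalField a U x₀ ξ₀ r τ M L) {τ' : ℝ} (hpos : 0 < τ') (hle : τ' ≤ τ) :
    IsConicalField a U x₀ ξ₀ r τ' M L where
  radius_pos := h.radius_pos
  time_pos := hpos
  bound_nonneg := h.bound_nonneg
  lipschitz_nonneg := h.lipschitz_nonneg
  mem s hs hsτ := h.mem s hs (hsτ.trans_le hle)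
  norm_le s hs hsτ := h.norm_le s hs (hsτ.trans_le hle)
  norm_sub_le s hs hsτ := h.norm_sub_le s hs (hsτ.trans_le hle)

/-- Two trajectories through the vertex of the cone agree for small times. -/
theorem eventuallyEq (h : IsConicalField a U x₀ ξ₀ r τ M L) {γ₁ γ₂ : ℝ → E × E}
    (hc₁ : ContinuousAt γ₁ 0) (hc₂ : ContinuousAt γ₂ 0)
    (h₁ : γ₁ 0 = (x₀, ξ₀)) (h₂ : γ₂ 0 = (x₀, ξ₀))
    (hd₁ : ∀ᶠ t in 𝓝 (0 : ℝ), t ≠ 0 → HasDerivAt γ₁ ((γ₁ t).2, a (γ₁ t).1) t)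
    (hd₂ : ∀ᶠ t in 𝓝 (0 : ℝ), t ≠ 0 → HasDerivAt γ₂ ((γ₂ t).2, a (γ₂ t).1) t) :
    γ₁ =ᶠ[𝓝 0] γ₂ := by
  have hball : ∀ {γ : ℝ → E × E}, ContinuousAt γ 0 → γ 0 = (x₀, ξ₀) →
      ∀ᶠ t in 𝓝 (0 : ℝ), (γ t).2 ∈ closedBall ξ₀ r := by
    intro γ hc h0
    have : Tendsto (fun t => (γ t).2) (𝓝 0) (𝓝 ξ₀) := by
      have := hc.snd.tendsto
      rwa [h0] at this
    exact this (closedBall_mem_nhds ξ₀ h.radius_pos)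
  obtain ⟨δ, hδ, hall⟩ := Metric.eventually_nhds_iff.1
    (((hball hc₁ h₁).and (hball hc₂ h₂)).and (hd₁.and hd₂))
  simp only [Real.dist_eq, sub_zero] at hall
  have hL := h.lipschitz_nonneg
  have hτ := h.time_pos
  obtain ⟨ε, hε, hεδ, hετ, hεL⟩ : ∃ ε > 0, ε < δ ∧ ε < τ ∧ L * ε < 1 := by
    have hL1 : 0 < 1 / (L + 1) := by positivity
    obtain ⟨ε, hε, hlt⟩ := exists_between (lt_min (lt_min hδ hτ) hL1)
    obtain ⟨hlt, hlt₃⟩ := lt_min_iff.1 hlt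
    obtain ⟨hlt₁, hlt₂⟩ := lt_min_iff.1 hlt
    refine ⟨ε, hε, hlt₁, hlt₂, ?_⟩
    rw [lt_div_iff₀ (by positivity)] at hlt₃
    nlinarith
  -- the slopes stay in the ball
  have hslope : ∀ {γ : ℝ → E × E}, ContinuousAt γ 0 → γ 0 = (x₀, ξ₀) →
      (∀ t, |t| < δ → (γ t).2 ∈ closedBall ξ₀ r) →
      (∀ t, |t| < δ → t ≠ 0 → HasDerivAt γ ((γ t).2, a (γ t).1) t) →
      ∀ t, |t| < δ → t ≠ 0 → ∃ y ∈ closedBall ξ₀ r, (γ t).1 = x₀ + t • y := by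
    intro γ hc h0 hb hd t ht ht0
    refine ⟨t⁻¹ • ((γ t).1 - x₀), ?_, by rw [smul_inv_smul₀ ht0]; abel⟩
    have hmv := norm_sub_zero_le_of_hasDerivAt_punctured (f := fun t => (γ t).1 - t • ξ₀)
      (f' := fun t => (γ t).2 - ξ₀) (C := r) (t := t)
      (hc.fst.sub (by fun_prop))
      (fun s hs hst => by
        have := (hasFDerivAt_fst.comp_hasDerivAt s (hd s (hst.trans_lt ht) hs)).sub
          ((hasDerivAt_id s).smul_const ξ₀)
        rwa [one_smul] at this)
      (fun s _ hst => by simpa [dist_eq_norm] using hb s (hst.trans_lt ht))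
    have heq : t⁻¹ • ((γ t).1 - x₀) - ξ₀
        = t⁻¹ • (((γ t).1 - t • ξ₀) - ((γ 0).1 - (0 : ℝ) • ξ₀)) := by
      rw [h0, zero_smul, sub_zero, sub_right_comm, smul_sub t⁻¹ _ (t • ξ₀), inv_smul_smul₀ ht0]
    rw [mem_closedBall, dist_eq_norm, heq, norm_smul, norm_inv, Real.norm_eq_abs,
      inv_mul_le_iff₀ (abs_pos.2 ht0), mul_comm]
    exact hmv
  have hcont : ∀ {γ : ℝ → E × E}, ContinuousAt γ 0 →
      (∀ t, |t| < δ → t ≠ 0 → HasDerivAt γ ((γ t).2, a (γ t).1) t) →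
      ContinuousOn γ (Icc (-ε) ε) := by
    intro γ hc hd t ht
    rcases eq_or_ne t 0 with rfl | ht0
    · exact hc.continuousWithinAt
    · exact (hd t ((abs_le.2 ht).trans_lt hεδ) ht0).continuousAt.continuousWithinAt
  have hb₁ := fun t ht => (hall (y := t) ht).1.1
  have hb₂ := fun t ht => (hall (y := t) ht).1.2
  have hd₁' := fun t ht => (hall (y := t) ht).2.1
  have hd₂' := fun t ht => (hall (y := t) ht).2.2
  obtain ⟨m, hm, hmax⟩ := isCompact_Icc.exists_isMaxOn (nonempty_Icc.2 (by linarith : -ε ≤ ε))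
    ((hcont hc₁ hd₁').snd.sub (hcont hc₂ hd₂').snd).norm
  set S : ℝ := ‖(γ₁ m).2 - (γ₂ m).2‖
  have hS0 : 0 ≤ S := norm_nonneg _
  have hvel : ∀ t, |t| ≤ ε → ‖(γ₁ t).2 - (γ₂ t).2‖ ≤ S := fun t ht => hmax (abs_le.1 ht)
  have hpos : ∀ t, |t| ≤ ε → ‖(γ₁ t).1 - (γ₂ t).1‖ ≤ S * |t| := by
    intro t ht
    have := norm_sub_zero_le_of_hasDerivAt_punctured (f := fun t => (γ₁ t).1 - (γ₂ t).1)
      (f' := fun t => (γ₁ t).2 - (γ₂ t).2) (C := S) (t := t) (hc₁.fst.sub hc₂.fst)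
      (fun s hs hst =>
        (hasFDerivAt_fst.comp_hasDerivAt s (hd₁' s ((hst.trans ht).trans_lt hεδ) hs)).sub
        (hasFDerivAt_fst.comp_hasDerivAt s (hd₂' s ((hst.trans ht).trans_lt hεδ) hs)))
      (fun s _ hst => hvel s (hst.trans ht))
    simpa [h₁, h₂] using this
  have hforce : ∀ t, t ≠ 0 → |t| ≤ ε → ‖a (γ₁ t).1 - a (γ₂ t).1‖ ≤ L * S := by
    intro t ht0 ht
    obtain ⟨y, hy, hy'⟩ := hslope hc₁ h₁ hb₁ hd₁' t (ht.trans_lt hεδ) ht0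
    obtain ⟨z, hz, hz'⟩ := hslope hc₂ h₂ hb₂ hd₂' t (ht.trans_lt hεδ) ht0
    have hp := hpos t ht
    rw [hy', hz'] at hp ⊢
    refine (h.norm_sub_le t ht0 (ht.trans_lt hετ) y hy z hz).trans ?_
    rw [add_sub_add_left_eq_sub, ← smul_sub, norm_smul, Real.norm_eq_abs, mul_comm] at hp
    exact mul_le_mul_of_nonneg_left (le_of_mul_le_mul_right hp (abs_pos.2 ht0)) hL
  have hSle : S ≤ L * S * |m| := by
    have hm' := abs_le.2 hm
    have := norm_sub_zero_le_of_hasDerivAt_punctured (f := fun t => (γ₁ t).2 - (γ₂ t).2)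
      (f' := fun t => a (γ₁ t).1 - a (γ₂ t).1) (C := L * S) (t := m) (hc₁.snd.sub hc₂.snd)
      (fun s hs hst =>
        (hasFDerivAt_snd.comp_hasDerivAt s (hd₁' s ((hst.trans hm').trans_lt hεδ) hs)).sub
        (hasFDerivAt_snd.comp_hasDerivAt s (hd₂' s ((hst.trans hm').trans_lt hεδ) hs)))
      (fun s hs hst => hforce s hs (hst.trans hm'))
    simpa [h₁, h₂] using this
  have hSzero : S = 0 := by
    have : L * S * |m| ≤ L * S * ε := mul_le_mul_of_nonneg_left (abs_le.2 hm) (by positivity)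
    nlinarith
  refine Metric.eventually_nhds_iff.2 ⟨ε, hε, fun t ht => ?_⟩
  rw [Real.dist_eq, sub_zero] at ht
  have hx := hpos t ht.le
  have hv := hvel t ht.le
  rw [hSzero] at hv hx
  rw [zero_mul] at hx
  exact Prod.ext (sub_eq_zero.1 (norm_le_zero_iff.1 hx)) (sub_eq_zero.1 (norm_le_zero_iff.1 hv))

end IsConicalField

section TimeAverage

variable {E : Type*} [NormedAddCommGroup E] [NormedSpace ℝ E]

/-- The average of `ξ` between times `0` and `t`. -/
noncomputable def timeAverage (ξ : ℝ → E) (t : ℝ) : E := ∫ u in (0 : ℝ)..1, ξ (t * u)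

theorem continuous_timeAverage {ξ : ℝ → E} (hξ : Continuous ξ) : Continuous (timeAverage ξ) :=
  intervalIntegral.continuous_parametric_intervalIntegral_of_continuous' (by fun_prop) 0 1

theorem smul_timeAverage (ξ : ℝ → E) (t : ℝ) : t • timeAverage ξ t = ∫ s in (0 : ℝ)..t, ξ s := by
  simp [timeAverage]

theorem norm_timeAverage_sub_le {ξ η : ℝ → E} (hξ : Continuous ξ) (hη : Continuous η) {C : ℝ}
    (h : ∀ t, ‖ξ t - η t‖ ≤ C) (t : ℝ) : ‖timeAverage ξ t - timeAverage η t‖ ≤ C := by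
  rw [timeAverage, timeAverage, ← intervalIntegral.integral_sub
    (Continuous.intervalIntegrable (by fun_prop) _ _)
    (Continuous.intervalIntegrable (by fun_prop) _ _)]
  simpa using intervalIntegral.norm_integral_le_of_norm_le_const (a := (0 : ℝ)) (b := 1)
    (fun u _ => h (t * u))

theorem timeAverage_mem_closedBall [CompleteSpace E] {ξ : ℝ → E} (hξ : Continuous ξ) {ξ₀ : E}
    {r : ℝ} (h : ∀ t, ξ t ∈ closedBall ξ₀ r) (t : ℝ) : timeAverage ξ t ∈ closedBall ξ₀ r := by
  have := norm_timeAverage_sub_le hξ (continuous_const (y := ξ₀))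
    (fun t => by simpa [dist_eq_norm] using h t) t
  simpa [timeAverage, dist_eq_norm] using this

theorem norm_integral_le_of_support_subset_Ioo {H : ℝ → E} {τ C : ℝ} (hτ : 0 < τ)
    (hC : 0 ≤ C) (hbound : ∀ s, ‖H s‖ ≤ C) (hsupp : ∀ s ∉ Ioo (-τ) τ, H s = 0) (t : ℝ) :
    ‖∫ s in (0 : ℝ)..t, H s‖ ≤ 2 * τ * C := by
  have hint : Integrable ((Ioo (-τ) τ).indicator fun _ : ℝ => C) :=
    (integrable_indicator_iff measurableSet_Ioo).2 (integrableOn_const (by simp))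
  rw [intervalIntegral.norm_integral_eq_norm_integral_uIoc]
  calc _ ≤ ∫ s in uIoc 0 t, (Ioo (-τ) τ).indicator (fun _ => C) s := by
        refine norm_integral_le_of_norm_le hint.restrict (Eventually.of_forall fun s => ?_)
        by_cases hs : s ∈ Ioo (-τ) τ
        · simpa [hs] using hbound s
        · simp [hs, hsupp s hs]
    _ ≤ ∫ s, (Ioo (-τ) τ).indicator (fun _ => C) s :=
        setIntegral_le_integral hint
          (Eventually.of_forall fun s => indicator_nonneg (fun _ _ => hC) s)
    _ = 2 * τ * C := by
        rw [integral_indicator_const _ measurableSet_Ioo, Real.volume_real_Ioo_of_le (by linarith),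
          smul_eq_mul]
        ring

/-- The force felt at time `s` by a particle issued from `x₀` with velocity `ξ`, cut off outside
of the punctured interval `0 < |s| < τ`. -/
noncomputable def truncatedForce (a : E → E) (x₀ : E) (τ : ℝ) (ξ : ℝ → E) : ℝ → E :=
  (Ioo (-τ) τ \ {0}).indicator fun s => a (x₀ + s • timeAverage ξ s)

end TimeAverage

namespace IsConicalField

variable {E : Type*} [NormedAddCommGroup E] [NormedSpace ℝ E] [CompleteSpace E]
  {a : E → E} {U : Set E} {x₀ ξ₀ : E} {r τ M L : ℝ}

theorem norm_truncatedForce_le (h : IsConicalField a U x₀ ξ₀ r τ M L) {ξ : ℝ → E}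
    (hξ : Continuous ξ) (hmem : ∀ t, ξ t ∈ closedBall ξ₀ r) (s : ℝ) :
    ‖truncatedForce a x₀ τ ξ s‖ ≤ M := by
  by_cases hs : s ∈ Ioo (-τ) τ \ {0}
  · rw [truncatedForce, indicator_of_mem hs]
    exact h.norm_le s hs.2 (abs_lt.2 hs.1) _ (timeAverage_mem_closedBall hξ hmem s)
  · rw [truncatedForce, indicator_of_notMem hs, norm_zero]
    exact h.bound_nonneg

theorem norm_truncatedForce_sub_le (h : IsConicalField a U x₀ ξ₀ r τ M L) {ξ η : ℝ → E}
    (hξ : Continuous ξ) (hmemξ : ∀ t, ξ t ∈ closedBall ξ₀ r)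
    (hη : Continuous η) (hmemη : ∀ t, η t ∈ closedBall ξ₀ r)
    {C : ℝ} (hC : ∀ t, ‖ξ t - η t‖ ≤ C) (s : ℝ) :
    ‖truncatedForce a x₀ τ ξ s - truncatedForce a x₀ τ η s‖ ≤ L * C := by
  have hL := h.lipschitz_nonneg
  by_cases hs : s ∈ Ioo (-τ) τ \ {0}
  · rw [truncatedForce, truncatedForce, indicator_of_mem hs, indicator_of_mem hs]
    refine (h.norm_sub_le s hs.2 (abs_lt.2 hs.1) _ (timeAverage_mem_closedBall hξ hmemξ s) _
      (timeAverage_mem_closedBall hη hmemη s)).trans ?_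
    gcongr
    exact norm_timeAverage_sub_le hξ hη hC s
  · rw [truncatedForce, truncatedForce, indicator_of_notMem hs, indicator_of_notMem hs, sub_zero,
      norm_zero]
    exact mul_nonneg hL ((norm_nonneg _).trans (hC 0))

theorem continuousOn_force (h : IsConicalField a U x₀ ξ₀ r τ M L) (ha : ContinuousOn a U)
    {ξ : ℝ → E} (hξ : Continuous ξ) (hmem : ∀ t, ξ t ∈ closedBall ξ₀ r) :
    ContinuousOn (fun s => a (x₀ + s • timeAverage ξ s)) (Ioo (-τ) τ \ {0}) := by
  have := continuous_timeAverage hξ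
  exact ha.comp (by fun_prop) fun s hs =>
    h.mem s hs.2 (abs_lt.2 hs.1) _ (timeAverage_mem_closedBall hξ hmem s)

theorem integrable_truncatedForce (h : IsConicalField a U x₀ ξ₀ r τ M L) (ha : ContinuousOn a U)
    {ξ : ℝ → E} (hξ : Continuous ξ) (hmem : ∀ t, ξ t ∈ closedBall ξ₀ r) :
    Integrable (truncatedForce a x₀ τ ξ) := by
  have hW : MeasurableSet (Ioo (-τ) τ \ {0}) := measurableSet_Ioo.diff (measurableSet_singleton 0)
  have hfin : volume (Ioo (-τ) τ \ {0}) < ⊤ := (measure_mono sdiff_subset).trans_lt (by simp)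
  have : IsFiniteMeasure (volume.restrict (Ioo (-τ) τ \ {0})) := ⟨by simpa using hfin⟩
  refine (integrable_indicator_iff hW).2 (Integrable.of_bound (C := M) ?_ ?_)
  · exact (h.continuousOn_force ha hξ hmem).aestronglyMeasurable hW
  · refine (ae_restrict_iff' hW).2 (Eventually.of_forall fun s hs => ?_)
    exact h.norm_le s hs.2 (abs_lt.2 hs.1) _ (timeAverage_mem_closedBall hξ hmem s)

theorem norm_integral_truncatedForce_le (h : IsConicalField a U x₀ ξ₀ r τ M L) {ξ : ℝ → E}
    (hξ : Continuous ξ) (hmem : ∀ t, ξ t ∈ closedBall ξ₀ r) (t : ℝ) :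
    ‖∫ s in (0 : ℝ)..t, truncatedForce a x₀ τ ξ s‖ ≤ 2 * τ * M :=
  norm_integral_le_of_support_subset_Ioo h.time_pos h.bound_nonneg
    (h.norm_truncatedForce_le hξ hmem)
    (fun _ hs => indicator_of_notMem (fun hs' => hs hs'.1) _) t

open BoundedContinuousFunction in
/-- The integral equation for the velocity has a solution on short time intervals. -/
theorem exists_velocity (h : IsConicalField a U x₀ ξ₀ r τ M L) (ha : ContinuousOn a U)
    (hM : 2 * τ * M ≤ r) (hL : 2 * τ * L ≤ 1 / 2) :
    ∃ ξ : ℝ → E, Continuous ξ ∧ (∀ t, ξ t ∈ closedBall ξ₀ r) ∧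
      ∀ t, ξ t = ξ₀ + ∫ s in (0 : ℝ)..t, truncatedForce a x₀ τ ξ s := by
  have hr := h.radius_pos
  set B : Set (ℝ →ᵇ E) := closedBall (const ℝ ξ₀) r
  have hB : ∀ ξ ∈ B, ∀ t, ξ t ∈ closedBall ξ₀ r := fun ξ hξ t =>
    (dist_coe_le_dist (g := const ℝ ξ₀) t).trans hξ
  have : CompleteSpace B := isClosed_closedBall.completeSpace_coe
  have : Nonempty B := ⟨⟨const ℝ ξ₀, mem_closedBall_self hr.le⟩⟩
  have hle : ∀ ξ : B, ∀ t, ‖∫ s in (0 : ℝ)..t, truncatedForce a x₀ τ ξ.1 s‖ ≤ r := fun ξ t =>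
    (h.norm_integral_truncatedForce_le ξ.1.continuous (hB _ ξ.2) t).trans hM
  have hint : ∀ ξ : B, Integrable (truncatedForce a x₀ τ ξ.1) := fun ξ =>
    h.integrable_truncatedForce ha ξ.1.continuous (hB _ ξ.2)
  let Φ : B → B := fun ξ =>
    ⟨ofNormedAddCommGroup (fun t => ξ₀ + ∫ s in (0 : ℝ)..t, truncatedForce a x₀ τ ξ.1 s)
      (continuous_const.add ((hint ξ).continuous_primitive 0)) (‖ξ₀‖ + r)
      (fun t => (norm_add_le _ _).trans (by gcongr; exact hle ξ t)),
      (dist_le hr.le).2 fun t => by simpa [dist_eq_norm] using hle ξ t⟩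
  have hΦ : ContractingWith (1 / 2) Φ := by
    refine ⟨by norm_num, LipschitzWith.of_dist_le_mul fun ξ η => ?_⟩
    refine (dist_le (by positivity)).2 fun t => ?_
    have hdiff : ∀ t, ‖ξ.1 t - η.1 t‖ ≤ dist ξ η := fun t => by
      rw [← dist_eq_norm]
      exact dist_coe_le_dist t
    have := norm_integral_le_of_support_subset_Ioo
      (H := fun s => truncatedForce a x₀ τ ξ.1 s - truncatedForce a x₀ τ η.1 s) h.time_pos
      (mul_nonneg h.lipschitz_nonneg dist_nonneg)
      (h.norm_truncatedForce_sub_le ξ.1.continuous (hB _ ξ.2) η.1.continuous (hB _ η.2) hdiff)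
      (fun s hs => by
        have hs' : s ∉ Ioo (-τ) τ \ {0} := fun hs' => hs hs'.1
        simp only [truncatedForce, indicator_of_notMem hs', sub_zero]) t
    rw [intervalIntegral.integral_sub (hint ξ).intervalIntegrable (hint η).intervalIntegrable]
      at this
    simp only [Φ, coe_ofNormedAddCommGroup, dist_eq_norm, add_sub_add_left_eq_sub]
    refine this.trans ?_
    rw [← mul_assoc]
    exact mul_le_mul_of_nonneg_right (by simpa using hL) dist_nonneg
  have hfix := hΦ.fixedPoint_isFixedPt
  set ξ := hΦ.fixedPoint
  refine ⟨ξ.1, ξ.1.continuous, hB _ ξ.2, fun t => ?_⟩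
  exact (congrArg (fun η : B => η.1 t) hfix).symm

theorem exists_trajectory (h : IsConicalField a U x₀ ξ₀ r τ M L)
    (ha : ContinuousOn a U) :
    ∃ τ₀ > (0 : ℝ), ∃ γ : ℝ → E × E, (∃ K, LipschitzWith K γ) ∧ γ 0 = (x₀, ξ₀) ∧
      ∀ t, |t| ≤ τ₀ → t ≠ 0 → (γ t).1 ∈ U ∧ HasDerivAt γ ((γ t).2, a (γ t).1) t := by
  have hr := h.radius_pos
  have hM := h.bound_nonneg
  have hL := h.lipschitz_nonneg
  obtain ⟨σ, hσ, hστ, hσM, hσL⟩ : ∃ σ > 0, σ ≤ τ ∧ 2 * σ * M ≤ r ∧ 2 * σ * L ≤ 1 / 2 := by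
    have hτ := h.time_pos
    obtain ⟨σ, hσ, hlt⟩ := exists_between
      (show 0 < min τ (min (r / (2 * (M + 1))) (1 / (4 * (L + 1)))) by positivity)
    rw [lt_min_iff, lt_min_iff, lt_div_iff₀ (by positivity), lt_div_iff₀ (by positivity)] at hlt
    exact ⟨σ, hσ, hlt.1.le, by linarith [hlt.2.1], by linarith [hlt.2.2]⟩
  replace h := h.mono hσ hστ
  obtain ⟨ξ, hξ, hmem, heq⟩ := h.exists_velocity ha hσM hσL
  have hint := h.integrable_truncatedForce ha hξ hmem
  have hx : ∀ t, x₀ + ∫ s in (0 : ℝ)..t, ξ s = x₀ + t • timeAverage ξ t := fun t => by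
    rw [smul_timeAverage]
  have hξlip : ∀ t, ‖ξ t‖ ≤ ‖ξ₀‖ + r := fun t => norm_le_of_mem_closedBall (hmem t)
  refine ⟨σ / 2, half_pos hσ, fun t => (x₀ + ∫ s in (0 : ℝ)..t, ξ s, ξ t),
    ⟨max (‖ξ₀‖ + r).toNNReal M.toNNReal, LipschitzWith.prodMk ?_ ?_⟩, ?_, ?_⟩
  · refine LipschitzWith.of_dist_le_mul fun t s => ?_
    rw [dist_add_left, dist_eq_norm, intervalIntegral.integral_interval_sub_left
      (hξ.intervalIntegrable _ _) (hξ.intervalIntegrable _ _),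
      Real.coe_toNNReal _ (by positivity), Real.dist_eq]
    exact intervalIntegral.norm_integral_le_of_norm_le_const fun u _ => hξlip u
  · refine LipschitzWith.of_dist_le_mul fun t s => ?_
    rw [heq t, heq s, dist_add_left, dist_eq_norm, intervalIntegral.integral_interval_sub_left
      hint.intervalIntegrable hint.intervalIntegrable, Real.coe_toNNReal _ hM, Real.dist_eq]
    exact intervalIntegral.norm_integral_le_of_norm_le_const fun u _ =>
      h.norm_truncatedForce_le hξ hmem u
  · simpa using heq 0
  · intro t ht ht0
    have htσ : |t| < σ := by linarith
    have htW : t ∈ Ioo (-σ) σ \ {0} := ⟨abs_lt.1 htσ, ht0⟩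
    refine ⟨?_, HasDerivAt.prodMk ?_ ?_⟩
    · simp only [hx]
      exact h.mem t ht0 htσ _ (timeAverage_mem_closedBall hξ hmem t)
    · exact (intervalIntegral.integral_hasDerivAt_right (hξ.intervalIntegrable _ _)
        (hξ.stronglyMeasurableAtFilter _ _) hξ.continuousAt).const_add x₀
    · have hnhds : Ioo (-σ) σ \ {(0 : ℝ)} ∈ 𝓝 t :=
        (isOpen_Ioo.sdiff isClosed_singleton).mem_nhds htW
      have hcont : ContinuousAt (truncatedForce a x₀ σ ξ) t :=
        ((h.continuousOn_force ha hξ hmem).continuousAt hnhds).congr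
          (by filter_upwards [hnhds] with s hs using
            (indicator_of_mem hs fun s => a (x₀ + s • timeAverage ξ s)).symm)
      have := (intervalIntegral.integral_hasDerivAt_right (hint.intervalIntegrable (a := 0))
        (hint.aestronglyMeasurable.stronglyMeasurableAtFilter) hcont).const_add ξ₀
      rw [truncatedForce, indicator_of_mem htW, ← hx] at this
      exact this.congr_of_eventuallyEq (Eventually.of_forall heq)

end IsConicalField

section NormPotential

variable {E F : Type*} [NormedAddCommGroup E] [InnerProductSpace ℝ E]
  [NormedAddCommGroup F] [InnerProductSpace ℝ F]

theorem hasFDerivAt_norm_of_ne_zero {u : F} (hu : u ≠ 0) :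
    HasFDerivAt (fun u : F => ‖u‖) (innerSL ℝ (‖u‖⁻¹ • u)) u := by
  have hu' : ‖u‖ ≠ 0 := norm_ne_zero_iff.2 hu
  have := (hasStrictFDerivAt_norm_sq u).hasFDerivAt.sqrt (pow_ne_zero 2 hu')
  simp only [Real.sqrt_sq (norm_nonneg _)] at this
  convert this using 1
  ext v
  simp
  field_simp

theorem norm_inv_smul_sub_le {u v : F} (hu : u ≠ 0) (hv : v ≠ 0) :
    ‖‖u‖⁻¹ • u - ‖v‖⁻¹ • v‖ ≤ 2 * ‖u - v‖ / ‖u‖ := by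
  have hu' : 0 < ‖u‖ := norm_pos_iff.2 hu
  have hv' : 0 < ‖v‖ := norm_pos_iff.2 hv
  have hsplit : ‖u‖⁻¹ • u - ‖v‖⁻¹ • v = ‖u‖⁻¹ • (u - v) + (‖u‖⁻¹ - ‖v‖⁻¹) • v := by
    rw [smul_sub, sub_smul]
    abel
  have hcoef : ‖(‖u‖⁻¹ - ‖v‖⁻¹) • v‖ ≤ ‖u - v‖ / ‖u‖ := by
    have : (‖u‖⁻¹ - ‖v‖⁻¹) = (‖v‖ - ‖u‖) / (‖u‖ * ‖v‖) := by field_simp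
    rw [norm_smul, this, norm_div, norm_mul, norm_norm, norm_norm, Real.norm_eq_abs]
    rw [div_mul_eq_mul_div, mul_div_mul_right _ _ hv'.ne', norm_sub_rev u v]
    gcongr
    exact abs_norm_sub_norm_le v u
  calc _ ≤ ‖‖u‖⁻¹ • (u - v)‖ + ‖(‖u‖⁻¹ - ‖v‖⁻¹) • v‖ := by rw [hsplit]; exact norm_add_le _ _
    _ ≤ ‖u - v‖ / ‖u‖ + ‖u - v‖ / ‖u‖ := by
        gcongr
        rw [norm_smul, norm_inv, norm_norm, inv_mul_eq_div]
    _ = 2 * ‖u - v‖ / ‖u‖ := by ring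

/-- The differential of `w * ‖g‖ + V₀` at `x`, with the direction `g x / ‖g x‖` and the norm
`‖g x‖` replaced by independent variables. -/
noncomputable def decoupledDifferential (w V₀ : E → ℝ) (g : E → F) (z : E × F × ℝ) : E →L[ℝ] ℝ :=
  w z.1 • (innerSL ℝ z.2.1).comp (fderiv ℝ g z.1) + z.2.2 • fderiv ℝ w z.1 + fderiv ℝ V₀ z.1

variable {w V₀ : E → ℝ} {g : E → F}

theorem contDiff_decoupledDifferential (hw : ContDiff ℝ (⊤ : ℕ∞) w)
    (hV₀ : ContDiff ℝ (⊤ : ℕ∞) V₀) (hg : ContDiff ℝ (⊤ : ℕ∞) g) :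
    ContDiff ℝ 1 (decoupledDifferential w V₀ g) := by
  have hle : (1 : WithTop ℕ∞) + 1 ≤ ((⊤ : ℕ∞) : WithTop ℕ∞) :=
    WithTop.coe_le_coe.2 (le_top : (1 : ℕ∞) + 1 ≤ ⊤)
  have hw' : ContDiff ℝ 1 (fderiv ℝ w) := hw.fderiv_right hle
  have hV₀' : ContDiff ℝ 1 (fderiv ℝ V₀) := hV₀.fderiv_right hle
  have hg' : ContDiff ℝ 1 (fderiv ℝ g) := hg.fderiv_right hle
  have hw₁ : ContDiff ℝ 1 w := hw.of_le (by exact_mod_cast le_top)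
  have hinner : ContDiff ℝ 1 (fun z : E × F × ℝ => innerSL ℝ z.2.1) :=
    (innerSL ℝ (E := F)).contDiff.comp (contDiff_fst.comp contDiff_snd)
  unfold decoupledDifferential
  exact (((hw₁.comp contDiff_fst).smul (hinner.clm_comp (hg'.comp contDiff_fst))).add
    ((contDiff_snd.comp contDiff_snd).smul (hw'.comp contDiff_fst))).add (hV₀'.comp contDiff_fst)

theorem fderiv_mul_norm_add (hw : Differentiable ℝ w) (hV₀ : Differentiable ℝ V₀)
    (hg : Differentiable ℝ g) {x : E} (hx : g x ≠ 0) :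
    fderiv ℝ (fun y => w y * ‖g y‖ + V₀ y) x =
      decoupledDifferential w V₀ g (x, ‖g x‖⁻¹ • g x, ‖g x‖) :=
  (((hw x).hasFDerivAt.mul ((hasFDerivAt_norm_of_ne_zero hx).comp x (hg x).hasFDerivAt)).add
    (hV₀ x).hasFDerivAt).fderiv

theorem contDiffAt_mul_norm_add (hw : ContDiff ℝ (⊤ : ℕ∞) w) (hV₀ : ContDiff ℝ (⊤ : ℕ∞) V₀)
    (hg : ContDiff ℝ (⊤ : ℕ∞) g) {x : E} (hx : g x ≠ 0) :
    ContDiffAt ℝ (⊤ : ℕ∞) (fun y => w y * ‖g y‖ + V₀ y) x :=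
  (hw.contDiffAt.mul (hg.contDiffAt.norm ℝ hx)).add hV₀.contDiffAt

/-- If `g` vanishes at `x₀` and its differential does not vanish on `ξ₀`, then `‖g‖` grows at
least linearly in a double cone around the direction `ξ₀`. -/
theorem exists_mul_le_norm_of_fderiv_ne_zero {x₀ ξ₀ : E} (hg : DifferentiableAt ℝ g x₀)
    (hgx₀ : g x₀ = 0) (hdg : fderiv ℝ g x₀ ξ₀ ≠ 0) :
    ∃ r > 0, ∃ τ > 0, ∃ c > 0, ∀ s : ℝ, |s| < τ → ∀ y ∈ closedBall ξ₀ r,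
      ‖s • y‖ ≤ 1 ∧ c * |s| ≤ ‖g (x₀ + s • y)‖ := by
  set D := fderiv ℝ g x₀
  set c := ‖D ξ₀‖
  have hc : 0 < c := norm_pos_iff.2 hdg
  set R := ‖ξ₀‖ + 1
  have hR : 0 < R := by positivity
  obtain ⟨δ, hδ, hD⟩ := Metric.eventually_nhds_iff.1
    (hg.hasFDerivAt.isLittleO.def (show 0 < c / (4 * R) by positivity))
  refine ⟨min 1 (c / (4 * (‖D‖ + 1))), by positivity, min (1 / R) (δ / R), by positivity,
    c / 2, by positivity, fun s hs y hy => ?_⟩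
  rw [mem_closedBall, dist_eq_norm, le_min_iff, le_div_iff₀ (by positivity)] at hy
  rw [lt_min_iff, lt_div_iff₀ hR, lt_div_iff₀ hR] at hs
  have hyR : ‖y‖ ≤ R := by
    have := norm_le_norm_add_norm_sub' y ξ₀
    linarith [hy.1]
  have hsy : ‖s • y‖ ≤ |s| * R := by
    rw [norm_smul, Real.norm_eq_abs]
    gcongr
  refine ⟨hsy.trans hs.1.le, ?_⟩
  have herr := hD (y := x₀ + s • y) (by simpa [dist_eq_norm] using hsy.trans_lt hs.2)
  rw [hgx₀, sub_zero, add_sub_cancel_left] at herr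
  have herr' : ‖g (x₀ + s • y) - D (s • y)‖ ≤ |s| * (c / 4) := by
    refine herr.trans ((mul_le_mul_of_nonneg_left hsy (by positivity)).trans_eq ?_)
    field_simp
  have hDy : 3 * c / 4 ≤ ‖D y‖ := by
    have h₁ : ‖D y - D ξ₀‖ ≤ ‖D‖ * ‖y - ξ₀‖ := by
      rw [← map_sub]
      exact D.le_opNorm _
    have h₂ : c ≤ ‖D y‖ + ‖D y - D ξ₀‖ := norm_le_norm_add_norm_sub (D y) (D ξ₀)
    nlinarith [hy.2, norm_nonneg (y - ξ₀)]
  have hDsy : |s| * (3 * c / 4) ≤ ‖D (s • y)‖ := by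
    rw [map_smul, norm_smul, Real.norm_eq_abs]
    gcongr
  have := norm_le_norm_add_norm_sub (g (x₀ + s • y)) (D (s • y))
  linarith

variable [ProperSpace E] [ProperSpace F]

theorem norm_gradient_sub_gradient (f : E → ℝ) (x y : E) :
    ‖gradient f x - gradient f y‖ = ‖fderiv ℝ f x - fderiv ℝ f y‖ := by
  rw [gradient, gradient, ← map_sub, LinearIsometryEquiv.norm_map]

theorem norm_gradient (f : E → ℝ) (x : E) : ‖gradient f x‖ = ‖fderiv ℝ f x‖ := by
  rw [gradient, LinearIsometryEquiv.norm_map]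

theorem exists_lipschitzOnWith_gradient {f : E → ℝ} {x : E} (hf : ContDiffAt ℝ 2 f x) :
    ∃ K, ∃ t ∈ 𝓝 x, LipschitzOnWith K (gradient f) t := by
  obtain ⟨K, t, ht, hK⟩ := (hf.fderiv_right (m := 1) (by norm_num)).exists_lipschitzOnWith
  refine ⟨K, t, ht, LipschitzOnWith.of_dist_le_mul fun y hy z hz => ?_⟩
  rw [dist_eq_norm, norm_gradient_sub_gradient, ← dist_eq_norm]
  exact hK.dist_le_mul y hy z hz

theorem exists_isConicalField_neg_gradient (hw : ContDiff ℝ (⊤ : ℕ∞) w)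
    (hV₀ : ContDiff ℝ (⊤ : ℕ∞) V₀) (hg : ContDiff ℝ (⊤ : ℕ∞) g) {x₀ ξ₀ : E} (hgx₀ : g x₀ = 0)
    (hdg : fderiv ℝ g x₀ ξ₀ ≠ 0) :
    ∃ r τ M L, IsConicalField (fun x => -gradient (fun y => w y * ‖g y‖ + V₀ y) x)
      {x | g x ≠ 0} x₀ ξ₀ r τ M L := by
  have htop : ((⊤ : ℕ∞) : WithTop ℕ∞) ≠ 0 := by simp
  obtain ⟨r, hr, τ, hτ, c, hc, hcone⟩ :=
    exists_mul_le_norm_of_fderiv_ne_zero (hg.differentiable htop x₀) hgx₀ hdg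
  obtain ⟨Kg, hKg⟩ := hg.contDiffOn.exists_lipschitzOnWith htop (convex_closedBall x₀ 1)
    (isCompact_closedBall x₀ 1)
  set ρ : ℝ := ‖x₀‖ + 1 + Kg
  have hρ : 0 ≤ ρ := by positivity
  set P := decoupledDifferential w V₀ g
  obtain ⟨K, hK⟩ := (contDiff_decoupledDifferential hw hV₀ hg).contDiffOn.exists_lipschitzOnWith
    one_ne_zero (convex_closedBall (0 : E × F × ℝ) ρ) (isCompact_closedBall _ ρ)
  set Z : E → E × F × ℝ := fun x => (x, ‖g x‖⁻¹ • g x, ‖g x‖)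
  have hfd : ∀ x, g x ≠ 0 → fderiv ℝ (fun y => w y * ‖g y‖ + V₀ y) x = P (Z x) := fun x hx =>
    fderiv_mul_norm_add (hw.differentiable htop) (hV₀.differentiable htop)
      (hg.differentiable htop) hx
  have hne : ∀ s, s ≠ 0 → |s| < τ → ∀ y ∈ closedBall ξ₀ r, g (x₀ + s • y) ≠ 0 :=
    fun s hs hsτ y hy =>
      norm_pos_iff.1 ((mul_pos hc (abs_pos.2 hs)).trans_le (hcone s hsτ y hy).2)
  have hmem : ∀ s, |s| < τ → ∀ y ∈ closedBall ξ₀ r, x₀ + s • y ∈ closedBall x₀ 1 :=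
    fun s hsτ y hy => by simpa [dist_eq_norm] using (hcone s hsτ y hy).1
  have hZ : ∀ x ∈ closedBall x₀ 1, Z x ∈ closedBall 0 ρ := by
    intro x hx
    have hx' : ‖x‖ ≤ ‖x₀‖ + 1 := norm_le_of_mem_closedBall hx
    have hgx : ‖g x‖ ≤ Kg := by
      have := hKg.dist_le_mul x hx x₀ (mem_closedBall_self zero_le_one)
      rw [hgx₀, dist_zero_right] at this
      exact this.trans (mul_le_of_le_one_right Kg.2 hx)
    have hdir : ‖‖g x‖⁻¹ • g x‖ ≤ 1 := by
      rw [norm_smul, norm_inv, norm_norm]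
      exact inv_mul_le_one
    rw [mem_closedBall_zero_iff, Prod.norm_def, Prod.norm_def, norm_norm]
    have hKg0 : (0 : ℝ) ≤ Kg := Kg.2
    have hx0 := norm_nonneg x₀
    exact max_le (by linarith) (max_le (by linarith) (by linarith))
  set τ' := min τ 1
  have hτ' : ∀ {s}, |s| < τ' → |s| < τ := fun hs => hs.trans_le (min_le_left _ _)
  refine ⟨r, τ', ‖P 0‖ + K * ρ, K * (1 + 2 * Kg / c + Kg), hr, by positivity, by positivity,
    by positivity, fun s hs hsτ => hne s hs (hτ' hsτ), fun s hs hsτ y hy => ?_,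
    fun s hs hsτ y hy z hz => ?_⟩
  · rw [norm_neg, norm_gradient, hfd _ (hne s hs (hτ' hsτ) y hy)]
    have hball := hZ _ (hmem s (hτ' hsτ) y hy)
    have := hK.dist_le_mul _ hball 0 (mem_closedBall_self hρ)
    refine (norm_le_norm_add_norm_sub' _ (P 0)).trans ?_
    rw [← dist_eq_norm]
    gcongr
    exact this.trans (by gcongr; exact hball)
  · have hy' := hne s hs (hτ' hsτ) y hy
    have hz' := hne s hs (hτ' hsτ) z hz
    have hs1 : |s| ≤ 1 := (hsτ.trans_le (min_le_right _ _)).le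
    rw [neg_sub_neg, norm_sub_rev, norm_gradient_sub_gradient, hfd _ hy', hfd _ hz',
      ← dist_eq_norm, mul_assoc]
    refine (hK.dist_le_mul _ (hZ _ (hmem s (hτ' hsτ) y hy)) _
      (hZ _ (hmem s (hτ' hsτ) z hz))).trans ?_
    have hgdist : ‖g (x₀ + s • y) - g (x₀ + s • z)‖ ≤ Kg * (|s| * ‖y - z‖) := by
      have := hKg.dist_le_mul _ (hmem s (hτ' hsτ) y hy) _ (hmem s (hτ' hsτ) z hz)
      rwa [dist_add_left, dist_eq_norm, dist_eq_norm, ← smul_sub, norm_smul,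
        Real.norm_eq_abs] at this
    have hn := norm_nonneg (y - z)
    have hsn : |s| * ‖y - z‖ ≤ ‖y - z‖ := mul_le_of_le_one_left hn hs1
    have hKg0 : (0 : ℝ) ≤ Kg := Kg.2
    have hdir : 0 ≤ 2 * Kg / c * ‖y - z‖ := by positivity
    have hKgn : 0 ≤ Kg * ‖y - z‖ := by positivity
    gcongr
    rw [Prod.dist_eq, Prod.dist_eq]
    refine max_le ?_ (max_le ?_ ?_)
    · rw [dist_add_left, dist_eq_norm, ← smul_sub, norm_smul, Real.norm_eq_abs]
      linarith
    · rw [dist_eq_norm]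
      have hs0 : 0 < |s| := abs_pos.2 hs
      have : 2 * ‖g (x₀ + s • y) - g (x₀ + s • z)‖ / ‖g (x₀ + s • y)‖ ≤
          2 * (Kg * (|s| * ‖y - z‖)) / (c * |s|) := by
        gcongr
        exact (hcone s (hτ' hsτ) y hy).2
      have heq : 2 * (Kg * (|s| * ‖y - z‖)) / (c * |s|) = 2 * Kg / c * ‖y - z‖ := by
        field_simp
      have := (norm_inv_smul_sub_le hy' hz').trans (this.trans_eq heq)
      linarith
    · have h₁ : dist ‖g (x₀ + s • y)‖ ‖g (x₀ + s • z)‖ ≤ Kg * (|s| * ‖y - z‖) := by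
        rw [Real.dist_eq]
        exact (abs_norm_sub_norm_le _ _).trans hgdist
      have h₂ : Kg * (|s| * ‖y - z‖) ≤ Kg * ‖y - z‖ := mul_le_mul_of_nonneg_left hsn hKg0
      linarith

end NormPotential

section Uniqueness

variable {E : Type*} [NormedAddCommGroup E] [NormedSpace ℝ E] {a : E → E} {U : Set E}

/-- Trajectories of a locally Lipschitz force field that pass through the same phase space point
agree for nearby times. -/
theorem eventuallyEq_of_hasDerivAt_of_lipschitz {γ₁ γ₂ : ℝ → E × E} {t : ℝ} {K : NNReal}
    {N : Set E} (hN : N ∈ 𝓝 (γ₁ t).1) (hK : LipschitzOnWith K a N) (heq : γ₁ t = γ₂ t)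
    (hd₁ : ∀ᶠ s in 𝓝 t, HasDerivAt γ₁ ((γ₁ s).2, a (γ₁ s).1) s)
    (hd₂ : ∀ᶠ s in 𝓝 t, HasDerivAt γ₂ ((γ₂ s).2, a (γ₂ s).1) s) :
    γ₁ =ᶠ[𝓝 t] γ₂ := by
  have hmem₁ : ∀ᶠ s in 𝓝 t, (γ₁ s).1 ∈ N := hd₁.self_of_nhds.continuousAt.fst hN
  have hmem₂ : ∀ᶠ s in 𝓝 t, (γ₂ s).1 ∈ N :=
    hd₂.self_of_nhds.continuousAt.fst (by rwa [heq] at hN)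
  have hLip : LipschitzOnWith (max 1 K) (fun z : E × E => (z.2, a z.1)) (Prod.fst ⁻¹' N) := by
    refine LipschitzOnWith.prodMk LipschitzWith.prod_snd.lipschitzOnWith ?_
    have := hK.comp (LipschitzWith.prod_fst.lipschitzOnWith (s := (Prod.fst ⁻¹' N : Set (E × E))))
      (fun _ hz => hz)
    rwa [mul_one] at this
  exact ODE_solution_unique_of_eventually (v := fun _ z => (z.2, a z.1))
    (s := fun _ => Prod.fst ⁻¹' N) (Eventually.of_forall fun _ => hLip)
    (hd₁.and hmem₁) (hd₂.and hmem₂) heq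

theorem IsConicalField.eqOn {x₀ ξ₀ : E} {r τ M L : ℝ} (h : IsConicalField a U x₀ ξ₀ r τ M L)
    (ha : ∀ x ∈ U, ∃ K, ∃ N ∈ 𝓝 x, LipschitzOnWith K a N) {γ₁ γ₂ : ℝ → E × E} {T : ℝ}
    (hT : 0 < T) (hc₁ : ContinuousAt γ₁ 0) (hc₂ : ContinuousAt γ₂ 0)
    (h₁ : γ₁ 0 = (x₀, ξ₀)) (h₂ : γ₂ 0 = (x₀, ξ₀))
    (hU : ∀ t ∈ Icc (-T) T, t ≠ 0 → (γ₁ t).1 ∈ U)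
    (hd₁ : ∀ t ∈ Icc (-T) T, t ≠ 0 → HasDerivAt γ₁ ((γ₁ t).2, a (γ₁ t).1) t)
    (hd₂ : ∀ t ∈ Icc (-T) T, t ≠ 0 → HasDerivAt γ₂ ((γ₂ t).2, a (γ₂ t).1) t) :
    EqOn γ₁ γ₂ (Icc (-T) T) := by
  have hcont : ∀ {γ : ℝ → E × E}, ContinuousAt γ 0 →
      (∀ t ∈ Icc (-T) T, t ≠ 0 → HasDerivAt γ ((γ t).2, a (γ t).1) t) →
      ∀ t ∈ Icc (-T) T, ContinuousAt γ t := by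
    intro γ hc hd t ht
    rcases eq_or_ne t 0 with rfl | ht0
    · exact hc
    · exact (hd t ht ht0).continuousAt
  set u : Set ℝ := interior {t | γ₁ t = γ₂ t}
  have hclosure : ∀ t ∈ closure u, t ∈ Icc (-T) T → γ₁ t = γ₂ t := by
    intro t ht htT
    have := mem_closure_iff_nhdsWithin_neBot.1 ht
    refine tendsto_nhds_unique_of_eventuallyEq
      ((hcont hc₁ hd₁ t htT).mono_left (nhdsWithin_le_nhds (s := u)))
      ((hcont hc₂ hd₂ t htT).mono_left nhdsWithin_le_nhds) ?_
    filter_upwards [self_mem_nhdsWithin] with s hs using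
      (interior_subset hs : s ∈ {t | γ₁ t = γ₂ t})
  have hzero : (0 : ℝ) ∈ u := by
    have hnhds : Icc (-T) T ∈ 𝓝 (0 : ℝ) := Icc_mem_nhds (by linarith) hT
    exact mem_interior_iff_mem_nhds.2 (h.eventuallyEq hc₁ hc₂ h₁ h₂
      (by filter_upwards [hnhds] using hd₁) (by filter_upwards [hnhds] using hd₂))
  have hsub : Ioo (-T) T ⊆ u := by
    refine isPreconnected_Ioo.subset_of_closure_inter_subset isOpen_interior
      ⟨0, ⟨by linarith, hT⟩, hzero⟩ ?_
    rintro t ⟨ht, htT⟩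
    rcases eq_or_ne t 0 with rfl | ht0
    · exact hzero
    have htT' := Ioo_subset_Icc_self htT
    obtain ⟨K, N, hN, hK⟩ := ha _ (hU t htT' ht0)
    have hnhds : ∀ᶠ s in 𝓝 t, s ∈ Icc (-T) T ∧ s ≠ 0 :=
      Filter.Eventually.and (Icc_mem_nhds htT.1 htT.2) (isOpen_ne.mem_nhds ht0)
    exact mem_interior_iff_mem_nhds.2 (eventuallyEq_of_hasDerivAt_of_lipschitz hN hK
      (hclosure t ht htT') (hnhds.mono fun s hs => hd₁ s hs.1 hs.2)
      (hnhds.mono fun s hs => hd₂ s hs.1 hs.2))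
  intro t ht
  refine hclosure t (closure_mono hsub ?_) ht
  rwa [closure_Ioo (by linarith)]

end Uniqueness


/-- Existence and uniqueness of the broken Hamiltonian trajectory through a point
(x₀,ξ₀) ∈ S* for the potential V(x) = w(x)|g(x)| + V₀(x). -/
theorem stmt0 (d p : ℕ) (hd : 1 ≤ d) (hp : 1 ≤ p) (hpd : p ≤ d)
    (w V₀ : EuclideanSpace ℝ (Fin d) → ℝ)
    (g : EuclideanSpace ℝ (Fin d) → EuclideanSpace ℝ (Fin p))
    (hw : ContDiff ℝ (⊤ : ℕ∞) w) (hV₀ : ContDiff ℝ (⊤ : ℕ∞) V₀) (hg : ContDiff ℝ (⊤ : ℕ∞) g)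
    (V : EuclideanSpace ℝ (Fin d) → ℝ) (hV : ∀ y, V y = w y * ‖g y‖ + V₀ y)
    (x₀ ξ₀ : EuclideanSpace ℝ (Fin d)) (hgx₀ : g x₀ = 0) (hdg : fderiv ℝ g x₀ ξ₀ ≠ 0) :
    ∃ τ₀ > (0:ℝ), ∃ γ : ℝ → EuclideanSpace ℝ (Fin d) × EuclideanSpace ℝ (Fin d),
      (∃ K : NNReal, LipschitzOnWith K γ (Set.Icc (-τ₀) τ₀)) ∧
      γ 0 = (x₀, ξ₀) ∧
      (∀ t ∈ Set.Icc (-τ₀) τ₀, t ≠ 0 →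
        g (γ t).1 ≠ 0 ∧ HasDerivAt γ ((γ t).2, -gradient V (γ t).1) t) ∧
      (∀ τ₁ > (0:ℝ), ∀ γ' : ℝ → EuclideanSpace ℝ (Fin d) × EuclideanSpace ℝ (Fin d),
        (∃ K : NNReal, LipschitzOnWith K γ' (Set.Icc (-τ₁) τ₁)) →
        γ' 0 = (x₀, ξ₀) →
        (∀ t ∈ Set.Icc (-τ₁) τ₁, t ≠ 0 →
          g (γ' t).1 ≠ 0 ∧ HasDerivAt γ' ((γ' t).2, -gradient V (γ' t).1) t) →
        ∀ t ∈ Set.Icc (-(min τ₀ τ₁)) (min τ₀ τ₁), γ' t = γ t) := by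
  obtain rfl : V = fun y => w y * ‖g y‖ + V₀ y := funext hV
  obtain ⟨r, τ, M, L, hcone⟩ := exists_isConicalField_neg_gradient hw hV₀ hg hgx₀ hdg
  have hlip : ∀ x, g x ≠ 0 → ∃ K, ∃ N ∈ 𝓝 x,
      LipschitzOnWith K (fun x => -gradient (fun y => w y * ‖g y‖ + V₀ y) x) N := by
    intro x hx
    obtain ⟨K, N, hN, hK⟩ := exists_lipschitzOnWith_gradient
      ((contDiffAt_mul_norm_add hw hV₀ hg hx).of_le
        (WithTop.coe_le_coe.2 (le_top : (2 : ℕ∞) ≤ ⊤)))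
    exact ⟨K, N, hN, hK.neg⟩
  have hcont : ContinuousOn (fun x => -gradient (fun y => w y * ‖g y‖ + V₀ y) x)
      {x | g x ≠ 0} := by
    intro x hx
    obtain ⟨K, N, hN, hK⟩ := hlip x hx
    exact (hK.continuousOn.continuousAt hN).continuousWithinAt
  obtain ⟨τ₀, hτ₀, γ, ⟨K, hK⟩, h0, hγ⟩ := hcone.exists_trajectory hcont
  refine ⟨τ₀, hτ₀, γ, ⟨K, hK.lipschitzOnWith⟩, h0,
    fun t ht ht0 => hγ t (abs_le.2 ht) ht0, ?_⟩
  rintro τ₁ hτ₁ γ' ⟨K', hK'⟩ h0' hγ'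
  have hle₀ : ∀ t ∈ Icc (-(min τ₀ τ₁)) (min τ₀ τ₁), |t| ≤ τ₀ := fun t ht =>
    (abs_le.2 ht).trans (min_le_left _ _)
  have hle₁ : ∀ t ∈ Icc (-(min τ₀ τ₁)) (min τ₀ τ₁), t ∈ Icc (-τ₁) τ₁ := fun t ht =>
    abs_le.1 ((abs_le.2 ht).trans (min_le_right _ _))
  exact hcone.eqOn hlip (lt_min hτ₀ hτ₁)
    (hK'.continuousOn.continuousAt (Icc_mem_nhds (by linarith) hτ₁)) hK.continuous.continuousAt
    h0' h0 (fun t ht ht0 => (hγ' t (hle₁ t ht) ht0).1)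
    (fun t ht ht0 => (hγ' t (hle₁ t ht) ht0).2) (fun t ht ht0 => (hγ t (hle₀ t ht) ht0).2)
end

section
/- Let x₀ ∈ ℝ^d with g(x₀) = 0 and ξ₀ ∈ ℝ^d with dg(x₀)ξ₀ ≠ 0. Suppose τ > 0 and x : [−τ, τ] → ℝ^d is Lipschitz with x(0) = x₀, g(x_t) ≠ 0 for t ≠ 0, and x is differentiable at every t ≠ 0 with ẋ_t = ξ_t, where ξ : [−τ, τ] → ℝ^d is continuous with ξ(0) = ξ₀. Then g(x_t)/|g(x_t)| converges to ω₀ := dg(x₀)ξ₀/|dg(x₀)ξ₀| as t → 0⁺, and to −ω₀ as t → 0⁻. -/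
/-- If `f` vanishes at `0` with nonzero right derivative `v`, then `f t / ‖f t‖ → v / ‖v‖` as
`t → 0⁺`. -/
theorem HasDerivWithinAt.tendsto_normalize_nhdsGT {E : Type*} [NormedAddCommGroup E]
    [NormedSpace ℝ E] {f : ℝ → E} {v : E} (hf : HasDerivWithinAt f v (Set.Ioi 0) 0)
    (h0 : f 0 = 0) (hv : v ≠ 0) :
    Filter.Tendsto (fun t => ‖f t‖⁻¹ • f t) (nhdsWithin 0 (Set.Ioi 0))
      (nhds (‖v‖⁻¹ • v)) := by
  have hs := (hasDerivWithinAt_iff_tendsto_slope' Set.self_notMem_Ioi).1 hf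
  refine ((hs.norm.inv₀ (norm_ne_zero_iff.2 hv)).smul hs).congr' ?_
  filter_upwards [self_mem_nhdsWithin] with t (ht : 0 < t)
  rw [slope_def_module, h0, sub_zero, sub_zero, norm_smul, norm_inv, Real.norm_of_nonneg ht.le,
    mul_inv, inv_inv, smul_smul]
  congr 1
  field_simp

/-- If `f` vanishes at `0` with nonzero left derivative `v`, then `f t / ‖f t‖ → -(v / ‖v‖)` as
`t → 0⁻`. -/
theorem HasDerivWithinAt.tendsto_normalize_nhdsLT {E : Type*} [NormedAddCommGroup E]
    [NormedSpace ℝ E] {f : ℝ → E} {v : E} (hf : HasDerivWithinAt f v (Set.Iio 0) 0)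
    (h0 : f 0 = 0) (hv : v ≠ 0) :
    Filter.Tendsto (fun t => ‖f t‖⁻¹ • f t) (nhdsWithin 0 (Set.Iio 0))
      (nhds (-(‖v‖⁻¹ • v))) := by
  have hs := (hasDerivWithinAt_iff_tendsto_slope' Set.self_notMem_Iio).1 hf
  refine ((hs.norm.inv₀ (norm_ne_zero_iff.2 hv)).smul hs).neg.congr' ?_
  filter_upwards [self_mem_nhdsWithin] with t (ht : t < 0)
  rw [slope_def_module, h0, sub_zero, sub_zero, norm_smul, norm_inv, Real.norm_of_nonpos ht.le,
    mul_inv, inv_inv, smul_smul, ← neg_smul]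
  congr 1
  field_simp [ht.ne]

/-- Along a Lipschitz trajectory through (x₀,ξ₀) ∈ S* with ẋ_t = ξ_t and g(x_t) ≠ 0 for
t ≠ 0, the unit vector g(x_t)/|g(x_t)| tends to ω₀ = dg(x₀)ξ₀/|dg(x₀)ξ₀| as t → 0⁺,
and to −ω₀ as t → 0⁻. -/
theorem stmt1 (d p : ℕ) (hd : 1 ≤ d) (hp : 1 ≤ p) (hpd : p ≤ d)
    (g : EuclideanSpace ℝ (Fin d) → EuclideanSpace ℝ (Fin p)) (hg : ContDiff ℝ (⊤ : ℕ∞) g)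
    (x₀ ξ₀ : EuclideanSpace ℝ (Fin d)) (hgx₀ : g x₀ = 0) (hdg : fderiv ℝ g x₀ ξ₀ ≠ 0)
    (τ : ℝ) (hτ : 0 < τ)
    (x ξ : ℝ → EuclideanSpace ℝ (Fin d))
    (K : NNReal) (hxLip : LipschitzOnWith K x (Set.Icc (-τ) τ))
    (hx0 : x 0 = x₀)
    (hne : ∀ t ∈ Set.Icc (-τ) τ, t ≠ 0 → g (x t) ≠ 0)
    (hξcont : ContinuousOn ξ (Set.Icc (-τ) τ)) (hξ0 : ξ 0 = ξ₀)
    (hode : ∀ t ∈ Set.Icc (-τ) τ, t ≠ 0 → HasDerivAt x (ξ t) t) :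
    Filter.Tendsto (fun t => ‖g (x t)‖⁻¹ • g (x t)) (nhdsWithin 0 (Set.Ioc 0 τ))
        (nhds (‖fderiv ℝ g x₀ ξ₀‖⁻¹ • fderiv ℝ g x₀ ξ₀)) ∧
      Filter.Tendsto (fun t => ‖g (x t)‖⁻¹ • g (x t)) (nhdsWithin 0 (Set.Ico (-τ) 0))
        (nhds (-(‖fderiv ℝ g x₀ ξ₀‖⁻¹ • fderiv ℝ g x₀ ξ₀))) := by
  have hIoc : Set.Ioc 0 τ ∈ nhdsWithin (0 : ℝ) (Set.Ioi 0) := Ioc_mem_nhdsGT hτ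
  have hIco : Set.Ico (-τ) 0 ∈ nhdsWithin (0 : ℝ) (Set.Iio 0) := Ico_mem_nhdsLT (by linarith)
  have hsubR : Set.Ioc 0 τ ⊆ Set.Icc (-τ) τ := fun t ht => ⟨by linarith [ht.1], ht.2⟩
  have hsubL : Set.Ico (-τ) 0 ⊆ Set.Icc (-τ) τ := fun t ht => ⟨ht.1, by linarith [ht.2]⟩
  have h0mem : (0 : ℝ) ∈ Set.Icc (-τ) τ := ⟨by linarith, hτ.le⟩
  have hξ : Filter.Tendsto ξ (nhds 0) (nhds ξ₀) := by
    have := hξcont.continuousAt (Icc_mem_nhds (neg_lt_zero.2 hτ) hτ)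
    rwa [ContinuousAt, hξ0] at this
  have hxcont : ContinuousWithinAt x (Set.Icc (-τ) τ) 0 := hxLip.continuousOn 0 h0mem
  have hR : HasDerivWithinAt x ξ₀ (Set.Ici 0) 0 := by
    refine hasDerivWithinAt_Ici_of_tendsto_deriv (s := Set.Ioc 0 τ)
      (fun t ht => (hode t (hsubR ht) ht.1.ne').differentiableAt.differentiableWithinAt)
      (hxcont.mono hsubR) hIoc ((hξ.mono_left nhdsWithin_le_nhds).congr' ?_)
    filter_upwards [hIoc] with t ht using (hode t (hsubR ht) ht.1.ne').deriv.symm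
  have hL : HasDerivWithinAt x ξ₀ (Set.Iic 0) 0 := by
    refine hasDerivWithinAt_Iic_of_tendsto_deriv (s := Set.Ico (-τ) 0)
      (fun t ht => (hode t (hsubL ht) ht.2.ne).differentiableAt.differentiableWithinAt)
      (hxcont.mono hsubL) hIco ((hξ.mono_left nhdsWithin_le_nhds).congr' ?_)
    filter_upwards [hIco] with t ht using (hode t (hsubL ht) ht.2.ne).deriv.symm
  have hgd : HasFDerivAt g (fderiv ℝ g x₀) (x 0) := by
    rw [hx0]
    exact (hg.differentiable (by simp) x₀).hasFDerivAt
  have hgx0 : (g ∘ x) 0 = 0 := by simp [hx0, hgx₀]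
  exact ⟨((hgd.comp_hasDerivWithinAt 0 (hR.mono Set.Ioi_subset_Ici_self)).tendsto_normalize_nhdsGT
      hgx0 hdg).mono_left (nhdsWithin_mono 0 Set.Ioc_subset_Ioi_self),
    ((hgd.comp_hasDerivWithinAt 0 (hL.mono Set.Iio_subset_Iic_self)).tendsto_normalize_nhdsLT
      hgx0 hdg).mono_left (nhdsWithin_mono 0 Set.Ico_subset_Iio_self)⟩
end

section
/- Let (x₀, ξ₀) with g(x₀) = 0 and dg(x₀)ξ₀ ≠ 0, and set ω₀ = dg(x₀)ξ₀/|dg(x₀)ξ₀|. Suppose τ > 0 and γ : [−τ, τ] → ℝ^d × ℝ^d, γ(t) = (x_t, ξ_t), is Lipschitz with γ(0) = (x₀, ξ₀), g(x_t) ≠ 0 for t ≠ 0, and for every t ≠ 0, γ is differentiable at t with ẋ_t = ξ_t and ξ̇_t = −∇V(x_t). Then ẋ_t → ξ₀ as t → 0, and ξ̇_t → −∇V₀(x₀) − w(x₀)·(dg(x₀))^T ω₀ as t → 0⁺, while ξ̇_t → −∇V₀(x₀) + w(x₀)·(dg(x₀))^T ω₀ as t → 0⁻. -/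
open Filter Topology Set in
/-- If `f` has derivative `g` on a punctured neighbourhood of `x`, and both functions are continuous
at `x`, then `g x` is the derivative of `f` at `x`. -/
theorem hasDerivAt_of_eventually_hasDerivAt_nhdsNE {E : Type*} [NormedAddCommGroup E]
    [NormedSpace ℝ E] {f g : ℝ → E} {x : ℝ} (h : ∀ᶠ y in 𝓝[≠] x, HasDerivAt f (g y) y)
    (hf : ContinuousAt f x) (hg : ContinuousAt g x) : HasDerivAt f (g x) x := by
  have hgt := h.filter_mono (nhdsWithin_mono x fun y (hy : x < y) => hy.ne')
  have hlt := h.filter_mono (nhdsWithin_mono x fun y (hy : y < x) => hy.ne)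
  have hr : HasDerivWithinAt f (g x) (Ici x) x :=
    hasDerivWithinAt_Ici_of_tendsto_deriv
      (fun y hy => HasDerivAt.differentiableAt hy |>.differentiableWithinAt)
      hf.continuousWithinAt hgt
      ((tendsto_inf_left hg).congr' (hgt.mono fun y hy => hy.deriv.symm))
  have hl : HasDerivWithinAt f (g x) (Iic x) x :=
    hasDerivWithinAt_Iic_of_tendsto_deriv
      (fun y hy => HasDerivAt.differentiableAt hy |>.differentiableWithinAt)
      hf.continuousWithinAt hlt
      ((tendsto_inf_left hg).congr' (hlt.mono fun y hy => hy.deriv.symm))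
  simpa using hl.union hr

open Filter Topology in
/-- The direction of a curve leaving the origin with nonzero velocity `v` tends to that of `v`. -/
theorem HasDerivAt.tendsto_inv_norm_smul_nhdsGT {E : Type*} [NormedAddCommGroup E]
    [NormedSpace ℝ E] {y : ℝ → E} {v : E} (h : HasDerivAt y v 0) (hy : y 0 = 0) (hv : v ≠ 0) :
    Tendsto (fun t => ‖y t‖⁻¹ • y t) (𝓝[>] 0) (𝓝 (‖v‖⁻¹ • v)) := by
  have hs : Tendsto (slope y 0) (𝓝[>] 0) (𝓝 v) :=
    h.tendsto_slope.mono_left (nhdsWithin_mono 0 fun t (ht : 0 < t) => ht.ne')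
  refine ((hs.norm.inv₀ (norm_ne_zero_iff.2 hv)).smul hs).congr' ?_
  filter_upwards [self_mem_nhdsWithin] with t (ht : 0 < t)
  rw [slope_def_module, hy, sub_zero, sub_zero, norm_smul, norm_inv, Real.norm_of_nonneg ht.le,
    mul_inv, inv_inv, smul_smul, mul_right_comm, mul_inv_cancel₀ ht.ne', one_mul]

open Filter Topology in
/-- The direction of a curve reaching the origin with nonzero velocity `v` tends to the opposite
of that of `v`. -/
theorem HasDerivAt.tendsto_inv_norm_smul_nhdsLT {E : Type*} [NormedAddCommGroup E]
    [NormedSpace ℝ E] {y : ℝ → E} {v : E} (h : HasDerivAt y v 0) (hy : y 0 = 0) (hv : v ≠ 0) :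
    Tendsto (fun t => ‖y t‖⁻¹ • y t) (𝓝[<] 0) (𝓝 (-(‖v‖⁻¹ • v))) := by
  have hs : Tendsto (slope y 0) (𝓝[<] 0) (𝓝 v) :=
    h.tendsto_slope.mono_left (nhdsWithin_mono 0 fun t (ht : t < 0) => ht.ne)
  refine ((hs.norm.inv₀ (norm_ne_zero_iff.2 hv)).smul hs).neg.congr' ?_
  filter_upwards [self_mem_nhdsWithin] with t (ht : t < 0)
  rw [slope_def_module, hy, sub_zero, sub_zero, norm_smul, norm_inv, Real.norm_of_nonpos ht.le,
    mul_inv, inv_inv, smul_smul, mul_right_comm, neg_mul, mul_inv_cancel₀ ht.ne, neg_one_mul,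
    neg_smul, neg_neg]

open Filter Topology in
theorem Filter.Tendsto.clm_apply_nhds {α E F : Type*} [NormedAddCommGroup E] [NormedSpace ℝ E]
    [NormedAddCommGroup F] [NormedSpace ℝ F] {l : Filter α} {A : α → E →L[ℝ] F} {A₀ : E →L[ℝ] F}
    {v : α → E} {v₀ : E} (hA : Tendsto A l (𝓝 A₀)) (hv : Tendsto v l (𝓝 v₀)) :
    Tendsto (fun t => A t (v t)) l (𝓝 (A₀ v₀)) :=
  have hc : Continuous fun q : (E →L[ℝ] F) × E => q.1 q.2 :=
    continuous_fst.clm_apply continuous_snd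
  (hc.tendsto (A₀, v₀)).comp (hA.prodMk_nhds hv)

section Gradient

variable {E F : Type*} [NormedAddCommGroup E] [InnerProductSpace ℝ E] [CompleteSpace E]
  [NormedAddCommGroup F] [InnerProductSpace ℝ F] [CompleteSpace F]

theorem ContDiff.continuous_gradient {f : E → ℝ} {n : WithTop ℕ∞} (hf : ContDiff ℝ n f)
    (hn : n ≠ 0) : Continuous (gradient f) :=
  (InnerProductSpace.toDual ℝ E).symm.continuous.comp (hf.continuous_fderiv hn)

theorem HasFDerivAt.hasGradientAt_norm {g : E → F} {g' : E →L[ℝ] F} {y : E}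
    (hg : HasFDerivAt g g' y) (h0 : g y ≠ 0) :
    HasGradientAt (fun z => ‖g z‖) (ContinuousLinearMap.adjoint g' (‖g y‖⁻¹ • g y)) y := by
  have hn : ‖g y‖ ≠ 0 := norm_ne_zero_iff.2 h0
  have h := hg.norm_sq.sqrt (pow_ne_zero 2 hn)
  simp only [Real.sqrt_sq (norm_nonneg _)] at h
  rw [hasGradientAt_iff_hasFDerivAt]
  refine h.congr_fderiv ?_
  ext v
  simp [ContinuousLinearMap.adjoint_inner_left]
  ring

theorem gradient_mul_norm_add {w V₀ : E → ℝ} {g : E → F} {y : E}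
    (hw : DifferentiableAt ℝ w y) (hV₀ : DifferentiableAt ℝ V₀ y) (hg : DifferentiableAt ℝ g y)
    (h0 : g y ≠ 0) :
    gradient (fun z => w z * ‖g z‖ + V₀ z) y =
      w y • ContinuousLinearMap.adjoint (fderiv ℝ g y) (‖g y‖⁻¹ • g y) +
        ‖g y‖ • gradient w y + gradient V₀ y := by
  apply HasGradientAt.gradient
  have h := (hw.hasGradientAt.hasFDerivAt.mul
    (hg.hasFDerivAt.hasGradientAt_norm h0).hasFDerivAt).add hV₀.hasGradientAt.hasFDerivAt
  rw [hasGradientAt_iff_hasFDerivAt]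
  refine h.congr_fderiv ?_
  simp only [map_add, map_smulₛₗ, conj_trivial]

open Filter Topology in
/-- If `u` approaches a zero of `g` along which the direction of `g` converges, then the gradient
of `w * ‖g‖ + V₀` converges along `u`. -/
theorem tendsto_gradient_mul_norm_add {α : Type*} {l : Filter α} {w V₀ : E → ℝ} {g : E → F}
    {n : WithTop ℕ∞} (hn : n ≠ 0) (hw : ContDiff ℝ n w) (hV₀ : ContDiff ℝ n V₀)
    (hg : ContDiff ℝ n g) {u : α → E} {x₀ : E} {ω : F} (hu : Tendsto u l (𝓝 x₀))
    (hx₀ : g x₀ = 0) (hne : ∀ᶠ t in l, g (u t) ≠ 0)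
    (hω : Tendsto (fun t => ‖g (u t)‖⁻¹ • g (u t)) l (𝓝 ω)) :
    Tendsto (fun t => gradient (fun z => w z * ‖g z‖ + V₀ z) (u t)) l
      (𝓝 (w x₀ • ContinuousLinearMap.adjoint (fderiv ℝ g x₀) ω + gradient V₀ x₀)) := by
  have hadj : Tendsto (fun t => ContinuousLinearMap.adjoint (fderiv ℝ g (u t))) l
      (𝓝 (ContinuousLinearMap.adjoint (fderiv ℝ g x₀))) :=
    (((ContinuousLinearMap.adjoint (𝕜 := ℝ) (E := E) (F := F)).continuous.comp
      (hg.continuous_fderiv hn)).tendsto x₀).comp hu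
  have happ : Tendsto
      (fun t => ContinuousLinearMap.adjoint (fderiv ℝ g (u t)) (‖g (u t)‖⁻¹ • g (u t))) l
      (𝓝 (ContinuousLinearMap.adjoint (fderiv ℝ g x₀) ω)) :=
    Filter.Tendsto.clm_apply_nhds hadj hω
  have hwu : Tendsto (fun t => w (u t)) l (𝓝 (w x₀)) := (hw.continuous.tendsto x₀).comp hu
  have hgu : Tendsto (fun t => ‖g (u t)‖) l (𝓝 0) := by
    have hgn := (hg.continuous.norm.tendsto x₀).comp hu
    rwa [hx₀, norm_zero] at hgn
  have hdw : Tendsto (fun t => gradient w (u t)) l (𝓝 (gradient w x₀)) :=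
    ((hw.continuous_gradient hn).tendsto x₀).comp hu
  have hdV : Tendsto (fun t => gradient V₀ (u t)) l (𝓝 (gradient V₀ x₀)) :=
    ((hV₀.continuous_gradient hn).tendsto x₀).comp hu
  have h := ((hwu.smul happ).add (hgu.smul hdw)).add hdV
  rw [zero_smul, add_zero] at h
  refine h.congr' (hne.mono fun t ht => ?_)
  exact (gradient_mul_norm_add (hw.differentiable hn _) (hV₀.differentiable hn _)
    (hg.differentiable hn _) ht).symm

end Gradient

/-- Along a Lipschitz trajectory through (x₀,ξ₀) ∈ S* solving the Hamiltonian system for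
t ≠ 0, one has ẋ_t → ξ₀ as t → 0 and ξ̇_t = −∇V(x_t) → −∇V₀(x₀) ∓ w(x₀)·(dg(x₀))^T ω₀
as t → 0^±, where ω₀ = dg(x₀)ξ₀/|dg(x₀)ξ₀|. -/
theorem stmt2 (d p : ℕ) (hd : 1 ≤ d) (hp : 1 ≤ p) (hpd : p ≤ d)
    (w V₀ : EuclideanSpace ℝ (Fin d) → ℝ)
    (g : EuclideanSpace ℝ (Fin d) → EuclideanSpace ℝ (Fin p))
    (hw : ContDiff ℝ (⊤ : ℕ∞) w) (hV₀ : ContDiff ℝ (⊤ : ℕ∞) V₀) (hg : ContDiff ℝ (⊤ : ℕ∞) g)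
    (V : EuclideanSpace ℝ (Fin d) → ℝ) (hV : ∀ y, V y = w y * ‖g y‖ + V₀ y)
    (x₀ ξ₀ : EuclideanSpace ℝ (Fin d)) (hgx₀ : g x₀ = 0) (hdg : fderiv ℝ g x₀ ξ₀ ≠ 0)
    (ω₀ : EuclideanSpace ℝ (Fin p))
    (hω₀ : ω₀ = ‖fderiv ℝ g x₀ ξ₀‖⁻¹ • fderiv ℝ g x₀ ξ₀)
    (τ : ℝ) (hτ : 0 < τ)
    (x ξ : ℝ → EuclideanSpace ℝ (Fin d))
    (K : NNReal)
    (hLip : LipschitzOnWith K (fun t => (x t, ξ t)) (Set.Icc (-τ) τ))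
    (hx0 : x 0 = x₀) (hξ0 : ξ 0 = ξ₀)
    (hne : ∀ t ∈ Set.Icc (-τ) τ, t ≠ 0 → g (x t) ≠ 0)
    (hode : ∀ t ∈ Set.Icc (-τ) τ, t ≠ 0 →
      HasDerivAt x (ξ t) t ∧ HasDerivAt ξ (-gradient V (x t)) t) :
    Filter.Tendsto (fun t => ξ t) (nhdsWithin 0 (Set.Icc (-τ) τ \ {0})) (nhds ξ₀) ∧
      Filter.Tendsto (fun t => -gradient V (x t)) (nhdsWithin 0 (Set.Ioc 0 τ))
        (nhds (-gradient V₀ x₀ - w x₀ • (ContinuousLinearMap.adjoint (fderiv ℝ g x₀)) ω₀)) ∧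
      Filter.Tendsto (fun t => -gradient V (x t)) (nhdsWithin 0 (Set.Ico (-τ) 0))
        (nhds (-gradient V₀ x₀ + w x₀ • (ContinuousLinearMap.adjoint (fderiv ℝ g x₀)) ω₀)) := by
  have hI : Set.Icc (-τ) τ ∈ nhds (0 : ℝ) := Icc_mem_nhds (neg_lt_zero.2 hτ) hτ
  have hcont : ContinuousAt (fun t => (x t, ξ t)) 0 := hLip.continuousOn.continuousAt hI
  have hxc : ContinuousAt x 0 := hcont.fst
  have hξc : ContinuousAt ξ 0 := hcont.snd
  have hx' : HasDerivAt x ξ₀ 0 := by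
    rw [← hξ0]
    refine hasDerivAt_of_eventually_hasDerivAt_nhdsNE ?_ hxc hξc
    filter_upwards [nhdsWithin_le_nhds hI, self_mem_nhdsWithin] with t ht ht0
    exact (hode t ht ht0).1
  have hgx' : HasDerivAt (fun t => g (x t)) (fderiv ℝ g x₀ ξ₀) 0 := by
    have hgd : HasFDerivAt g (fderiv ℝ g x₀) (x 0) := by
      rw [hx0]
      exact (hg.differentiable (by simp) x₀).hasFDerivAt
    exact hgd.comp_hasDerivAt 0 hx'
  have hgx0 : g (x 0) = 0 := by rw [hx0, hgx₀]
  rw [ContinuousAt, hx0] at hxc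
  rw [ContinuousAt, hξ0] at hξc
  obtain rfl : V = fun y => w y * ‖g y‖ + V₀ y := funext hV
  refine ⟨hξc.mono_left nhdsWithin_le_nhds, ?_, ?_⟩
  · have h := tendsto_gradient_mul_norm_add (l := nhdsWithin 0 (Set.Ioc 0 τ)) (by simp) hw hV₀ hg
      (hxc.mono_left nhdsWithin_le_nhds) hgx₀
      (eventually_nhdsWithin_of_forall fun t ht =>
        hne t ⟨(neg_lt_zero.2 hτ).le.trans ht.1.le, ht.2⟩ ht.1.ne')
      ((hgx'.tendsto_inv_norm_smul_nhdsGT hgx0 hdg).mono_left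
        (nhdsWithin_mono 0 Set.Ioc_subset_Ioi_self))
    rw [← neg_add', add_comm, hω₀]
    exact h.neg
  · have h := tendsto_gradient_mul_norm_add (l := nhdsWithin 0 (Set.Ico (-τ) 0)) (by simp) hw hV₀ hg
      (hxc.mono_left nhdsWithin_le_nhds) hgx₀
      (eventually_nhdsWithin_of_forall fun t ht =>
        hne t ⟨ht.1, ht.2.le.trans hτ.le⟩ ht.2.ne)
      ((hgx'.tendsto_inv_norm_smul_nhdsLT hgx0 hdg).mono_left
        (nhdsWithin_mono 0 Set.Ico_subset_Iio_self))
    rw [map_neg, smul_neg] at h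
    rw [hω₀, ← sub_eq_neg_add, ← neg_sub, sub_eq_neg_add]
    exact h.neg
end

section
/- Let (x₀, ξ₀) ∈ S*. Then there exist τ₀ > 0, an open neighborhood Ω of (x₀, ξ₀) in ℝ^d × ℝ^d with Ω ∩ S ⊂ S*, and a continuous map Φ : [−τ₀, τ₀] × Ω → ℝ^d × ℝ^d such that for every (x, ξ) ∈ Ω, writing Φ(t, x, ξ) = (X_t, Ξ_t): (i) Φ(0, x, ξ) = (x, ξ); (ii) t ↦ Φ(t, x, ξ) is Lipschitz on [−τ₀, τ₀]; (iii) the set {t ∈ [−τ₀, τ₀] : g(X_t) = 0} contains at most one element; (iv) at every t with g(X_t) ≠ 0 the curve is differentiable with Ẋ_t = Ξ_t, Ξ̇_t = −∇V(X_t). Moreover for each (x, ξ) ∈ Ω, t ↦ Φ(t, x, ξ) is the unique Lipschitz curve on [−τ₀, τ₀] through (x, ξ) at t = 0 satisfying (iii) and (iv). -/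
section Transversal

open Set Filter Topology Metric MeasureTheory
open scoped NNReal

theorem norm_sub_le_of_norm_hasDerivAt_Ioo_le {E : Type*} [NormedAddCommGroup E]
    [NormedSpace ℝ E] {f f' : ℝ → E} {a b C : ℝ} (hab : a ≤ b) (hf : ContinuousOn f (Icc a b))
    (hderiv : ∀ t ∈ Ioo a b, HasDerivAt f (f' t) t) (hC : ∀ t ∈ Ioo a b, ‖f' t‖ ≤ C) :
    ‖f b - f a‖ ≤ C * (b - a) := by
  rcases hab.eq_or_lt with rfl | hab
  · simp
  have hC0 : 0 ≤ C := by
    obtain ⟨t, ht⟩ := nonempty_Ioo.2 hab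
    exact (norm_nonneg _).trans (hC t ht)
  have hlip : LipschitzOnWith C.toNNReal f (Ioo a b) :=
    (convex_Ioo a b).lipschitzOnWith_of_nnnorm_hasDerivWithin_le
      (fun t ht => (hderiv t ht).hasDerivWithinAt)
      (fun t ht => by
        rw [← NNReal.coe_le_coe, coe_nnnorm, Real.coe_toNNReal _ hC0]; exact hC t ht)
  have hcl : closure (Ioo a b) = Icc a b := closure_Ioo hab.ne
  have hlip' := LipschitzOnWith.closure (hcl ▸ hf) hlip
  rw [hcl] at hlip'
  have := hlip'.norm_sub_le (right_mem_Icc.2 hab.le) (left_mem_Icc.2 hab.le)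
  rwa [Real.coe_toNNReal _ hC0, Real.norm_of_nonneg (by linarith)] at this

/-- The map `F` is Lipschitz near every point, with a constant that may blow up like the
inverse of `‖g‖`. -/
def SingularLipschitz {E Y : Type*} [NormedAddCommGroup E] [NormedAddCommGroup Y]
    (F : E → E) (g : E → Y) : Prop :=
  ∀ x, ∃ C : ℝ, 0 ≤ C ∧ ∃ s ∈ 𝓝 x, ∀ a ∈ s, ∀ b ∈ s, g a ≠ 0 → g b ≠ 0 →
    ‖F a - F b‖ ≤ C * (1 + ‖g a‖⁻¹) * ‖a - b‖

section Uniqueness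

variable {E Y : Type*} [NormedAddCommGroup E] [NormedSpace ℝ E] [NormedAddCommGroup Y]
  [NormedSpace ℝ Y] {F : E → E} {g : E → Y} {γ γ₁ γ₂ : ℝ → E × E} {b t₀ : ℝ}

omit [NormedSpace ℝ E] [NormedSpace ℝ Y] in
theorem eventually_ne_zero_of_subsingleton (hg : Continuous g) (hγ : ContinuousOn γ (Icc 0 b))
    (hsub : Set.Subsingleton {t | t ∈ Icc 0 b ∧ g (γ t).1 = 0}) (ht₀ : t₀ ∈ Ico 0 b) :
    ∀ᶠ t in 𝓝[>] t₀, g (γ t).1 ≠ 0 := by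
  have hI : Ioo t₀ b ∈ 𝓝[>] t₀ := Ioo_mem_nhdsGT ht₀.2
  have hcont : Tendsto γ (𝓝[>] t₀) (𝓝 (γ t₀)) :=
    (hγ t₀ ⟨ht₀.1, ht₀.2.le⟩).mono_of_mem_nhdsWithin
      (mem_of_superset hI fun t ht => ⟨ht₀.1.trans ht.1.le, ht.2.le⟩)
  by_cases h : g (γ t₀).1 = 0
  · filter_upwards [hI] with t ht h0
    have := hsub ⟨⟨ht₀.1.trans ht.1.le, ht.2.le⟩, h0⟩ ⟨⟨ht₀.1, ht₀.2.le⟩, h⟩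
    exact ht.1.ne' this
  · exact (((hg.comp continuous_fst).tendsto _).comp hcont).eventually_ne h

theorem eventually_le_norm_of_transversal (hg : ContDiff ℝ 1 g) (hγ : ContinuousOn γ (Icc 0 b))
    (hsub : Set.Subsingleton {t | t ∈ Icc 0 b ∧ g (γ t).1 = 0})
    (hder : ∀ t ∈ Icc 0 b, g (γ t).1 ≠ 0 → HasDerivAt γ ((γ t).2, F (γ t).1) t)
    (htr : ∀ t ∈ Icc 0 b, g (γ t).1 = 0 → fderiv ℝ g (γ t).1 (γ t).2 ≠ 0)
    (ht₀ : t₀ ∈ Ico 0 b) :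
    ∃ c > 0, ∀ᶠ t in 𝓝[>] t₀, c * (t - t₀) ≤ ‖g (γ t).1‖ := by
  have hI : Ioo t₀ b ∈ 𝓝[>] t₀ := Ioo_mem_nhdsGT ht₀.2
  have hcont : Tendsto γ (𝓝[>] t₀) (𝓝 (γ t₀)) :=
    (hγ t₀ ⟨ht₀.1, ht₀.2.le⟩).mono_of_mem_nhdsWithin
      (mem_of_superset hI fun t ht => ⟨ht₀.1.trans ht.1.le, ht.2.le⟩)
  by_cases h : g (γ t₀).1 = 0
  · have hne := eventually_ne_zero_of_subsingleton hg.continuous hγ hsub ht₀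
    obtain ⟨s, hs, hsne⟩ := hne.exists_mem
    have hd : ∀ t ∈ Ioo t₀ b ∩ s, HasDerivAt (fun t => (γ t).1) (γ t).2 t := fun t ht =>
      (hder t ⟨ht₀.1.trans ht.1.1.le, ht.1.2.le⟩ (hsne t ht.2)).fst
    have hX : HasDerivWithinAt (fun t => (γ t).1) (γ t₀).2 (Ici t₀) t₀ := by
      refine hasDerivWithinAt_Ici_of_tendsto_deriv (s := Ioo t₀ b ∩ s)
        (fun t ht => (hd t ht).differentiableAt.differentiableWithinAt) ?_
        (inter_mem hI hs) ?_
      · exact continuous_fst.continuousAt.comp_continuousWithinAt ((hγ t₀ ⟨ht₀.1, ht₀.2.le⟩).mono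
          fun t ht => ⟨ht₀.1.trans ht.1.1.le, ht.1.2.le⟩)
      · refine ((continuous_snd.tendsto _).comp hcont).congr' ?_
        filter_upwards [inter_mem hI hs] with t ht using (hd t ht).deriv.symm
    have hy : HasDerivWithinAt (fun t => g (γ t).1) (fderiv ℝ g (γ t₀).1 (γ t₀).2) (Ioi t₀) t₀ :=
      (((hg.differentiable one_ne_zero _).hasFDerivAt).comp_hasDerivWithinAt t₀ hX).mono
        Ioi_subset_Ici_self
    have hv := norm_pos_iff.2 (htr t₀ ⟨ht₀.1, ht₀.2.le⟩ h)
    refine ⟨_, half_pos hv, ?_⟩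
    rw [hasDerivWithinAt_iff_tendsto_slope' self_notMem_Ioi] at hy
    filter_upwards [hy.norm.eventually_const_lt (half_lt_self hv), self_mem_nhdsWithin]
      with t ht htt
    have h0 : 0 < t - t₀ := sub_pos.2 htt
    rw [slope_def_module, h, sub_zero, norm_smul, norm_inv, Real.norm_of_nonneg h0.le,
      inv_mul_eq_div, lt_div_iff₀ h0] at ht
    exact ht.le
  · have hv := norm_pos_iff.2 h
    refine ⟨_, half_pos hv, ?_⟩
    have h1 : Tendsto (fun t => ‖g (γ t).1‖) (𝓝[>] t₀) (𝓝 ‖g (γ t₀).1‖) :=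
      ((hg.continuous.comp continuous_fst).tendsto _ |>.comp hcont).norm
    have h2 : Ioo t₀ (t₀ + 1) ∈ 𝓝[>] t₀ := Ioo_mem_nhdsGT (by linarith)
    filter_upwards [h1.eventually_const_lt (half_lt_self hv), h2] with t ht ht2
    refine le_trans ?_ ht.le
    have : t - t₀ ≤ 1 := by linarith [ht2.2]
    nlinarith

theorem eventually_eq_right_of_eq (hF : SingularLipschitz F g) (hg : ContDiff ℝ 1 g)
    (hγ₁ : ContinuousOn γ₁ (Icc 0 b)) (hγ₂ : ContinuousOn γ₂ (Icc 0 b))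
    (hsub₁ : Set.Subsingleton {t | t ∈ Icc 0 b ∧ g (γ₁ t).1 = 0})
    (hsub₂ : Set.Subsingleton {t | t ∈ Icc 0 b ∧ g (γ₂ t).1 = 0})
    (hder₁ : ∀ t ∈ Icc 0 b, g (γ₁ t).1 ≠ 0 → HasDerivAt γ₁ ((γ₁ t).2, F (γ₁ t).1) t)
    (hder₂ : ∀ t ∈ Icc 0 b, g (γ₂ t).1 ≠ 0 → HasDerivAt γ₂ ((γ₂ t).2, F (γ₂ t).1) t)
    (htr₁ : ∀ t ∈ Icc 0 b, g (γ₁ t).1 = 0 → fderiv ℝ g (γ₁ t).1 (γ₁ t).2 ≠ 0)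
    (ht₀ : t₀ ∈ Ico 0 b) (heq : γ₁ t₀ = γ₂ t₀) :
    ∀ᶠ t in 𝓝[>] t₀, γ₁ t = γ₂ t := by
  have hI : Ioo t₀ b ∈ 𝓝[>] t₀ := Ioo_mem_nhdsGT ht₀.2
  have hcont : ∀ γ : ℝ → E × E, ContinuousOn γ (Icc 0 b) → Tendsto γ (𝓝[>] t₀) (𝓝 (γ t₀)) :=
    fun γ hγ => (hγ t₀ ⟨ht₀.1, ht₀.2.le⟩).mono_of_mem_nhdsWithin
      (mem_of_superset hI fun t ht => ⟨ht₀.1.trans ht.1.le, ht.2.le⟩)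
  obtain ⟨c, hc, hlow⟩ := eventually_le_norm_of_transversal hg hγ₁ hsub₁ hder₁ htr₁ ht₀
  obtain ⟨C, hC, s, hs, hFs⟩ := hF (γ₁ t₀).1
  have hs₁ : ∀ᶠ t in 𝓝[>] t₀, (γ₁ t).1 ∈ s :=
    ((continuous_fst.tendsto _).comp (hcont γ₁ hγ₁)).eventually_mem hs
  have hs₂ : ∀ᶠ t in 𝓝[>] t₀, (γ₂ t).1 ∈ s :=
    ((continuous_fst.tendsto _).comp (hcont γ₂ hγ₂)).eventually_mem (heq ▸ hs)
  have hC' : 0 < C * (1 + c⁻¹) + 1 := by positivity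
  set C' := C * (1 + c⁻¹) + 1 with hC'def
  have hall := hlow.and (hs₁.and (hs₂.and
    ((eventually_ne_zero_of_subsingleton hg.continuous hγ₁ hsub₁ ht₀).and
      (eventually_ne_zero_of_subsingleton hg.continuous hγ₂ hsub₂ ht₀))))
  obtain ⟨u, hu, hall⟩ := (mem_nhdsGT_iff_exists_Ioo_subset' ht₀.2).1 hall
  set η := min (min ((u - t₀) / 2) ((b - t₀) / 2)) (min 1 (1 / (2 * C'))) with hη
  have hηpos : 0 < η := by
    have := sub_pos.2 (mem_Ioi.1 hu)
    have := sub_pos.2 ht₀.2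
    positivity
  have hη1 : η ≤ 1 := (min_le_right _ _).trans (min_le_left _ _)
  have hηC : C' * η ≤ 1 / 2 := by
    have : η ≤ 1 / (2 * C') := (min_le_right _ _).trans (min_le_right _ _)
    calc C' * η ≤ C' * (1 / (2 * C')) := by gcongr
      _ = 1 / 2 := by field_simp
  have hηu : t₀ + η < u := by
    have : η ≤ (u - t₀) / 2 := (min_le_left _ _).trans (min_le_left _ _)
    have := sub_pos.2 (mem_Ioi.1 hu)
    linarith
  have hηb : t₀ + η < b := by
    have : η ≤ (b - t₀) / 2 := (min_le_left _ _).trans (min_le_right _ _)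
    have := sub_pos.2 ht₀.2
    linarith
  have hsubI : Icc t₀ (t₀ + η) ⊆ Icc 0 b := Icc_subset_Icc ht₀.1 hηb.le
  have hsubA : ∀ t ∈ Ioc t₀ (t₀ + η), t ∈ Ioo t₀ u := fun t ht => ⟨ht.1, ht.2.trans_lt hηu⟩
  have hδc : ContinuousOn (fun t => γ₁ t - γ₂ t) (Icc t₀ (t₀ + η)) :=
    (hγ₁.mono hsubI).sub (hγ₂.mono hsubI)
  have hδd : ∀ t ∈ Ioc t₀ (t₀ + η), HasDerivAt (fun t => γ₁ t - γ₂ t)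
      ((γ₁ t).2 - (γ₂ t).2, F (γ₁ t).1 - F (γ₂ t).1) t := fun t ht => by
    obtain ⟨-, -, -, h₁, h₂⟩ := hall (hsubA t ht)
    exact (hder₁ t (hsubI ⟨ht.1.le, ht.2⟩) h₁).sub (hder₂ t (hsubI ⟨ht.1.le, ht.2⟩) h₂)
  obtain ⟨m, hm, hmax⟩ := isCompact_Icc.exists_isMaxOn
    (nonempty_Icc.2 (by linarith : t₀ ≤ t₀ + η)) hδc.snd.norm
  set D := ‖(γ₁ m - γ₂ m).2‖ with hD
  have hD0 : 0 ≤ D := norm_nonneg _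
  have hmax' : ∀ t ∈ Icc t₀ (t₀ + η), ‖(γ₁ t - γ₂ t).2‖ ≤ D := fun t ht => hmax ht
  have hX : ∀ t ∈ Icc t₀ (t₀ + η), ‖(γ₁ t).1 - (γ₂ t).1‖ ≤ D * (t - t₀) := by
    intro t ht
    have := norm_sub_le_of_norm_hasDerivAt_Ioo_le (C := D) ht.1
      (hδc.fst.mono (Icc_subset_Icc_right ht.2))
      (fun r hr => (hδd r ⟨hr.1, hr.2.le.trans ht.2⟩).fst)
      (fun r hr => hmax' r ⟨hr.1.le, hr.2.le.trans ht.2⟩)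
    simpa [heq] using this
  have hΞ' : ∀ t ∈ Ioo t₀ (t₀ + η), ‖F (γ₁ t).1 - F (γ₂ t).1‖ ≤ C' * D := by
    intro t ht
    obtain ⟨h0, h1, h2, h3, h4⟩ := hall (hsubA t ⟨ht.1, ht.2.le⟩)
    have ht0 : 0 < t - t₀ := sub_pos.2 ht.1
    have hinv : ‖g (γ₁ t).1‖⁻¹ ≤ c⁻¹ * (t - t₀)⁻¹ := by
      rw [← mul_inv]; exact inv_anti₀ (by positivity) h0
    calc _ ≤ C * (1 + ‖g (γ₁ t).1‖⁻¹) * ‖(γ₁ t).1 - (γ₂ t).1‖ := hFs _ h1 _ h2 h3 h4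
      _ ≤ C * (1 + c⁻¹ * (t - t₀)⁻¹) * (D * (t - t₀)) := by
        gcongr; exact hX t ⟨ht.1.le, ht.2.le⟩
      _ = C * ((t - t₀) + c⁻¹) * D := by field_simp
      _ ≤ C * (1 + c⁻¹) * D := by gcongr; linarith [ht.2]
      _ ≤ C' * D := by gcongr; linarith
  have hΞ : D ≤ C' * D * (m - t₀) := by
    have := norm_sub_le_of_norm_hasDerivAt_Ioo_le (C := C' * D) hm.1
      (hδc.snd.mono (Icc_subset_Icc_right hm.2))
      (fun r hr => (hδd r ⟨hr.1, hr.2.le.trans hm.2⟩).snd)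
      (fun r hr => hΞ' r ⟨hr.1, hr.2.trans_le hm.2⟩)
    simpa [heq, hD] using this
  have hDz : D = 0 := by
    have h1 : C' * D * (m - t₀) ≤ C' * D * η := by gcongr; linarith [hm.2]
    nlinarith
  filter_upwards [Ioo_mem_nhdsGT (by linarith : t₀ < t₀ + η)] with t ht
  have ht' := Ioo_subset_Icc_self ht
  have h1 := hX t ht'
  have h2 := hmax' t ht'
  rw [hDz] at h2
  rw [hDz, zero_mul] at h1
  refine Prod.ext ?_ ?_
  · exact sub_eq_zero.1 (norm_le_zero_iff.1 h1)
  · exact sub_eq_zero.1 (norm_le_zero_iff.1 h2)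

theorem eqOn_Icc_zero_of_transversal (hF : SingularLipschitz F g) (hg : ContDiff ℝ 1 g)
    (hγ₁ : ContinuousOn γ₁ (Icc 0 b)) (hγ₂ : ContinuousOn γ₂ (Icc 0 b))
    (hsub₁ : Set.Subsingleton {t | t ∈ Icc 0 b ∧ g (γ₁ t).1 = 0})
    (hsub₂ : Set.Subsingleton {t | t ∈ Icc 0 b ∧ g (γ₂ t).1 = 0})
    (hder₁ : ∀ t ∈ Icc 0 b, g (γ₁ t).1 ≠ 0 → HasDerivAt γ₁ ((γ₁ t).2, F (γ₁ t).1) t)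
    (hder₂ : ∀ t ∈ Icc 0 b, g (γ₂ t).1 ≠ 0 → HasDerivAt γ₂ ((γ₂ t).2, F (γ₂ t).1) t)
    (htr₁ : ∀ t ∈ Icc 0 b, g (γ₁ t).1 = 0 → fderiv ℝ g (γ₁ t).1 (γ₁ t).2 ≠ 0)
    (heq : γ₁ 0 = γ₂ 0) : EqOn γ₁ γ₂ (Icc 0 b) := by
  have hcl : IsClosed ({t | γ₁ t = γ₂ t} ∩ Icc 0 b) := by
    have : {t | γ₁ t = γ₂ t} ∩ Icc 0 b = Icc 0 b ∩ (fun t => γ₁ t - γ₂ t) ⁻¹' {0} := by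
      ext t; simp [sub_eq_zero, and_comm]
    rw [this]
    exact (hγ₁.sub hγ₂).preimage_isClosed_of_isClosed isClosed_Icc isClosed_singleton
  exact hcl.Icc_subset_of_forall_mem_nhdsWithin heq fun t ht =>
    eventually_eq_right_of_eq hF hg hγ₁ hγ₂ hsub₁ hsub₂ hder₁ hder₂ htr₁ ht.2 ht.1

/-- Time reversal of a phase space curve. -/
def timeReversal (γ : ℝ → E × E) (t : ℝ) : E × E := ((γ (-t)).1, -(γ (-t)).2)

theorem hasDerivAt_timeReversal {t : ℝ} (h : HasDerivAt γ ((γ (-t)).2, F (γ (-t)).1) (-t)) :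
    HasDerivAt (timeReversal γ) ((timeReversal γ t).2, F (timeReversal γ t).1) t := by
  have h' : HasDerivAt (fun t => γ (-t)) (-(γ (-t)).2, -F (γ (-t)).1) t := by
    simpa using! h.scomp t (hasDerivAt_neg t)
  have h1 : HasDerivAt (fun t => (γ (-t)).1) (-(γ (-t)).2) t := h'.fst
  have h3 : HasDerivAt (fun t => (γ (-t)).2) (-F (γ (-t)).1) t := h'.snd
  have h2 : HasDerivAt (fun t => -(γ (-t)).2) (- -F (γ (-t)).1) t := h3.fun_neg
  rw [neg_neg] at h2
  exact h1.prodMk h2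

theorem eqOn_Icc_of_transversal (hF : SingularLipschitz F g) (hg : ContDiff ℝ 1 g) {τ : ℝ}
    (hγ₁ : ContinuousOn γ₁ (Icc (-τ) τ)) (hγ₂ : ContinuousOn γ₂ (Icc (-τ) τ))
    (hsub₁ : Set.Subsingleton {t | t ∈ Icc (-τ) τ ∧ g (γ₁ t).1 = 0})
    (hsub₂ : Set.Subsingleton {t | t ∈ Icc (-τ) τ ∧ g (γ₂ t).1 = 0})
    (hder₁ : ∀ t ∈ Icc (-τ) τ, g (γ₁ t).1 ≠ 0 → HasDerivAt γ₁ ((γ₁ t).2, F (γ₁ t).1) t)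
    (hder₂ : ∀ t ∈ Icc (-τ) τ, g (γ₂ t).1 ≠ 0 → HasDerivAt γ₂ ((γ₂ t).2, F (γ₂ t).1) t)
    (htr₁ : ∀ t ∈ Icc (-τ) τ, g (γ₁ t).1 = 0 → fderiv ℝ g (γ₁ t).1 (γ₁ t).2 ≠ 0)
    (heq : γ₁ 0 = γ₂ 0) : EqOn γ₁ γ₂ (Icc (-τ) τ) := by
  have hpos : ∀ {t}, t ∈ Icc 0 τ → t ∈ Icc (-τ) τ := fun ht => ⟨by linarith [ht.1, ht.2], ht.2⟩
  have hneg : ∀ {t}, t ∈ Icc 0 τ → -t ∈ Icc (-τ) τ :=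
    fun ht => ⟨by linarith [ht.2], by linarith [ht.1, ht.2]⟩
  have hrc : ∀ γ : ℝ → E × E, ContinuousOn γ (Icc (-τ) τ) →
      ContinuousOn (timeReversal γ) (Icc 0 τ) := fun γ hγ => by
    have := hγ.comp continuous_neg.continuousOn (fun t ht => hneg ht)
    exact this.fst.prodMk this.snd.neg
  have hrs : ∀ γ : ℝ → E × E, Set.Subsingleton {t | t ∈ Icc (-τ) τ ∧ g (γ t).1 = 0} →
      Set.Subsingleton {t | t ∈ Icc 0 τ ∧ g (timeReversal γ t).1 = 0} := fun γ hγ r hr s hs =>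
    neg_injective (hγ ⟨hneg hr.1, hr.2⟩ ⟨hneg hs.1, hs.2⟩)
  have h1 := eqOn_Icc_zero_of_transversal hF hg (hγ₁.mono fun t => hpos) (hγ₂.mono fun t => hpos)
    (hsub₁.anti fun t ht => ⟨hpos ht.1, ht.2⟩) (hsub₂.anti fun t ht => ⟨hpos ht.1, ht.2⟩)
    (fun t ht => hder₁ t (hpos ht)) (fun t ht => hder₂ t (hpos ht))
    (fun t ht => htr₁ t (hpos ht)) heq
  have h2 := eqOn_Icc_zero_of_transversal hF hg (hrc _ hγ₁) (hrc _ hγ₂) (hrs _ hsub₁)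
    (hrs _ hsub₂) (fun t ht h => hasDerivAt_timeReversal (hder₁ _ (hneg ht) h))
    (fun t ht h => hasDerivAt_timeReversal (hder₂ _ (hneg ht) h))
    (fun t ht h => by simpa [timeReversal] using htr₁ _ (hneg ht) h)
    (by simp [timeReversal, heq])
  intro t ht
  rcases le_total 0 t with h | h
  · exact h1 ⟨h, ht.2⟩
  · have := h2 ⟨neg_nonneg.2 h, by linarith [ht.1]⟩
    simp only [timeReversal, neg_neg, Prod.mk.injEq, neg_inj] at this
    exact Prod.ext this.1 this.2

end Uniqueness

theorem exists_subseq_tendsto_of_lipschitzWith {E : Type*} [MetricSpace E] {K : ℝ≥0}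
    {B : Set E} (hB : IsCompact B) {γ : ℕ → ℝ → E} (hL : ∀ n, LipschitzWith K (γ n))
    (hγ : ∀ n t, γ n t ∈ B) :
    ∃ (φ : ℕ → ℕ) (γ' : ℝ → E), StrictMono φ ∧
      ∀ t, Tendsto (fun n => γ (φ n) t) atTop (𝓝 (γ' t)) := by
  obtain ⟨l, -, φ, hφ, hl⟩ := (isCompact_univ_pi fun _ : ℚ => hB).tendsto_subseq
    (x := fun n (q : ℚ) => γ n q) fun n q _ => hγ n q
  rw [tendsto_pi_nhds] at hl
  have hex : ∀ t, ∃ y, Tendsto (fun n => γ (φ n) t) atTop (𝓝 y) := by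
    intro t
    have hc : CauchySeq fun n => γ (φ n) t := by
      rw [Metric.cauchySeq_iff]
      intro ε hε
      have hδ : 0 < ε / (3 * (K + 1)) := by positivity
      obtain ⟨q, hq1, hq2⟩ := exists_rat_btwn (lt_add_of_pos_right t hδ)
      have hqt : ∀ n, dist (γ n t) (γ n q) < ε / 3 := fun n => by
        have hd : dist t q ≤ ε / (3 * (K + 1)) := by
          rw [dist_comm, Real.dist_eq, abs_of_pos (by linarith)]; linarith
        calc dist (γ n t) (γ n q) ≤ K * dist t q := (hL n).dist_le_mul _ _
          _ ≤ K * (ε / (3 * (K + 1))) := by gcongr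
          _ < (K + 1) * (ε / (3 * (K + 1))) := by gcongr; linarith
          _ = ε / 3 := by field_simp
      obtain ⟨N, hN⟩ := Metric.cauchySeq_iff.1 (hl q).cauchySeq (ε / 3) (by positivity)
      refine ⟨N, fun m hm n hn => ?_⟩
      have h1 := hqt (φ m)
      have h2 := hqt (φ n)
      have h3 : dist (γ (φ m) q) (γ (φ n) q) < ε / 3 := hN m hm n hn
      have := dist_triangle4_right (γ (φ m) t) (γ (φ n) t) (γ (φ m) q) (γ (φ n) q)
      linarith
    obtain ⟨y, -, hy⟩ := cauchySeq_tendsto_of_isComplete hB.isComplete (fun n => hγ (φ n) t) hc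
    exact ⟨y, hy⟩
  choose γ' hγ' using hex
  exact ⟨φ, γ', hφ, hγ'⟩

/-- The regularised force field obtained from `h (x, ‖g x‖, g x / ‖g x‖)` by replacing `‖g x‖` with
`√(ε ^ 2 + ‖g x‖ ^ 2)`. -/
noncomputable def regForce {E Y : Type*} [NormedAddCommGroup Y] [NormedSpace ℝ Y]
    (h : E × ℝ × Y → E) (g : E → Y) (ε : ℝ) (x : E) : E :=
  h (x, √(ε ^ 2 + ‖g x‖ ^ 2), (√(ε ^ 2 + ‖g x‖ ^ 2))⁻¹ • g x)

theorem regForce_zero {E Y : Type*} [NormedAddCommGroup Y] [NormedSpace ℝ Y]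
    (h : E × ℝ × Y → E) (g : E → Y) (x : E) :
    regForce h g 0 x = h (x, ‖g x‖, ‖g x‖⁻¹ • g x) := by
  simp [regForce, Real.sqrt_sq (norm_nonneg _)]

/-- The phase space vector field with the regularised force. -/
noncomputable def regField {E Y : Type*} [NormedAddCommGroup Y] [NormedSpace ℝ Y]
    (h : E × ℝ × Y → E) (g : E → Y) (ε : ℝ) (z : E × E) : E × E :=
  (z.2, regForce h g ε z.1)

/-- A Lipschitz curve in `B` solving the integral equation of `regField h g ε` on `[-T, T]`. -/
structure IsRegSolution {E Y : Type*} [NormedAddCommGroup E] [NormedSpace ℝ E]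
    [NormedAddCommGroup Y] [NormedSpace ℝ Y] (h : E × ℝ × Y → E) (g : E → Y) (M : ℝ≥0)
    (B : Set (E × E)) (T ε : ℝ) (z : E × E) (γ : ℝ → E × E) : Prop where
  lipschitz : LipschitzWith M γ
  mem : ∀ t, γ t ∈ B
  eq_integral : ∀ t ∈ Icc (-T) T, γ t = z + ∫ s in (0 : ℝ)..t, regField h g ε (γ s)

section Field

variable {E Y : Type*} [NormedAddCommGroup E] [InnerProductSpace ℝ E] [FiniteDimensional ℝ E]
  [NormedAddCommGroup Y] [InnerProductSpace ℝ Y] [FiniteDimensional ℝ Y]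
  {h : E × ℝ × Y → E} {g : E → Y} {M : ℝ≥0} {B : Set (E × E)} {T ε c : ℝ} {z : E × E} {v : Y}
  {γ : ℝ → E × E}

omit [InnerProductSpace ℝ E] [FiniteDimensional ℝ E] in
theorem measurable_regField [MeasurableSpace E] [BorelSpace E] [MeasurableSpace Y] [BorelSpace Y]
    (hh : Continuous h) (hg : Continuous g) (ε : ℝ) : Measurable (regField h g ε) := by
  have hgm := hg.measurable
  have : Measurable (regForce h g ε) := by
    refine hh.measurable.comp ?_
    have h1 : Measurable fun x => √(ε ^ 2 + ‖g x‖ ^ 2) := Continuous.measurable (by fun_prop)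
    exact measurable_id.prodMk (h1.prodMk (h1.inv.smul hgm))
  exact measurable_snd.prodMk (this.comp measurable_fst)

omit [InnerProductSpace ℝ E] [FiniteDimensional ℝ E] [FiniteDimensional ℝ Y] in
theorem tendsto_regForce {ι : Type*} {l : Filter ι} (hh : Continuous h) (hg : Continuous g)
    {ε : ι → ℝ} {x : ι → E} {x₀ : E} (hε : Tendsto ε l (𝓝 0)) (hx : Tendsto x l (𝓝 x₀))
    (hx₀ : g x₀ ≠ 0) :
    Tendsto (fun i => regForce h g (ε i) (x i)) l (𝓝 (regForce h g 0 x₀)) := by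
  have hgx := (hg.tendsto x₀).comp hx
  have hs : Tendsto (fun i => √(ε i ^ 2 + ‖g (x i)‖ ^ 2)) l (𝓝 √(0 ^ 2 + ‖g x₀‖ ^ 2)) :=
    ((hε.pow 2).add (hgx.norm.pow 2)).sqrt
  have hne : √(0 ^ 2 + ‖g x₀‖ ^ 2) ≠ 0 := by
    have := norm_pos_iff.2 hx₀
    positivity
  exact (hh.tendsto _).comp (hx.prodMk_nhds (hs.prodMk_nhds ((hs.inv₀ hne).smul hgx)))

omit [FiniteDimensional ℝ E] [FiniteDimensional ℝ Y] in
theorem locallyLipschitz_regField (hh : LocallyLipschitz h) (hg : ContDiff ℝ 1 g) (hε : 0 < ε) :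
    LocallyLipschitz (regField h g ε) := by
  have hpos : ∀ x, 0 < ε ^ 2 + ‖g x‖ ^ 2 := fun x => by positivity
  have hs : ContDiff ℝ 1 fun x => √(ε ^ 2 + ‖g x‖ ^ 2) :=
    (contDiff_const.add (hg.norm_sq ℝ)).sqrt fun x => (hpos x).ne'
  have hu : ContDiff ℝ 1 fun x => (√(ε ^ 2 + ‖g x‖ ^ 2))⁻¹ • g x :=
    (hs.inv fun x => (Real.sqrt_pos.2 (hpos x)).ne').smul hg
  have hF : LocallyLipschitz (regForce h g ε) :=
    hh.comp (contDiff_id.prodMk (hs.prodMk hu)).locallyLipschitz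
  exact LipschitzWith.prod_snd.locallyLipschitz.prodMk
    (hF.comp LipschitzWith.prod_fst.locallyLipschitz)

omit [InnerProductSpace ℝ E] [FiniteDimensional ℝ E] in
theorem exists_norm_regField_le (hh : Continuous h) (hg : Continuous g) (hB : IsCompact B) :
    ∃ M : ℝ≥0, 0 < M ∧ ∀ ε ∈ Icc (0 : ℝ) 1, ∀ z ∈ B, ‖regField h g ε z‖ ≤ M := by
  have hcont : Continuous fun q : (E × E) × ℝ × Y =>
      (q.1.2, h (q.1.1, √(q.2.1 ^ 2 + ‖g q.1.1‖ ^ 2), q.2.2)) := by fun_prop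
  obtain ⟨C, hC⟩ := (hB.prod ((isCompact_Icc (a := (0 : ℝ)) (b := 1)).prod
    (isCompact_closedBall (0 : Y) 1))).exists_bound_of_continuousOn hcont.continuousOn
  refine ⟨C.toNNReal + 1, by positivity, fun ε hε z hz => ?_⟩
  have hmem : (√(ε ^ 2 + ‖g z.1‖ ^ 2))⁻¹ • g z.1 ∈ closedBall (0 : Y) 1 := by
    rw [mem_closedBall_zero_iff, norm_smul, norm_inv, Real.norm_of_nonneg (Real.sqrt_nonneg _),
      inv_mul_eq_div]
    refine div_le_one_of_le₀ (Real.le_sqrt_of_sq_le ?_) (Real.sqrt_nonneg _)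
    nlinarith [sq_nonneg ε]
  have := hC (z, ε, _) ⟨hz, hε, hmem⟩
  refine this.trans ?_
  push_cast
  linarith [Real.le_coe_toNNReal C]

omit [FiniteDimensional ℝ Y] in
theorem exists_isRegSolution (hh : LocallyLipschitz h) (hg : ContDiff ℝ 1 g) (hε : 0 < ε)
    {z₀ : E × E} {R : ℝ≥0} (hT : 0 ≤ T) (hM : ∀ z ∈ closedBall z₀ R, ‖regField h g ε z‖ ≤ M)
    (hMT : M * T ≤ R / 2) (hz : z ∈ closedBall z₀ (R / 2)) :
    ∃ γ, IsRegSolution h g M (closedBall z₀ R) T ε z γ := by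
  obtain ⟨K, hK⟩ := ((locallyLipschitz_regField hh hg hε).locallyLipschitzOn
    (s := closedBall z₀ R)).exists_lipschitzOnWith_of_compact (isCompact_closedBall _ _)
  have hPL : IsPicardLindelof (fun _ => regField h g ε)
      (⟨0, by linarith, hT⟩ : Icc (-T) T) z₀ R (R / 2) M K :=
    { lipschitzOnWith := fun _ _ => hK
      continuousOn := fun _ _ => continuousOn_const
      norm_le := fun _ _ => hM
      mul_max_le := by
        simp only [sub_zero, zero_sub, neg_neg, max_self, NNReal.coe_div, NNReal.coe_ofNat]
        linarith }
  obtain ⟨α, hα⟩ := ODE.FunSpace.exists_isFixedPt_next hPL (x := z) (by simpa using hz)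
  rw [ODE.FunSpace.isFixedPt_next_iff] at hα
  refine ⟨α.compProj, ?_, fun t => α.compProj_mem_closedBall hPL.mul_max_le, fun t ht => ?_⟩
  · have := α.lipschitzWith.comp (LipschitzWith.projIcc (by linarith : -T ≤ T))
    rwa [mul_one] at this
  · rw [ODE.FunSpace.compProj_of_mem ht, hα, ODE.picard_apply]

namespace IsRegSolution

omit [FiniteDimensional ℝ E] [FiniteDimensional ℝ Y] in
theorem apply_zero (hγ : IsRegSolution h g M B T ε z γ) (hT : 0 ≤ T) : γ 0 = z := by
  simpa using hγ.eq_integral 0 ⟨by linarith, hT⟩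

omit [FiniteDimensional ℝ Y] in
theorem subsingleton_of_eq_integral (hg : ContDiff ℝ 1 g) (hγ : Continuous γ) (hmem : ∀ t, γ t ∈ B)
    (hc : 0 < c) (hB : ∀ z ∈ B, c ≤ inner ℝ v (fderiv ℝ g z.1 z.2))
    (hX : ∀ t ∈ Icc (-T) T, (γ t).1 = z.1 + ∫ s in (0 : ℝ)..t, (γ s).2) :
    Set.Subsingleton {t | t ∈ Icc (-T) T ∧ g (γ t).1 = 0} := by
  suffices hm : StrictMonoOn (fun t => inner ℝ v (g (γ t).1)) (Icc (-T) T) from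
    fun r hr s hs => hm.injOn hr.1 hs.1 (by simp [hr.2, hs.2])
  have hΞ : Continuous fun s => (γ s).2 := continuous_snd.comp hγ
  refine strictMonoOn_of_deriv_pos (convex_Icc _ _)
    (continuous_const.inner (hg.continuous.comp (continuous_fst.comp hγ))).continuousOn ?_
  intro t ht
  rw [interior_Icc] at ht
  have h1 : HasDerivAt (fun t => z.1 + ∫ s in (0 : ℝ)..t, (γ s).2) (γ t).2 t :=
    (hΞ.integral_hasStrictDerivAt 0 t).hasDerivAt.const_add _
  have h2 : HasDerivAt (fun t => (γ t).1) (γ t).2 t := h1.congr_of_eventuallyEq <| by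
    filter_upwards [Ioo_mem_nhds ht.1 ht.2] with s hs using hX s (Ioo_subset_Icc_self hs)
  have h3 : HasDerivAt (fun t => g (γ t).1) (fderiv ℝ g (γ t).1 (γ t).2) t :=
    (hg.differentiable one_ne_zero _).hasFDerivAt.comp_hasDerivAt t h2
  have h4 : HasDerivAt (fun t => inner ℝ v (g (γ t).1))
      (inner ℝ v (fderiv ℝ g (γ t).1 (γ t).2)) t :=
    (innerSL ℝ v).hasFDerivAt.comp_hasDerivAt t h3
  rw [h4.deriv]
  exact hc.trans_le (hB _ (hmem t))

theorem intervalIntegrable_regField (hh : Continuous h) (hg : Continuous g) (hγ : Continuous γ)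
    (hmem : ∀ t, γ t ∈ B) (hM : ∀ z ∈ B, ‖regField h g ε z‖ ≤ M) (a b : ℝ) :
    IntervalIntegrable (fun s => regField h g ε (γ s)) volume a b := by
  borelize E Y
  refine (intervalIntegrable_const (c := (M : ℝ))).mono_fun ?_ ?_
  · exact ((measurable_regField hh hg ε).comp hγ.measurable).aestronglyMeasurable
  · exact .of_forall fun s => (hM _ (hmem s)).trans (le_abs_self _)

theorem fst_eq_integral (hγ : IsRegSolution h g M B T ε z γ) (hh : Continuous h)
    (hg : Continuous g) (hM : ∀ z ∈ B, ‖regField h g ε z‖ ≤ M) :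
    ∀ t ∈ Icc (-T) T, (γ t).1 = z.1 + ∫ s in (0 : ℝ)..t, (γ s).2 := fun t ht => by
  have hint := intervalIntegrable_regField hh hg hγ.lipschitz.continuous hγ.mem hM 0 t
  have := congrArg Prod.fst (hγ.eq_integral t ht)
  rw [this, Prod.fst_add]
  congr 1
  exact ((ContinuousLinearMap.fst ℝ E E).intervalIntegral_comp_comm hint).symm

/-- Pointwise limits of solutions for vanishing regularisation parameters are solutions of the
singular equation. -/
theorem of_tendsto (hh : Continuous h) (hg : ContDiff ℝ 1 g) (hBc : IsClosed B)
    (hc : 0 < c) (hB : ∀ z ∈ B, c ≤ inner ℝ v (fderiv ℝ g z.1 z.2))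
    (hM : ∀ ε ∈ Icc (0 : ℝ) 1, ∀ z ∈ B, ‖regField h g ε z‖ ≤ M)
    {γs : ℕ → ℝ → E × E} {εs : ℕ → ℝ} {zs : ℕ → E × E} (hεs : ∀ n, εs n ∈ Icc (0 : ℝ) 1)
    (hγs : ∀ n, IsRegSolution h g M B T (εs n) (zs n) (γs n))
    (hε : Tendsto εs atTop (𝓝 0)) (hz : Tendsto zs atTop (𝓝 z))
    (hγ : ∀ t, Tendsto (fun n => γs n t) atTop (𝓝 (γ t))) :
    IsRegSolution h g M B T 0 z γ := by
  have hlip : LipschitzWith M γ := LipschitzWith.of_dist_le_mul fun s t =>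
    le_of_tendsto ((hγ s).dist (hγ t)) (.of_forall fun n => (hγs n).lipschitz.dist_le_mul s t)
  have hmem : ∀ t, γ t ∈ B := fun t => hBc.mem_of_tendsto (hγ t) (.of_forall fun n => (hγs n).mem t)
  have hX : ∀ t ∈ Icc (-T) T, (γ t).1 = z.1 + ∫ s in (0 : ℝ)..t, (γ s).2 := by
    intro t ht
    have h1 : Tendsto (fun n => (zs n).1 + ∫ s in (0 : ℝ)..t, (γs n s).2) atTop
        (𝓝 (z.1 + ∫ s in (0 : ℝ)..t, (γ s).2)) := by
      refine ((continuous_fst.tendsto _).comp hz).add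
        (intervalIntegral.tendsto_integral_filter_of_dominated_convergence (fun _ => (M : ℝ)) ?_ ?_
          intervalIntegrable_const ?_)
      · exact .of_forall fun n =>
          (continuous_snd.comp (hγs n).lipschitz.continuous).aestronglyMeasurable
      · refine .of_forall fun n => .of_forall fun s _ => ?_
        exact (norm_snd_le (regField h g (εs n) (γs n s)).swap).trans
          (by simpa [Prod.norm_def, max_comm] using hM _ (hεs n) _ ((hγs n).mem s))
      · exact .of_forall fun s _ => (continuous_snd.tendsto _).comp (hγ s)
    refine tendsto_nhds_unique ((continuous_fst.tendsto _).comp (hγ t)) (h1.congr fun n => ?_)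
    exact ((hγs n).fst_eq_integral hh hg.continuous (hM _ (hεs n)) t ht).symm
  have hsub := subsingleton_of_eq_integral hg hlip.continuous hmem hc hB hX
  refine ⟨hlip, hmem, fun t ht => ?_⟩
  have h1 : Tendsto (fun n => zs n + ∫ s in (0 : ℝ)..t, regField h g (εs n) (γs n s)) atTop
      (𝓝 (z + ∫ s in (0 : ℝ)..t, regField h g 0 (γ s))) := by
    refine hz.add
      (intervalIntegral.tendsto_integral_filter_of_dominated_convergence (fun _ => (M : ℝ)) ?_ ?_
        intervalIntegrable_const ?_)
    · exact .of_forall fun n => (intervalIntegrable_regField hh hg.continuous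
        (hγs n).lipschitz.continuous (hγs n).mem (hM _ (hεs n)) 0 t).def'.aestronglyMeasurable
    · exact .of_forall fun n => .of_forall fun s _ => hM _ (hεs n) _ ((hγs n).mem s)
    · have hne : ∀ᵐ s, s ∉ {t | t ∈ Icc (-T) T ∧ g (γ t).1 = 0} :=
        measure_eq_zero_iff_ae_notMem.1 (hsub.measure_zero _)
      filter_upwards [hne] with s hs hst
      have hsT : s ∈ Icc (-T) T := by
        have h0 : (0 : ℝ) ∈ Icc (-T) T := ⟨by linarith [ht.1, ht.2], by linarith [ht.1, ht.2]⟩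
        exact uIcc_subset_Icc h0 ht (uIoc_subset_uIcc hst)
      have hgs : g (γ s).1 ≠ 0 := fun h0 => hs ⟨hsT, h0⟩
      exact ((continuous_snd.tendsto _).comp (hγ s)).prodMk_nhds
        (tendsto_regForce hh hg.continuous hε ((continuous_fst.tendsto _).comp (hγ s)) hgs)
  refine tendsto_nhds_unique (hγ t) (h1.congr fun n => ?_)
  exact ((hγs n).eq_integral t ht).symm

theorem hasDerivAt (hγ : IsRegSolution h g M B T 0 z γ) (hh : Continuous h) (hg : Continuous g)
    (hM : ∀ z ∈ B, ‖regField h g 0 z‖ ≤ M) {t : ℝ} (ht : t ∈ Ioo (-T) T) (hgt : g (γ t).1 ≠ 0) :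
    HasDerivAt γ ((γ t).2, regForce h g 0 (γ t).1) t := by
  borelize E Y
  have hγc := hγ.lipschitz.continuous
  have hc : ContinuousAt (fun s => regField h g 0 (γ s)) t :=
    ((continuous_snd.comp hγc).tendsto t).prodMk_nhds (tendsto_regForce hh hg tendsto_const_nhds
      ((continuous_fst.comp hγc).tendsto t) hgt)
  have hd := intervalIntegral.integral_hasDerivAt_right
    (intervalIntegrable_regField hh hg hγc hγ.mem hM 0 t)
    ((measurable_regField hh hg 0).comp
      hγc.measurable).stronglyMeasurable.stronglyMeasurableAtFilter hc
  refine (hd.const_add z).congr_of_eventuallyEq ?_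
  filter_upwards [Ioo_mem_nhds ht.1 ht.2] with s hs
    using hγ.eq_integral s (Ioo_subset_Icc_self hs)

end IsRegSolution

end Field

section Flow

variable {E Y : Type*} [NormedAddCommGroup E] [InnerProductSpace ℝ E] [FiniteDimensional ℝ E]
  [NormedAddCommGroup Y] [InnerProductSpace ℝ Y] [FiniteDimensional ℝ Y]

/-- The flow of `(x, ξ) ↦ (ξ, F x)` extends continuously across transversal zeros of `g`. -/
theorem exists_flow_of_transversal {h : E × ℝ × Y → E} {g : E → Y} {F : E → E}
    (hh : LocallyLipschitz h) (hg : ContDiff ℝ 1 g) (hF : SingularLipschitz F g)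
    (hFh : ∀ x, g x ≠ 0 → F x = regForce h g 0 x) {x₀ ξ₀ : E} (hdg : fderiv ℝ g x₀ ξ₀ ≠ 0) :
    ∃ τ₀ > (0 : ℝ), ∃ Ω : Set (E × E), IsOpen Ω ∧ (x₀, ξ₀) ∈ Ω ∧
      (∀ z ∈ Ω, g z.1 = 0 → fderiv ℝ g z.1 z.2 ≠ 0) ∧
      ∃ Φ : ℝ × (E × E) → E × E, ContinuousOn Φ (Icc (-τ₀) τ₀ ×ˢ Ω) ∧
        ∀ z ∈ Ω,
          Φ (0, z) = z ∧
          (∃ K : ℝ≥0, LipschitzOnWith K (fun t => Φ (t, z)) (Icc (-τ₀) τ₀)) ∧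
          Set.Subsingleton {t : ℝ | t ∈ Icc (-τ₀) τ₀ ∧ g (Φ (t, z)).1 = 0} ∧
          (∀ t ∈ Icc (-τ₀) τ₀, g (Φ (t, z)).1 ≠ 0 →
            HasDerivAt (fun s => Φ (s, z)) ((Φ (t, z)).2, F (Φ (t, z)).1) t) ∧
          (∀ γ : ℝ → E × E,
            (∃ K : ℝ≥0, LipschitzOnWith K γ (Icc (-τ₀) τ₀)) →
            γ 0 = z →
            Set.Subsingleton {t : ℝ | t ∈ Icc (-τ₀) τ₀ ∧ g (γ t).1 = 0} →
            (∀ t ∈ Icc (-τ₀) τ₀, g (γ t).1 ≠ 0 → HasDerivAt γ ((γ t).2, F (γ t).1) t) →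
            ∀ t ∈ Icc (-τ₀) τ₀, γ t = Φ (t, z)) := by
  set z₀ : E × E := (x₀, ξ₀) with hz₀
  set v := fderiv ℝ g x₀ ξ₀ with hv
  have hv0 : 0 < inner ℝ v v := real_inner_self_pos.2 hdg
  have hdgc : Continuous fun z : E × E => inner ℝ v (fderiv ℝ g z.1 z.2) := by
    have := hg.continuous_fderiv one_ne_zero
    fun_prop
  obtain ⟨R', hR', hRB⟩ := nhds_basis_closedBall.mem_iff.1
    (hdgc.continuousAt.eventually_const_lt (half_lt_self hv0 : _ < inner ℝ v (fderiv ℝ g z₀.1 z₀.2)))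
  lift R' to ℝ≥0 using hR'.le with R
  have hc := half_pos hv0
  set c := inner ℝ v v / 2
  set B := closedBall z₀ R with hBdef
  have hB : ∀ z ∈ B, c ≤ inner ℝ v (fderiv ℝ g z.1 z.2) := fun z hz => (hRB hz).le
  have hBne : ∀ z ∈ B, fderiv ℝ g z.1 z.2 ≠ 0 := fun z hz h0 => by
    have := hB z hz
    rw [h0, inner_zero_right] at this
    linarith
  have hhc := hh.continuous
  have hgc := hg.continuous
  obtain ⟨M, hM0, hM⟩ := exists_norm_regField_le hhc hgc (isCompact_closedBall z₀ R)
  have hM0' : ∀ z ∈ B, ‖regField h g 0 z‖ ≤ M := hM 0 ⟨le_rfl, zero_le_one⟩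
  set T : ℝ := R / 2 / M with hTdef
  have hT : 0 < T := by positivity
  have hMT : M * T ≤ R / 2 := (mul_div_cancel₀ _ (by positivity)).le
  have hlim : ∀ {εs : ℕ → ℝ} {zs : ℕ → E × E} {γs : ℕ → ℝ → E × E} {z : E × E},
      (∀ n, εs n ∈ Icc (0 : ℝ) 1) → (∀ n, IsRegSolution h g M B T (εs n) (zs n) (γs n)) →
      Tendsto εs atTop (𝓝 0) → Tendsto zs atTop (𝓝 z) → ∃ (φ : ℕ → ℕ) (γ : ℝ → E × E),
        IsRegSolution h g M B T 0 z γ ∧ ∀ t, Tendsto (fun n => γs (φ n) t) atTop (𝓝 (γ t)) := by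
    intro εs zs γs z hεs hγs hε hz
    obtain ⟨φ, γ, hφ, hγ⟩ := exists_subseq_tendsto_of_lipschitzWith
      (isCompact_closedBall z₀ R) (fun n => (hγs n).lipschitz) fun n => (hγs n).mem
    exact ⟨φ, γ, IsRegSolution.of_tendsto hhc hg isClosed_closedBall hc hB hM
      (fun n => hεs (φ n)) (fun n => hγs (φ n)) (hε.comp hφ.tendsto_atTop)
      (hz.comp hφ.tendsto_atTop) hγ, hγ⟩
  have hex : ∀ z ∈ ball z₀ (R / 2), ∃ γ, IsRegSolution h g M B T 0 z γ := by
    intro z hz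
    have hε : ∀ n : ℕ, (1 : ℝ) / (n + 1) ∈ Icc (0 : ℝ) 1 := fun n =>
      ⟨by positivity, div_le_one_of_le₀ (by linarith [n.cast_nonneg (α := ℝ)]) (by positivity)⟩
    have hreg : ∀ n : ℕ, ∃ γ, IsRegSolution h g M B T (1 / (n + 1)) z γ := fun n =>
      exists_isRegSolution hh hg (by positivity) hT.le (hM _ (hε n)) hMT (ball_subset_closedBall hz)
    choose γs hγs using hreg
    obtain ⟨-, γ, hγ, -⟩ := hlim hε hγs tendsto_one_div_add_atTop_nhds_zero_nat tendsto_const_nhds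
    exact ⟨γ, hγ⟩
  choose! Ψ hΨ using hex
  have hτT : Icc (-(T / 2)) (T / 2) ⊆ Ioo (-T) T := fun t ht =>
    ⟨by linarith [ht.1], by linarith [ht.2]⟩
  have hsub : ∀ {z γ}, IsRegSolution h g M B T 0 z γ →
      Set.Subsingleton {t | t ∈ Icc (-(T / 2)) (T / 2) ∧ g (γ t).1 = 0} := fun hγ =>
    (IsRegSolution.subsingleton_of_eq_integral hg hγ.lipschitz.continuous hγ.mem hc hB
      (hγ.fst_eq_integral hhc hgc hM0')).anti
        fun t ht => ⟨Ioo_subset_Icc_self (hτT ht.1), ht.2⟩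
  have hder : ∀ {z γ}, IsRegSolution h g M B T 0 z γ → ∀ t ∈ Icc (-(T / 2)) (T / 2),
      g (γ t).1 ≠ 0 → HasDerivAt γ ((γ t).2, F (γ t).1) t := fun hγ t ht hgt => by
    rw [hFh _ hgt]
    exact hγ.hasDerivAt hhc hgc hM0' (hτT ht) hgt
  have huniq : ∀ z ∈ ball z₀ (R / 2), ∀ γ : ℝ → E × E,
      ContinuousOn γ (Icc (-(T / 2)) (T / 2)) → γ 0 = z →
      Set.Subsingleton {t : ℝ | t ∈ Icc (-(T / 2)) (T / 2) ∧ g (γ t).1 = 0} →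
      (∀ t ∈ Icc (-(T / 2)) (T / 2), g (γ t).1 ≠ 0 → HasDerivAt γ ((γ t).2, F (γ t).1) t) →
      ∀ t ∈ Icc (-(T / 2)) (T / 2), γ t = Ψ z t := by
    intro z hz γ hγc hγ0 hγs hγd t ht
    have hΨz := hΨ z hz
    exact (eqOn_Icc_of_transversal hF hg hΨz.lipschitz.continuous.continuousOn hγc (hsub hΨz) hγs
      (hder hΨz) hγd (fun t _ _ => hBne _ (hΨz.mem t))
      ((hΨz.apply_zero hT.le).trans hγ0.symm) ht).symm
  refine ⟨T / 2, half_pos hT, ball z₀ (R / 2), isOpen_ball, mem_ball_self (half_pos hR'), ?_,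
    fun q => Ψ q.2 q.1, ?_, fun z hz => ⟨(hΨ z hz).apply_zero hT.le, ⟨M, ?_⟩, hsub (hΨ z hz),
      hder (hΨ z hz), fun γ ⟨K, hK⟩ => huniq z hz γ hK.continuousOn⟩⟩
  · exact fun z hz _ => hBne z (ball_subset_closedBall.trans (closedBall_subset_closedBall
      (by linarith)) hz)
  · refine continuousOn_prod_of_continuousOn_lipschitzOnWith _ M (fun t ht => ?_)
      fun z hz => (hΨ z hz).lipschitz.lipschitzOnWith
    intro z hz
    refine (continuousWithinAt_iff_continuousAt (isOpen_ball.mem_nhds hz)).2 ?_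
    have : Tendsto (fun z => Ψ z t) (𝓝[ball z₀ (R / 2)] z) (𝓝 (Ψ z t)) := by
      refine tendsto_of_seq_tendsto fun zs hzs => ?_
      rw [tendsto_nhdsWithin_iff] at hzs
      refine tendsto_of_subseq_tendsto fun ns hns => ?_
      obtain ⟨N, hN⟩ := eventually_atTop.1 (hns.eventually hzs.2)
      have hsh : Tendsto (fun n => ns (n + N)) atTop atTop := (tendsto_add_atTop_iff_nat N).2 hns
      obtain ⟨φ, γ, hγ, hlimγ⟩ := hlim (εs := fun _ => 0) (fun _ => ⟨le_rfl, zero_le_one⟩)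
        (fun n => hΨ (zs (ns (n + N))) (hN _ (Nat.le_add_left N n))) tendsto_const_nhds
        (hzs.1.comp hsh)
      refine ⟨fun n => φ n + N, ?_⟩
      rw [← huniq z hz γ hγ.lipschitz.continuous.continuousOn (hγ.apply_zero hT.le) (hsub hγ)
        (hder hγ) t ht]
      exact hlimγ t
    rwa [isOpen_ball.nhdsWithin_eq hz] at this
  · exact (hΨ z hz).lipschitz.lipschitzOnWith

theorem norm_inv_norm_smul_sub_le {Y : Type*} [NormedAddCommGroup Y] [NormedSpace ℝ Y] {a b : Y}
    (ha : a ≠ 0) (hb : b ≠ 0) : ‖‖a‖⁻¹ • a - ‖b‖⁻¹ • b‖ ≤ 2 * ‖a‖⁻¹ * ‖a - b‖ := by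
  have ha' := norm_pos_iff.2 ha
  have hb' := norm_pos_iff.2 hb
  have h1 : ‖a‖⁻¹ • a - ‖b‖⁻¹ • b = ‖a‖⁻¹ • (a - b) + (‖a‖⁻¹ - ‖b‖⁻¹) • b := by module
  have h2 : ‖(‖a‖⁻¹ - ‖b‖⁻¹) • b‖ ≤ ‖a‖⁻¹ * ‖a - b‖ := by
    rw [norm_smul, inv_sub_inv ha'.ne' hb'.ne', norm_div, norm_mul, norm_norm, norm_norm,
      Real.norm_eq_abs, abs_sub_comm]
    calc |‖a‖ - ‖b‖| / (‖a‖ * ‖b‖) * ‖b‖ = ‖a‖⁻¹ * |‖a‖ - ‖b‖| := by field_simp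
      _ ≤ _ := by gcongr; exact abs_norm_sub_norm_le a b
  calc _ ≤ ‖‖a‖⁻¹ • (a - b)‖ + ‖(‖a‖⁻¹ - ‖b‖⁻¹) • b‖ := h1 ▸ norm_add_le _ _
    _ ≤ ‖a‖⁻¹ * ‖a - b‖ + ‖a‖⁻¹ * ‖a - b‖ := by
      gcongr
      rw [norm_smul, norm_inv, norm_norm]
    _ = _ := by ring

theorem singularLipschitz_of_eq_regForce {h : E × ℝ × Y → E} {g : E → Y} {F : E → E}
    (hh : LocallyLipschitz h) (hg : ContDiff ℝ 1 g)
    (hFh : ∀ x, g x ≠ 0 → F x = regForce h g 0 x) : SingularLipschitz F g := by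
  intro x
  obtain ⟨L, hL⟩ := (hg.locallyLipschitz.locallyLipschitzOn
    (s := closedBall x 1)).exists_lipschitzOnWith_of_compact (isCompact_closedBall _ _)
  obtain ⟨S, hS⟩ := (isCompact_closedBall x 1).exists_bound_of_continuousOn
    hg.continuous.continuousOn
  obtain ⟨K, hK⟩ := (hh.locallyLipschitzOn
    (s := closedBall x 1 ×ˢ closedBall (0 : ℝ) S ×ˢ closedBall (0 : Y) 1)
    ).exists_lipschitzOnWith_of_compact
      ((isCompact_closedBall _ _).prod ((isCompact_closedBall _ _).prod (isCompact_closedBall _ _)))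
  have hmem : ∀ a ∈ closedBall x 1, g a ≠ 0 → (a, ‖g a‖, ‖g a‖⁻¹ • g a) ∈
      closedBall x 1 ×ˢ closedBall (0 : ℝ) S ×ˢ closedBall (0 : Y) 1 := fun a ha hga =>
    ⟨ha, by simpa using hS a ha, by simp [norm_smul, hga]⟩
  refine ⟨K * (1 + 2 * L), by positivity, closedBall x 1, closedBall_mem_nhds x one_pos,
    fun a ha b hb hga hgb => ?_⟩
  have hgL : ‖g a - g b‖ ≤ L * ‖a - b‖ := hL.norm_sub_le ha hb
  rw [hFh a hga, hFh b hgb, regForce_zero, regForce_zero]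
  refine (hK.norm_sub_le (hmem a ha hga) (hmem b hb hgb)).trans ?_
  rw [mul_assoc, mul_assoc]
  gcongr
  have hi : 0 ≤ ‖g a‖⁻¹ := by positivity
  have hn := norm_nonneg (a - b)
  have hL0 : (0 : ℝ) ≤ L := L.2
  have hLn := mul_nonneg hL0 hn
  have hin := mul_nonneg hi hn
  have hiLn := mul_nonneg hi hLn
  refine max_le ?_ (max_le ?_ ?_)
  · change ‖a - b‖ ≤ _
    nlinarith
  · refine (abs_norm_sub_norm_le (g a) (g b)).trans (hgL.trans ?_)
    nlinarith
  · refine (norm_inv_norm_smul_sub_le hga hgb).trans ?_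
    have : 2 * ‖g a‖⁻¹ * ‖g a - g b‖ ≤ 2 * ‖g a‖⁻¹ * (L * ‖a - b‖) := by gcongr
    nlinarith

end Flow

section Potential

variable {E Y : Type*} [NormedAddCommGroup E] [InnerProductSpace ℝ E] [FiniteDimensional ℝ E]
  [NormedAddCommGroup Y] [InnerProductSpace ℝ Y]

/-- The differential of `w ‖g‖ + V₀` at `x`, with `‖g x‖` and `g x / ‖g x‖` replaced by independent
variables. -/
noncomputable def conicalDifferential (w V₀ : E → ℝ) (g : E → Y) (q : E × ℝ × Y) : E →L[ℝ] ℝ :=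
  w q.1 • (innerSL ℝ q.2.2 ∘L fderiv ℝ g q.1) + q.2.1 • fderiv ℝ w q.1 + fderiv ℝ V₀ q.1

/-- The force field associated with `conicalDifferential`. -/
noncomputable def conicalForce (w V₀ : E → ℝ) (g : E → Y) (q : E × ℝ × Y) : E :=
  -(InnerProductSpace.toDual ℝ E).symm (conicalDifferential w V₀ g q)

variable {w V₀ V : E → ℝ} {g : E → Y}

theorem locallyLipschitz_conicalForce [FiniteDimensional ℝ Y] (hw : ContDiff ℝ 2 w)
    (hV₀ : ContDiff ℝ 2 V₀) (hg : ContDiff ℝ 2 g) : LocallyLipschitz (conicalForce w V₀ g) := by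
  have hw' : ContDiff ℝ 1 (fderiv ℝ w) := hw.fderiv_right (by norm_num)
  have hV' : ContDiff ℝ 1 (fderiv ℝ V₀) := hV₀.fderiv_right (by norm_num)
  have hg' : ContDiff ℝ 1 (fderiv ℝ g) := hg.fderiv_right (by norm_num)
  have hw1 : ContDiff ℝ 1 w := hw.of_le (by norm_num)
  have hL : ContDiff ℝ 1 (conicalDifferential w V₀ g) := by
    rw [contDiff_clm_apply_iff]
    intro y
    have : (fun q => conicalDifferential w V₀ g q y) = fun q : E × ℝ × Y =>
        w q.1 * inner ℝ q.2.2 (fderiv ℝ g q.1 y) + q.2.1 * fderiv ℝ w q.1 y + fderiv ℝ V₀ q.1 y := by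
      ext q; simp [conicalDifferential]
    rw [this]
    have h1 : ContDiff ℝ 1 fun q : E × ℝ × Y => fderiv ℝ g q.1 y := by fun_prop
    have h2 : ContDiff ℝ 1 fun q : E × ℝ × Y => inner ℝ q.2.2 (fderiv ℝ g q.1 y) :=
      contDiff_snd.snd.inner ℝ h1
    fun_prop
  exact ((InnerProductSpace.toDual ℝ E).symm.isometry.lipschitz.neg.locallyLipschitz).comp
    hL.locallyLipschitz

theorem neg_gradient_eq_regForce (hw : Differentiable ℝ w) (hV₀ : Differentiable ℝ V₀)
    (hg : Differentiable ℝ g) (hV : ∀ y, V y = w y * ‖g y‖ + V₀ y) {x : E} (hx : g x ≠ 0) :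
    -gradient V x = regForce (conicalForce w V₀ g) g 0 x := by
  have hx' := norm_pos_iff.2 hx
  have hn : HasFDerivAt (fun y => ‖g y‖) (innerSL ℝ (‖g x‖⁻¹ • g x) ∘L fderiv ℝ g x) x := by
    have := ((hg x).hasFDerivAt.norm_sq).sqrt (by positivity)
    simp only [Real.sqrt_sq (norm_nonneg _)] at this
    convert! this using 1
    ext y
    simp
    field_simp
  have hVd : HasFDerivAt V (conicalDifferential w V₀ g (x, ‖g x‖, ‖g x‖⁻¹ • g x)) x := by
    rw [funext hV]
    exact ((hw x).hasFDerivAt.mul hn).add (hV₀ x).hasFDerivAt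
  rw [regForce_zero, conicalForce, gradient, hVd.fderiv]

end Potential

end Transversal

/-- Extension of the Hamiltonian flow to a continuous map on [−τ₀,τ₀] × Ω for a neighborhood
Ω of a point (x₀,ξ₀) ∈ S* with Ω ∩ S ⊂ S*: the flow curves are Lipschitz, meet S at most
once, solve the Hamiltonian system away from S, and are the unique such curves. -/
theorem stmt3 (d p : ℕ) (hd : 1 ≤ d) (hp : 1 ≤ p) (hpd : p ≤ d)
    (w V₀ : EuclideanSpace ℝ (Fin d) → ℝ)
    (g : EuclideanSpace ℝ (Fin d) → EuclideanSpace ℝ (Fin p))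
    (hw : ContDiff ℝ (⊤ : ℕ∞) w) (hV₀ : ContDiff ℝ (⊤ : ℕ∞) V₀) (hg : ContDiff ℝ (⊤ : ℕ∞) g)
    (V : EuclideanSpace ℝ (Fin d) → ℝ) (hV : ∀ y, V y = w y * ‖g y‖ + V₀ y)
    (x₀ ξ₀ : EuclideanSpace ℝ (Fin d)) (hgx₀ : g x₀ = 0) (hdg : fderiv ℝ g x₀ ξ₀ ≠ 0) :
    ∃ τ₀ > (0:ℝ),
      ∃ Ω : Set (EuclideanSpace ℝ (Fin d) × EuclideanSpace ℝ (Fin d)),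
        IsOpen Ω ∧ (x₀, ξ₀) ∈ Ω ∧
        (∀ z ∈ Ω, g z.1 = 0 → fderiv ℝ g z.1 z.2 ≠ 0) ∧
        ∃ Φ : ℝ × (EuclideanSpace ℝ (Fin d) × EuclideanSpace ℝ (Fin d)) →
            EuclideanSpace ℝ (Fin d) × EuclideanSpace ℝ (Fin d),
          ContinuousOn Φ (Set.Icc (-τ₀) τ₀ ×ˢ Ω) ∧
          ∀ z ∈ Ω,
            Φ (0, z) = z ∧
            (∃ K : NNReal, LipschitzOnWith K (fun t => Φ (t, z)) (Set.Icc (-τ₀) τ₀)) ∧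
            Set.Subsingleton {t : ℝ | t ∈ Set.Icc (-τ₀) τ₀ ∧ g (Φ (t, z)).1 = 0} ∧
            (∀ t ∈ Set.Icc (-τ₀) τ₀, g (Φ (t, z)).1 ≠ 0 →
              HasDerivAt (fun s => Φ (s, z)) ((Φ (t, z)).2, -gradient V (Φ (t, z)).1) t) ∧
            (∀ γ : ℝ → EuclideanSpace ℝ (Fin d) × EuclideanSpace ℝ (Fin d),
              (∃ K : NNReal, LipschitzOnWith K γ (Set.Icc (-τ₀) τ₀)) →
              γ 0 = z →
              Set.Subsingleton {t : ℝ | t ∈ Set.Icc (-τ₀) τ₀ ∧ g (γ t).1 = 0} →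
              (∀ t ∈ Set.Icc (-τ₀) τ₀, g (γ t).1 ≠ 0 →
                HasDerivAt γ ((γ t).2, -gradient V (γ t).1) t) →
              ∀ t ∈ Set.Icc (-τ₀) τ₀, γ t = Φ (t, z)) := by
  have hw2 : ContDiff ℝ 2 w := contDiff_infty.1 hw 2
  have hV2 : ContDiff ℝ 2 V₀ := contDiff_infty.1 hV₀ 2
  have hg2 : ContDiff ℝ 2 g := contDiff_infty.1 hg 2
  have hg1 : ContDiff ℝ 1 g := hg2.of_le one_le_two
  have hh := locallyLipschitz_conicalForce hw2 hV2 hg2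
  have hF : ∀ x, g x ≠ 0 → -gradient V x = regForce (conicalForce w V₀ g) g 0 x := fun x =>
    neg_gradient_eq_regForce (hw2.differentiable two_ne_zero) (hV2.differentiable two_ne_zero)
      (hg2.differentiable two_ne_zero) hV
  exact exists_flow_of_transversal (F := fun x => -gradient V x) hh hg1
    (singularLipschitz_of_eq_regForce hh hg1 hF) hF hdg
end

section
/- Let (x₀, ξ₀) ∈ S*. Then there exist τ₀ > 0, an open neighborhood Ω of (x₀, ξ₀) in ℝ^d × ℝ^d, and a map Ψ : [0, τ₀] × Ω → ℝ^d × ℝ^d of class C^∞ (smooth jointly in (t, x, ξ)), such that for every (x, ξ) ∈ Ω with g(x) = 0 and dg(x)ξ ≠ 0, writing Ψ(t, x, ξ) = (X_t, Ξ_t): Ψ(0, x, ξ) = (x, ξ), g(X_t) ≠ 0 for every t ∈ (0, τ₀], and for t ∈ (0, τ₀], Ẋ_t = Ξ_t and Ξ̇_t = −∇V(X_t). In other words, the outgoing broken trajectories issued from points of S* are given, for t ∈ [0, τ₀], by the restriction to S* of a smooth map Φ₊ defined on a full neighborhood; the analogous statement holds for t ∈ [−τ₀, 0]. -/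
open Set Filter Topology MeasureTheory

/-- The action of a continuous field of linear maps on continuous maps, as a bounded bilinear map. -/
noncomputable def ContinuousMap.pointwiseCLM (K E F : Type) [TopologicalSpace K] [CompactSpace K]
    [NormedAddCommGroup E] [NormedSpace ℝ E] [NormedAddCommGroup F] [NormedSpace ℝ F] :
    C(K, E →L[ℝ] F) →L[ℝ] C(K, E) →L[ℝ] C(K, F) :=
  LinearMap.mkContinuous₂
    (LinearMap.mk₂ ℝ
      (fun (A : C(K, E →L[ℝ] F)) (e : C(K, E)) => (⟨fun u => A u (e u), by fun_prop⟩ : C(K, F)))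
      (fun _ _ _ => by ext; simp) (fun _ _ _ => by ext; simp)
      (fun _ _ _ => by ext; simp) (fun _ _ _ => by ext; simp)) 1
    (fun A e => by
      rw [ContinuousMap.norm_le _ (by positivity), one_mul]
      intro u
      exact (A u).le_of_opNorm_le_of_le (A.norm_coe_le_norm u) (e.norm_coe_le_norm u))

/-- Composition on the left with a differentiable map of class `C¹` is differentiable on `C(K, E)`. -/
theorem ContinuousMap.hasFDerivAt_comp {K E F : Type} [TopologicalSpace K] [CompactSpace K]
    [NormedAddCommGroup E] [NormedSpace ℝ E] [NormedAddCommGroup F] [NormedSpace ℝ F]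
    (f : C(E, F)) (f' : C(E, E →L[ℝ] F)) (hf : ∀ x, HasFDerivAt f (f' x) x) (e : C(K, E)) :
    HasFDerivAt (fun e : C(K, E) => f.comp e)
      (ContinuousMap.pointwiseCLM K E F (f'.comp e)) e := by
  rw [hasFDerivAt_iff_isLittleO, Asymptotics.isLittleO_iff]
  intro c hc
  have hcont : Continuous fun e : C(K, E) => f'.comp e := f'.continuous_postcomp
  obtain ⟨δ, hδ, hball⟩ := (Metric.continuousAt_iff
    (f := fun e : C(K, E) => f'.comp e) (a := e)).1 hcont.continuousAt c hc
  filter_upwards [Metric.ball_mem_nhds e hδ] with h hh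
  rw [ContinuousMap.norm_le _ (by positivity)]
  intro u
  have key := (convex_segment (𝕜 := ℝ) (e u) (h u)).norm_image_sub_le_of_norm_hasFDerivWithin_le'
    (f := f) (f' := f') (φ := f' (e u)) (C := c) (fun x _ => (hf x).hasFDerivWithinAt) ?_
    (left_mem_segment ℝ _ _) (right_mem_segment ℝ _ _)
  · exact key.trans (mul_le_mul_of_nonneg_left ((h - e).norm_coe_le_norm u) hc.le)
  · rintro x hx
    rw [segment_eq_image'] at hx
    obtain ⟨s, hs, rfl⟩ := hx
    have hlt : dist (e + s • (h - e)) e < δ := by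
      rw [dist_eq_norm, add_sub_cancel_left, norm_smul, Real.norm_of_nonneg hs.1]
      refine lt_of_le_of_lt (mul_le_of_le_one_left (norm_nonneg _) hs.2) ?_
      rwa [← dist_eq_norm]
    have := (ContinuousMap.dist_apply_le_dist u).trans (hball hlt).le
    rwa [dist_eq_norm] at this

/-- Composition on the left with a smooth map is smooth on `C(K, E)`. -/
theorem ContinuousMap.contDiff_comp {K E : Type} [TopologicalSpace K] [CompactSpace K]
    [NormedAddCommGroup E] [NormedSpace ℝ E] (n : ℕ) :
    ∀ {F : Type} [NormedAddCommGroup F] [NormedSpace ℝ F] (f : C(E, F)), ContDiff ℝ n f →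
      ContDiff ℝ n (fun e : C(K, E) => f.comp e) := by
  induction n with
  | zero =>
    intro F _ _ f _
    exact contDiff_zero.2 f.continuous_postcomp
  | succ n ih =>
    intro F _ _ f hf
    push_cast at hf ⊢
    obtain ⟨f', hf', hd⟩ := contDiff_succ_iff_hasFDerivAt.1 hf
    refine contDiff_succ_iff_hasFDerivAt.2
      ⟨_, ?_, ContinuousMap.hasFDerivAt_comp f ⟨f', hf'.continuous⟩ hd⟩
    exact (ContinuousMap.pointwiseCLM K E F).contDiff.comp (ih ⟨f', hf'.continuous⟩ hf')

theorem ContinuousMap.contDiff_comp_infty {K E F : Type} [TopologicalSpace K] [CompactSpace K]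
    [NormedAddCommGroup E] [NormedSpace ℝ E] [NormedAddCommGroup F] [NormedSpace ℝ F]
    (f : C(E, F)) (hf : ContDiff ℝ (⊤ : ℕ∞) f) :
    ContDiff ℝ (⊤ : ℕ∞) (fun e : C(K, E) => f.comp e) :=
  contDiff_infty.2 fun n => ContinuousMap.contDiff_comp n f (contDiff_infty.1 hf n)

/-- The operator `f ↦ (u ↦ ∫ s ∈ [0,1], f (s * u))`. -/
noncomputable def averageCLM (E : Type) [NormedAddCommGroup E] [NormedSpace ℝ E] :
    C(unitInterval, E) →L[ℝ] C(unitInterval, E) :=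
  LinearMap.mkContinuous
    { toFun := fun f => ⟨fun u => ∫ s : unitInterval, f (s * u), by
        simpa using continuous_parametric_integral_of_continuous (μ := volume)
          (f := fun u s : unitInterval => f (s * u)) (by fun_prop) isCompact_univ⟩
      map_add' := fun f g => by
        ext u
        have h (f : C(unitInterval, E)) : Integrable fun s : unitInterval => f (s * u) :=
          Continuous.integrable_of_hasCompactSupport (by fun_prop) (HasCompactSupport.of_compactSpace _)
        simpa using integral_add (h f) (h g)
      map_smul' := fun c f => by
        ext u
        simpa using integral_smul c fun s : unitInterval => f (s * u) } 1
    (fun f => by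
      rw [ContinuousMap.norm_le _ (by positivity), one_mul]
      intro u
      refine (norm_integral_le_of_norm_le_const (C := ‖f‖)
        (ae_of_all _ fun s => f.norm_coe_le_norm _)).trans ?_
      simp)

theorem averageCLM_apply {E : Type} [NormedAddCommGroup E] [NormedSpace ℝ E]
    (f : C(unitInterval, E)) (u : unitInterval) :
    averageCLM E f u = ∫ s : unitInterval, f (s * u) := rfl

/-- A smooth fixed-point equation `e = H (q, e)` whose right-hand side has vanishing partial
derivative in `e` at the base point has a locally unique solution, smooth on a whole neighborhood. -/
theorem exists_contDiffOn_fixedPoint {P C : Type} [NormedAddCommGroup P] [NormedSpace ℝ P]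
    [CompleteSpace P] [NormedAddCommGroup C] [NormedSpace ℝ C] [CompleteSpace C]
    (H : P × C → C) (hH : ContDiff ℝ (⊤ : ℕ∞) H) (q₀ : P) (e₀ : C) (h₀ : H (q₀, e₀) = e₀)
    (B : P →L[ℝ] C) (hB : HasFDerivAt H (B ∘L ContinuousLinearMap.fst ℝ P C) (q₀, e₀)) :
    ∃ δ > 0, ∃ r > 0, ∃ η : P → C, ContDiffOn ℝ (⊤ : ℕ∞) η (Metric.ball q₀ δ) ∧
      η q₀ = e₀ ∧
      (∀ q ∈ Metric.ball q₀ δ, η q ∈ Metric.ball e₀ r ∧ H (q, η q) = η q) ∧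
      ∀ q ∈ Metric.ball q₀ δ, ∀ e ∈ Metric.ball e₀ r, H (q, e) = e → e = η q := by
  set Θ : P × C → P × C := fun a => (a.1, a.2 - H a) with hΘdef
  have hΘ : ContDiff ℝ (⊤ : ℕ∞) Θ := contDiff_fst.prodMk (contDiff_snd.sub hH)
  let L : (P × C) ≃L[ℝ] (P × C) :=
    (ContinuousLinearEquiv.refl ℝ P).skewProd (ContinuousLinearEquiv.refl ℝ C) (-B)
  have hL : HasFDerivAt Θ (L : P × C →L[ℝ] P × C) (q₀, e₀) := by
    refine HasFDerivAt.congr_fderiv (hasFDerivAt_fst.prodMk (hasFDerivAt_snd.sub hB)) ?_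
    ext a <;> simp [L]
  let φ := hΘ.contDiffAt.toOpenPartialHomeomorph Θ hL (by simp)
  have hφ : ∀ a, φ a = Θ a := fun a => rfl
  have hsrc : (q₀, e₀) ∈ φ.source :=
    hΘ.contDiffAt.mem_toOpenPartialHomeomorph_source hL (by simp)
  have hopen : IsOpen {a | fderiv ℝ Θ a ∈ range ((↑) : ((P × C) ≃L[ℝ] (P × C)) → _)} :=
    ContinuousLinearEquiv.isOpen.preimage (hΘ.continuous_fderiv (by simp))
  have hnhds : φ.source ∩ {a | fderiv ℝ Θ a ∈ range ((↑) : ((P × C) ≃L[ℝ] (P × C)) → _)}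
      ∈ 𝓝 (q₀, e₀) :=
    (φ.open_source.inter hopen).mem_nhds ⟨hsrc, L, hL.fderiv.symm⟩
  obtain ⟨r, hr, hball⟩ := Metric.mem_nhds_iff.1 hnhds
  have hball' : ∀ q ∈ Metric.ball q₀ r, ∀ e ∈ Metric.ball e₀ r, (q, e) ∈ φ.source ∧
      ∃ L' : (P × C) ≃L[ℝ] (P × C), (L' : P × C →L[ℝ] P × C) = fderiv ℝ Θ (q, e) := by
    intro q hq e he
    refine hball ?_
    rw [← ball_prod_same]
    exact ⟨hq, he⟩
  have hφ₀ : φ (q₀, e₀) = (q₀, 0) := by rw [hφ]; simp [hΘdef, h₀]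
  have hpre : (fun q : P => (q, (0 : C))) ⁻¹'
      (φ.target ∩ φ.symm ⁻¹' (Metric.ball (q₀, e₀) r)) ∈ 𝓝 q₀ := by
    refine ((φ.isOpen_inter_preimage_symm Metric.isOpen_ball).preimage (by fun_prop)).mem_nhds ?_
    refine ⟨?_, ?_⟩
    · simpa only [← hφ₀] using φ.map_source hsrc
    · simp only [mem_preimage, ← hφ₀, φ.left_inv hsrc]
      exact Metric.mem_ball_self hr
  obtain ⟨δ, hδ, hδball⟩ := Metric.mem_nhds_iff.1 hpre
  have hsymm : ∀ q ∈ Metric.ball q₀ δ, (φ.symm (q, 0)).1 = q ∧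
      H (q, (φ.symm (q, 0)).2) = (φ.symm (q, 0)).2 ∧ (φ.symm (q, 0)).2 ∈ Metric.ball e₀ r := by
    intro q hq
    obtain ⟨h1, h2⟩ := hδball hq
    have h3 := φ.right_inv h1
    rw [hφ] at h3
    simp only [hΘdef, Prod.mk.injEq] at h3
    obtain ⟨h4, h5⟩ := h3
    have h6 : φ.symm (q, 0) = (q, (φ.symm (q, 0)).2) := Prod.ext h4 rfl
    refine ⟨h4, ?_, ?_⟩
    · rw [← h6]; exact (sub_eq_zero.1 h5).symm
    · rw [mem_preimage, ← ball_prod_same] at h2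
      exact h2.2
  refine ⟨min δ r, lt_min hδ hr, r, hr, fun q => (φ.symm (q, 0)).2, ?_, ?_, ?_, ?_⟩
  · intro q hq
    have hqδ := Metric.ball_subset_ball (min_le_left _ _) hq
    obtain ⟨h1, h2, h3⟩ := hsymm q hqδ
    obtain ⟨h4, L', hL'⟩ := hball' q (Metric.ball_subset_ball (min_le_right _ _) hq) _ h3
    have h6 : φ.symm (q, 0) = (q, (φ.symm (q, 0)).2) := Prod.ext h1 rfl
    have : ContDiffAt ℝ (⊤ : ℕ∞) φ.symm (q, 0) := by
      refine φ.contDiffAt_symm (hδball hqδ).1 (f₀' := L') ?_ hΘ.contDiffAt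
      rw [hL', ← h6]
      exact (hΘ.differentiable (by simp) _).hasFDerivAt
    exact (contDiff_snd.contDiffAt.comp q
      (this.comp q (contDiff_id.prodMk contDiff_const).contDiffAt)).contDiffWithinAt
  · simp only [← hφ₀, φ.left_inv hsrc]
  · intro q hq
    obtain ⟨h1, h2, h3⟩ := hsymm q (Metric.ball_subset_ball (min_le_left _ _) hq)
    exact ⟨h3, h2⟩
  · intro q hq e he heq
    have h := (hball' q (Metric.ball_subset_ball (min_le_right _ _) hq) e he).1
    have h2 : φ (q, e) = (q, 0) := by rw [hφ]; simp [hΘdef, heq]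
    simp only [← h2, φ.left_inv h]

theorem smul_average_eq_intervalIntegral {E : Type} [NormedAddCommGroup E] [NormedSpace ℝ E]
    (φ : ℝ → E) (t : ℝ) : t • ∫ s : unitInterval, φ (t * s) = ∫ s in 0..t, φ s := by
  have : ∫ s : unitInterval, φ (t * s) = ∫ s in (0 : ℝ)..1, φ (t * s) := by
    rw [intervalIntegral.integral_of_le zero_le_one, ← integral_Icc_eq_integral_Ioc]
    exact integral_subtype measurableSet_Icc (fun s : ℝ => φ (t * s))
  rw [this, intervalIntegral.smul_integral_comp_mul_left]
  simp

theorem hasDerivAt_smul_average {E : Type} [NormedAddCommGroup E] [NormedSpace ℝ E]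
    [CompleteSpace E] {φ : ℝ → E} {δ t : ℝ} (hφ : ContinuousOn φ (Metric.ball 0 δ))
    (ht : t ∈ Metric.ball (0 : ℝ) δ) :
    HasDerivAt (fun t : ℝ => t • ∫ s : unitInterval, φ (t * s)) (φ t) t := by
  simp only [smul_average_eq_intervalIntegral]
  have hδ : 0 < δ := (norm_nonneg _).trans_lt (mem_ball_zero_iff.1 ht)
  refine intervalIntegral.integral_hasDerivAt_right ?_ ?_
    (hφ.continuousAt (Metric.isOpen_ball.mem_nhds ht))
  · refine (hφ.mono ?_).intervalIntegrable
    exact ((convex_ball (0 : ℝ) δ).ordConnected).uIcc_subset (Metric.mem_ball_self hδ) ht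
  · exact hφ.stronglyMeasurableAtFilter Metric.isOpen_ball t ht

/-- Constant maps on `[0,1]`, as a continuous linear map. -/
noncomputable def constCLM (E : Type) [NormedAddCommGroup E] [NormedSpace ℝ E] :
    E →L[ℝ] C(unitInterval, E) :=
  LinearMap.mkContinuous
    { toFun := fun x => ContinuousMap.const _ x
      map_add' := fun _ _ => rfl
      map_smul' := fun _ _ => rfl } 1
    (fun x => by
      rw [ContinuousMap.norm_le _ (by positivity), one_mul]
      exact fun _ => le_rfl)

/-- Multiplication by the variable on `C([0,1], E)`. -/
noncomputable def mulVarCLM (E : Type) [NormedAddCommGroup E] [NormedSpace ℝ E] :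
    C(unitInterval, E) →L[ℝ] C(unitInterval, E) :=
  LinearMap.mkContinuous
    { toFun := fun f => ⟨fun u => (u : ℝ) • f u, by fun_prop⟩
      map_add' := fun _ _ => by ext; simp
      map_smul' := fun c _ => by ext u; simp [smul_comm c] } 1
    (fun f => by
      rw [ContinuousMap.norm_le _ (by positivity), one_mul]
      intro u
      simp only [LinearMap.coe_mk, AddHom.coe_mk, ContinuousMap.coe_mk, norm_smul]
      refine (mul_le_of_le_one_left (norm_nonneg _) ?_).trans (f.norm_coe_le_norm u)
      rw [Real.norm_of_nonneg u.2.1]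
      exact u.2.2)

/-- The linear map sending `(c, x, e)` to the curve `u ↦ (c * u, x, e u)`. -/
noncomputable def graphCLM (E : Type) [NormedAddCommGroup E] [NormedSpace ℝ E] :
    (ℝ × E × C(unitInterval, E)) →L[ℝ] C(unitInterval, ℝ × E × E) :=
  LinearMap.mkContinuous
    { toFun := fun a => ⟨fun u => (a.1 * u, a.2.1, a.2.2 u), by fun_prop⟩
      map_add' := fun _ _ => by ext <;> simp [add_mul]
      map_smul' := fun c _ => by ext <;> simp [mul_assoc] } 1
    (fun a => by
      rw [ContinuousMap.norm_le _ (by positivity), one_mul]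
      intro u
      simp only [LinearMap.coe_mk, AddHom.coe_mk, ContinuousMap.coe_mk]
      refine norm_prod_le_iff.2 ⟨?_, norm_prod_le_iff.2 ⟨?_, ?_⟩⟩
      · refine le_trans ?_ (norm_fst_le a)
        rw [norm_mul, Real.norm_of_nonneg u.2.1]
        exact mul_le_of_le_one_right (norm_nonneg _) u.2.2
      · exact (norm_fst_le a.2).trans (norm_snd_le a)
      · exact (a.2.2.norm_coe_le_norm u).trans ((norm_snd_le a.2).trans (norm_snd_le a)))

/-- Smooth local solution of the singular system `X = x + t η`, `X' = Ξ`, `Ξ' = F (t, x, η)`,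
`(X, Ξ)(0) = (x, ξ)`, with joint smoothness in time and initial data. -/
theorem exists_contDiffOn_solution {E : Type} [NormedAddCommGroup E] [NormedSpace ℝ E]
    [CompleteSpace E] (F : ℝ × E × E → E) (hF : ContDiff ℝ (⊤ : ℕ∞) F) (z₀ : E × E) :
    ∃ δ > 0, ∃ η Ξ : ℝ × (E × E) → E,
      ContDiffOn ℝ (⊤ : ℕ∞) η (Metric.ball 0 δ ×ˢ Metric.ball z₀ δ) ∧
      ContDiffOn ℝ (⊤ : ℕ∞) Ξ (Metric.ball 0 δ ×ˢ Metric.ball z₀ δ) ∧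
      η (0, z₀) = z₀.2 ∧
      ∀ z ∈ Metric.ball z₀ δ, Ξ (0, z) = z.2 ∧ ∀ t ∈ Metric.ball (0 : ℝ) δ,
        HasDerivAt (fun s => z.1 + s • η (s, z)) (Ξ (t, z)) t ∧
        HasDerivAt (fun s => Ξ (s, z)) (F (t, z.1, η (t, z))) t := by
  let S : (ℝ × (E × E)) × C(unitInterval, E) → C(unitInterval, E) := fun a =>
    averageCLM E (ContinuousMap.comp ⟨F, hF.continuous⟩ (graphCLM E (a.1.1, a.1.2.1, a.2)))
  have hS : ContDiff ℝ (⊤ : ℕ∞) S := by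
    refine (averageCLM E).contDiff.comp ((ContinuousMap.contDiff_comp_infty _ hF).comp
      ((graphCLM E).contDiff.comp ?_))
    fun_prop
  have hS_apply : ∀ t z e u, S ((t, z), e) u =
      ∫ s : unitInterval, F (t * (s * u : unitInterval), z.1, e (s * u)) := fun _ _ _ _ => rfl
  let H : (ℝ × (E × E)) × C(unitInterval, E) → C(unitInterval, E) := fun a =>
    constCLM E a.1.2.2 + a.1.1 • averageCLM E (mulVarCLM E (S a))
  have hS' : ContDiff ℝ (⊤ : ℕ∞) fun a => averageCLM E (mulVarCLM E (S a)) :=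
    (averageCLM E).contDiff.comp ((mulVarCLM E).contDiff.comp hS)
  have hH : ContDiff ℝ (⊤ : ℕ∞) H :=
    ((constCLM E).contDiff.comp (contDiff_snd.comp (contDiff_snd.comp contDiff_fst))).add
      ((contDiff_fst.comp contDiff_fst).smul hS')
  have hH_apply : ∀ t z e u, H ((t, z), e) u = z.2 +
      t • ∫ s : unitInterval, ((s * u : unitInterval) : ℝ) • S ((t, z), e) (s * u) :=
    fun _ _ _ _ => rfl
  obtain ⟨δ, hδ, r, hr, ε, hε, hε₀, hfix, huniq⟩ := exists_contDiffOn_fixedPoint H hH (0, z₀)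
    (constCLM E z₀.2) (by simp [H])
    (constCLM E ∘L ContinuousLinearMap.snd ℝ E E ∘L ContinuousLinearMap.snd ℝ ℝ (E × E) +
      (ContinuousLinearMap.fst ℝ ℝ (E × E)).smulRight
        (averageCLM E (mulVarCLM E (S ((0, z₀), constCLM E z₀.2))))) (by
      have h1 : HasFDerivAt (fun a : (ℝ × (E × E)) × C(unitInterval, E) => constCLM E a.1.2.2)
          (constCLM E ∘L ContinuousLinearMap.snd ℝ E E ∘L ContinuousLinearMap.snd ℝ ℝ (E × E) ∘L
            ContinuousLinearMap.fst ℝ (ℝ × (E × E)) C(unitInterval, E))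
          ((0, z₀), constCLM E z₀.2) := (constCLM E ∘L ContinuousLinearMap.snd ℝ E E ∘L
            ContinuousLinearMap.snd ℝ ℝ (E × E) ∘L
            ContinuousLinearMap.fst ℝ (ℝ × (E × E)) C(unitInterval, E)).hasFDerivAt
      have h2 : HasFDerivAt (fun a : (ℝ × (E × E)) × C(unitInterval, E) => a.1.1)
          (ContinuousLinearMap.fst ℝ ℝ (E × E) ∘L
            ContinuousLinearMap.fst ℝ (ℝ × (E × E)) C(unitInterval, E))
          ((0, z₀), constCLM E z₀.2) := (ContinuousLinearMap.fst ℝ ℝ (E × E) ∘L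
            ContinuousLinearMap.fst ℝ (ℝ × (E × E)) C(unitInterval, E)).hasFDerivAt
      refine (h1.add (h2.smul (hS'.differentiable (by simp) _).hasFDerivAt)).congr_fderiv ?_
      refine ContinuousLinearMap.ext fun a => ?_
      simp)
  rw [← ball_prod_same] at hfix huniq hε
  have hscale : ∀ t ∈ Metric.ball (0 : ℝ) δ, ∀ s : unitInterval, t * s ∈ Metric.ball (0 : ℝ) δ := by
    intro t ht s
    rw [mem_ball_zero_iff, norm_mul, Real.norm_of_nonneg s.2.1] at *
    exact (mul_le_of_le_one_right (norm_nonneg _) s.2.2).trans_lt ht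
  have hres : ∀ z ∈ Metric.ball z₀ δ, ∀ t ∈ Metric.ball (0 : ℝ) δ, ∀ s : unitInterval,
      ε (t, z) s = ε (t * s, z) 1 := by
    intro z hz t ht s
    obtain ⟨h1, h2⟩ := hfix (t, z) ⟨ht, hz⟩
    have key := huniq (t * s, z) ⟨hscale t ht s, hz⟩
      ⟨fun u => ε (t, z) (u * s), by fun_prop⟩ ?_ ?_
    · rw [← key]; simp
    · rw [Metric.mem_ball, ContinuousMap.dist_lt_iff hr] at h1 ⊢
      exact fun u => h1 (u * s)
    · ext u
      have h3 := DFunLike.congr_fun h2 (u * s)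
      simp only [ContinuousMap.coe_mk]
      rw [← h3, hH_apply, hH_apply, mul_smul, ← integral_smul]
      congr 2
      refine integral_congr_ae (ae_of_all _ fun v => ?_)
      simp only [hS_apply, ContinuousMap.coe_mk, smul_smul]
      have : ∀ w : unitInterval, t * s * (w * (v * u) : unitInterval)
          = t * (w * (v * (u * s)) : unitInterval) := by
        intro w; push_cast; ring
      simp only [this, mul_assoc]
      congr 1
      push_cast; ring
  have hη : ContDiffOn ℝ (⊤ : ℕ∞) (fun q => ε q 1) (Metric.ball 0 δ ×ˢ Metric.ball z₀ δ) :=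
    (ContinuousMap.evalCLM ℝ (M := E) (1 : unitInterval)).contDiff.comp_contDiffOn hε
  have hΞ : ContDiffOn ℝ (⊤ : ℕ∞) (fun q : ℝ × (E × E) => q.2.2 + q.1 • S (q, ε q) 1)
      (Metric.ball 0 δ ×ˢ Metric.ball z₀ δ) := by
    refine ContDiffOn.add (by fun_prop) (ContDiffOn.smul (by fun_prop) ?_)
    exact (ContinuousMap.evalCLM ℝ (1 : unitInterval)).contDiff.comp_contDiffOn
      (hS.comp_contDiffOn (contDiffOn_id.prodMk hε))
  have hline : ∀ z ∈ Metric.ball z₀ δ, MapsTo (fun t : ℝ => (t, z)) (Metric.ball 0 δ)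
      (Metric.ball 0 δ ×ˢ Metric.ball z₀ δ) := fun z hz t ht => ⟨ht, hz⟩
  refine ⟨δ, hδ, fun q => ε q 1, fun q => q.2.2 + q.1 • S (q, ε q) 1, hη, hΞ, ?_, ?_⟩
  · simp only [hε₀]; rfl
  intro z hz
  refine ⟨by simp, fun t ht => ?_⟩
  have hΞeq : ∀ t ∈ Metric.ball (0 : ℝ) δ, S ((t, z), ε (t, z)) 1 =
      ∫ s : unitInterval, F (t * s, z.1, ε (t * s, z) 1) := by
    intro t ht
    rw [hS_apply]
    simp only [mul_one, hres z hz t ht]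
  have hηeq : ∀ t ∈ Metric.ball (0 : ℝ) δ, ε (t, z) 1 =
      ∫ s : unitInterval, (z.2 + (t * s) • S ((t * s, z), ε (t * s, z)) 1) := by
    intro t ht
    have hc : Continuous fun s : unitInterval => (t * s) • S ((t * s, z), ε (t * s, z)) 1 := by
      have : ContinuousOn (fun t : ℝ => t • S ((t, z), ε (t, z)) 1) (Metric.ball 0 δ) := by
        have := (hΞ.continuousOn.comp (by fun_prop : Continuous fun t : ℝ => (t, z)).continuousOn
          (hline z hz)).sub (continuousOn_const (c := z.2))
        simpa [Function.comp_def, Pi.sub_def] using this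
      exact this.comp_continuous (by fun_prop) fun s => hscale t ht s
    rw [integral_add (integrable_const _)
      (hc.integrable_of_hasCompactSupport (HasCompactSupport.of_compactSpace _))]
    conv_lhs => rw [← (hfix (t, z) ⟨ht, hz⟩).2]
    rw [hH_apply, ← integral_smul]
    simp only [integral_const, probReal_univ, one_smul]
    congr 2
    funext s
    rw [hΞeq _ (hscale t ht s), hS_apply, smul_smul, mul_one]
    congr 2
    funext v
    rw [hres z hz t ht]
    have : t * (v * s : unitInterval) = t * s * v := by push_cast; ring
    rw [this]
  have hnhds : ∀ᶠ s in 𝓝 t, s ∈ Metric.ball (0 : ℝ) δ := Metric.isOpen_ball.mem_nhds ht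
  constructor
  · refine HasDerivAt.congr_of_eventuallyEq (HasDerivAt.const_add z.1 (hasDerivAt_smul_average
      (φ := fun t => z.2 + t • S ((t, z), ε (t, z)) 1)
      (hΞ.continuousOn.comp (by fun_prop : Continuous fun t : ℝ => (t, z)).continuousOn
          (hline z hz)) ht)) ?_
    filter_upwards [hnhds] with s hs
    rw [hηeq s hs]
  · refine HasDerivAt.congr_of_eventuallyEq (HasDerivAt.const_add z.2 (hasDerivAt_smul_average
      (φ := fun t => F (t, z.1, ε (t, z) 1)) ?_ ht)) ?_
    · refine hF.continuous.comp_continuousOn (continuousOn_id.prodMk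
        (continuousOn_const.prodMk ?_))
      exact hη.continuousOn.comp (by fun_prop : Continuous fun t : ℝ => (t, z)).continuousOn
          (hline z hz)
    · filter_upwards [hnhds] with s hs
      rw [hΞeq s hs]

/-- Hadamard's lemma along lines: `g (x + t η) = g x + t G (t, x, η)` with `G` smooth. -/
theorem exists_contDiff_lineQuotient {E F : Type} [NormedAddCommGroup E] [NormedSpace ℝ E]
    [NormedAddCommGroup F] [NormedSpace ℝ F] [CompleteSpace F] (g : E → F)
    (hg : ContDiff ℝ (⊤ : ℕ∞) g) :
    ∃ G : ℝ × E × E → F, ContDiff ℝ (⊤ : ℕ∞) G ∧ (∀ x η, G (0, x, η) = fderiv ℝ g x η) ∧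
      ∀ t x η, g (x + t • η) = g x + t • G (t, x, η) := by
  have hf : ContDiff ℝ (⊤ : ℕ∞) fun a : ℝ × E × E => fderiv ℝ g (a.2.1 + a.1 • a.2.2) a.2.2 :=
    ((hg.fderiv_right (m := (⊤ : ℕ∞)) (by simp)).comp (by fun_prop)).clm_apply (by fun_prop)
  let f : C(ℝ × E × E, F) := ⟨_, hf.continuous⟩
  have hG_apply : ∀ t x η, averageCLM F (f.comp
      (graphCLM E (t, x, constCLM E η))) 1 =
      ∫ s : unitInterval, fderiv ℝ g (x + (t * s) • η) η := by
    intro t x η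
    rw [averageCLM_apply]
    simp only [mul_one]
    rfl
  refine ⟨fun a => averageCLM F (f.comp
    (graphCLM E (a.1, a.2.1, constCLM E a.2.2))) 1, ?_, fun x η => ?_, fun t x η => ?_⟩
  · refine (ContinuousMap.evalCLM ℝ (M := F) (1 : unitInterval)).contDiff.comp ((averageCLM F).contDiff.comp
      ((ContinuousMap.contDiff_comp_infty f hf).comp ((graphCLM E).contDiff.comp ?_)))
    exact contDiff_fst.prodMk ((contDiff_fst.comp contDiff_snd).prodMk
      ((constCLM E).contDiff.comp (contDiff_snd.comp contDiff_snd)))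
  · simp only [hG_apply]
    simp
  · simp only [hG_apply]
    rw [smul_average_eq_intervalIntegral (fun s => fderiv ℝ g (x + s • η) η)]
    rw [intervalIntegral.integral_eq_sub_of_hasDerivAt (f := fun s : ℝ => g (x + s • η))]
    · simp
    · intro s _
      have h1 : HasDerivAt (fun s : ℝ => x + s • η) η s := by
        simpa using ((hasDerivAt_id s).smul_const η).const_add x
      exact (hg.differentiable (by simp) _).hasFDerivAt.comp_hasDerivAt s h1
    · refine Continuous.intervalIntegrable ?_ _ _
      exact hf.continuous.comp (by fun_prop : Continuous fun s : ℝ => (s, x, η))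

/-- Away from the origin the norm and the normalization map agree locally with globally smooth
maps. -/
theorem exists_contDiff_eventuallyEq_norm {F : Type} [NormedAddCommGroup F]
    [InnerProductSpace ℝ F] {y₀ : F} (hy₀ : y₀ ≠ 0) :
    ∃ n : F → F, ∃ m : F → ℝ, ContDiff ℝ (⊤ : ℕ∞) n ∧ ContDiff ℝ (⊤ : ℕ∞) m ∧
      ∀ᶠ y in 𝓝 y₀, y ≠ 0 ∧ n y = ‖y‖⁻¹ • y ∧ m y = ‖y‖ := by
  have hpos : 0 < ‖y₀‖ := norm_pos_iff.2 hy₀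
  let β : ContDiffBump y₀ := ⟨‖y₀‖ / 4, ‖y₀‖ / 2, by positivity, by linarith⟩
  have hβ : ∀ᶠ y in 𝓝 (0 : F), β y = 0 := by
    have : (0 : F) ∉ tsupport β := by
      rw [β.tsupport_eq, Metric.mem_closedBall, dist_zero_left]
      simp only [β]
      linarith
    exact notMem_tsupport_iff_eventuallyEq.1 this
  have hsmooth : ∀ {F' : Type} [NormedAddCommGroup F'] [NormedSpace ℝ F'] (h : F → F'),
      (∀ y ≠ 0, ContDiffAt ℝ (⊤ : ℕ∞) h y) → ContDiff ℝ (⊤ : ℕ∞) fun y => β y • h y := by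
    intro F' _ _ h hh
    refine contDiff_iff_contDiffAt.2 fun y => ?_
    rcases eq_or_ne y 0 with rfl | hy
    · refine (contDiffAt_const (c := (0 : F'))).congr_of_eventuallyEq ?_
      filter_upwards [hβ] with y hy
      simp [hy]
    · exact β.contDiffAt.smul (hh y hy)
  refine ⟨fun y => β y • ‖y‖⁻¹ • y, fun y => β y • ‖y‖,
    hsmooth _ fun y hy => ((contDiffAt_norm ℝ hy).inv (norm_ne_zero_iff.2 hy)).smul contDiffAt_id,
    hsmooth _ fun y hy => contDiffAt_norm ℝ hy, ?_⟩
  filter_upwards [isOpen_ne.mem_nhds hy₀, β.eventuallyEq_one] with y hy h1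
  simp only [Pi.one_apply] at h1
  simp [h1, hy]

/-- The Riesz isomorphism of a real Hilbert space, as a linear equivalence. -/
noncomputable def rieszCLE (E : Type) [NormedAddCommGroup E] [InnerProductSpace ℝ E]
    [CompleteSpace E] : E ≃L[ℝ] (E →L[ℝ] ℝ) where
  toFun := InnerProductSpace.toDual ℝ E
  invFun := (InnerProductSpace.toDual ℝ E).symm
  map_add' := by simp
  map_smul' := by simp
  left_inv := by intro; simp
  right_inv := by intro; simp
  continuous_toFun := (InnerProductSpace.toDual ℝ E).continuous
  continuous_invFun := (InnerProductSpace.toDual ℝ E).symm.continuous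

theorem HasFDerivAt.norm_rieszCLE {E F : Type} [NormedAddCommGroup E] [NormedSpace ℝ E]
    [NormedAddCommGroup F] [InnerProductSpace ℝ F] [CompleteSpace F] {g : E → F}
    {g' : E →L[ℝ] F} {x : E} (hg : HasFDerivAt g g' x) (hx : g x ≠ 0) :
    HasFDerivAt (fun y => ‖g y‖) ((rieszCLE F (‖g x‖⁻¹ • g x)) ∘L g') x := by
  have h := hg.norm_sq.sqrt (by simpa using hx)
  simp only [Real.sqrt_sq (norm_nonneg _)] at h
  refine h.congr_fderiv ?_
  ext v
  have : ‖g x‖ ≠ 0 := norm_ne_zero_iff.2 hx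
  simp [rieszCLE]
  field_simp

theorem gradient_mul_norm_add_s4 {E F : Type} [NormedAddCommGroup E] [InnerProductSpace ℝ E]
    [CompleteSpace E] [NormedAddCommGroup F] [InnerProductSpace ℝ F] [CompleteSpace F]
    {w V₀ V : E → ℝ} {g : E → F} (hV : ∀ y, V y = w y * ‖g y‖ + V₀ y) {x : E}
    (hw : DifferentiableAt ℝ w x) (hV₀ : DifferentiableAt ℝ V₀ x) (hg : DifferentiableAt ℝ g x)
    (hx : g x ≠ 0) :
    gradient V x = (rieszCLE E).symm (w x • (rieszCLE F (‖g x‖⁻¹ • g x) ∘L fderiv ℝ g x) +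
      ‖g x‖ • fderiv ℝ w x + fderiv ℝ V₀ x) := by
  have h := (hw.hasFDerivAt.mul (hg.hasFDerivAt.norm_rieszCLE hx)).add hV₀.hasFDerivAt
  have hV' : V = (w * fun y => ‖g y‖) + V₀ := funext hV
  rw [gradient, hV', h.fderiv]
  rfl

/-- One-sided broken flow: for `σ = 1` the outgoing one (`t > 0`), for `σ = -1` the incoming one
(`t < 0`). -/
theorem exists_contDiffOn_brokenFlow {E F : Type} [NormedAddCommGroup E] [InnerProductSpace ℝ E]
    [CompleteSpace E] [NormedAddCommGroup F] [InnerProductSpace ℝ F] [CompleteSpace F]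
    {w V₀ V : E → ℝ} {g : E → F} (hw : ContDiff ℝ (⊤ : ℕ∞) w) (hV₀ : ContDiff ℝ (⊤ : ℕ∞) V₀)
    (hg : ContDiff ℝ (⊤ : ℕ∞) g) (hV : ∀ y, V y = w y * ‖g y‖ + V₀ y) (z₀ : E × E)
    (hdg : fderiv ℝ g z₀.1 z₀.2 ≠ 0) {σ : ℝ} (hσ : |σ| = 1) :
    ∃ δ > 0, ∃ Ψ : ℝ × (E × E) → E × E,
      ContDiffOn ℝ (⊤ : ℕ∞) Ψ (Metric.ball 0 δ ×ˢ Metric.ball z₀ δ) ∧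
      ∀ z ∈ Metric.ball z₀ δ, g z.1 = 0 → Ψ (0, z) = z ∧
        ∀ t ∈ Metric.ball (0 : ℝ) δ, 0 < σ * t → g (Ψ (t, z)).1 ≠ 0 ∧
          HasDerivAt (fun s => Ψ (s, z)) ((Ψ (t, z)).2, -gradient V (Ψ (t, z)).1) t := by
  obtain ⟨G, hG, hG₀, hGline⟩ := exists_contDiff_lineQuotient g hg
  obtain ⟨n, m, hn, hm, hnm⟩ := exists_contDiff_eventuallyEq_norm hdg
  have hdw := hw.fderiv_right (m := (⊤ : ℕ∞)) (by simp)
  have hdV₀ := hV₀.fderiv_right (m := (⊤ : ℕ∞)) (by simp)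
  have hdg' := hg.fderiv_right (m := (⊤ : ℕ∞)) (by simp)
  let X : ℝ × E × E → E := fun a => a.2.1 + a.1 • a.2.2
  have hX : ContDiff ℝ (⊤ : ℕ∞) X := by fun_prop
  let A : ℝ × E × E → E := fun a => -(rieszCLE E).symm
    (w (X a) • (rieszCLE F (σ • n (G a)) ∘L fderiv ℝ g (X a)) +
      (σ * a.1 * m (G a)) • fderiv ℝ w (X a) + fderiv ℝ V₀ (X a))
  have hA : ContDiff ℝ (⊤ : ℕ∞) A := by
    refine ((rieszCLE E).symm.contDiff.comp (ContDiff.add (ContDiff.add ?_ ?_) ?_)).neg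
    · exact (hw.comp hX).smul (((rieszCLE F).contDiff.comp
        (contDiff_const.smul (hn.comp hG))).clm_comp (hdg'.comp hX))
    · exact ((contDiff_const.mul contDiff_fst).mul (hm.comp hG)).smul (hdw.comp hX)
    · exact hdV₀.comp hX
  obtain ⟨δ, hδ, η, Ξ, hη, hΞ, hη₀, hsol⟩ := exists_contDiffOn_solution A hA z₀
  have hcont : ContinuousAt (fun q : ℝ × (E × E) => G (q.1, q.2.1, η q)) (0, z₀) := by
    have h1 : ContinuousAt η (0, z₀) := hη.continuousOn.continuousAt
      ((Metric.isOpen_ball.prod Metric.isOpen_ball).mem_nhds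
        ⟨Metric.mem_ball_self hδ, Metric.mem_ball_self hδ⟩)
    exact hG.continuous.continuousAt.comp (by fun_prop)
  have hev : ∀ᶠ q : ℝ × (E × E) in 𝓝 (0, z₀), G (q.1, q.2.1, η q) ≠ 0 ∧
      n (G (q.1, q.2.1, η q)) = ‖G (q.1, q.2.1, η q)‖⁻¹ • G (q.1, q.2.1, η q) ∧
      m (G (q.1, q.2.1, η q)) = ‖G (q.1, q.2.1, η q)‖ := by
    refine hcont.eventually (p := fun y => y ≠ 0 ∧ n y = ‖y‖⁻¹ • y ∧ m y = ‖y‖) ?_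
    simpa only [hη₀, hG₀] using hnm
  obtain ⟨δ', hδ', hball⟩ := Metric.eventually_nhds_iff_ball.1 hev
  rw [← ball_prod_same] at hball
  have hsub {α : Type} [PseudoMetricSpace α] (a : α) :
      Metric.ball a (min δ δ') ⊆ Metric.ball a δ := Metric.ball_subset_ball (min_le_left _ _)
  have hsub' {α : Type} [PseudoMetricSpace α] (a : α) :
      Metric.ball a (min δ δ') ⊆ Metric.ball a δ' := Metric.ball_subset_ball (min_le_right _ _)
  have hprod := prod_mono (hsub (0 : ℝ)) (hsub z₀)
  refine ⟨min δ δ', lt_min hδ hδ', fun q => (q.2.1 + q.1 • η q, Ξ q), ?_, ?_⟩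
  · refine ContDiffOn.prodMk (ContDiffOn.add (by fun_prop) ?_) (hΞ.mono hprod)
    exact contDiff_fst.contDiffOn.smul (hη.mono hprod)
  intro z hz hgz
  obtain ⟨hΞz, hode⟩ := hsol z (hsub _ hz)
  refine ⟨by simp [hΞz], fun t ht hσt => ?_⟩
  obtain ⟨hode₁, hode₂⟩ := hode t (hsub _ ht)
  obtain ⟨hG0, hn', hm'⟩ := hball (t, z) ⟨hsub' _ ht, hsub' _ hz⟩
  have hσ2 : σ * σ = 1 := by rw [← abs_mul_abs_self, hσ, one_mul]
  have ht0 : t ≠ 0 := by rintro rfl; simp at hσt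
  have hgX : g (z.1 + t • η (t, z)) = t • G (t, z.1, η (t, z)) := by rw [hGline, hgz, zero_add]
  have hne : g (z.1 + t • η (t, z)) ≠ 0 := by rw [hgX]; exact smul_ne_zero ht0 hG0
  have habs : |t| = σ * t := by rw [← abs_of_pos hσt, abs_mul, hσ, one_mul]
  have hnorm : ‖g (z.1 + t • η (t, z))‖ = σ * t * m (G (t, z.1, η (t, z))) := by
    rw [hgX, norm_smul, Real.norm_eq_abs, habs, hm']
  have hdir : ‖g (z.1 + t • η (t, z))‖⁻¹ • g (z.1 + t • η (t, z)) =
      σ • n (G (t, z.1, η (t, z))) := by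
    have hσ0 : σ ≠ 0 := by rintro rfl; simp at hσ
    have hG0' := norm_ne_zero_iff.2 hG0
    rw [hnorm, hgX, hn', hm', smul_smul, smul_smul]
    congr 1
    field_simp
    rw [sq, hσ2]
  refine ⟨hne, hode₁.prodMk ?_⟩
  convert! hode₂ using 1
  rw [gradient_mul_norm_add_s4 hV (hw.differentiable (by simp) _) (hV₀.differentiable (by simp) _)
    (hg.differentiable (by simp) _) hne, hdir, hnorm]

/-- The outgoing (resp. incoming) broken trajectories issued from points of S* near
(x₀,ξ₀) ∈ S* are the restrictions to S* of maps Ψ (resp. Ψ') that are smooth jointly in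
(t,x,ξ) on [0,τ₀] × Ω (resp. [−τ₀,0] × Ω) for a full neighborhood Ω of (x₀,ξ₀). -/
theorem stmt4 (d p : ℕ) (hd : 1 ≤ d) (hp : 1 ≤ p) (hpd : p ≤ d)
    (w V₀ : EuclideanSpace ℝ (Fin d) → ℝ)
    (g : EuclideanSpace ℝ (Fin d) → EuclideanSpace ℝ (Fin p))
    (hw : ContDiff ℝ (⊤ : ℕ∞) w) (hV₀ : ContDiff ℝ (⊤ : ℕ∞) V₀) (hg : ContDiff ℝ (⊤ : ℕ∞) g)
    (V : EuclideanSpace ℝ (Fin d) → ℝ) (hV : ∀ y, V y = w y * ‖g y‖ + V₀ y)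
    (x₀ ξ₀ : EuclideanSpace ℝ (Fin d)) (hgx₀ : g x₀ = 0) (hdg : fderiv ℝ g x₀ ξ₀ ≠ 0) :
    ∃ τ₀ > (0:ℝ),
      ∃ Ω : Set (EuclideanSpace ℝ (Fin d) × EuclideanSpace ℝ (Fin d)),
        IsOpen Ω ∧ (x₀, ξ₀) ∈ Ω ∧
        (∃ Ψ : ℝ × (EuclideanSpace ℝ (Fin d) × EuclideanSpace ℝ (Fin d)) →
            EuclideanSpace ℝ (Fin d) × EuclideanSpace ℝ (Fin d),
          ContDiffOn ℝ (⊤ : ℕ∞) Ψ (Set.Icc 0 τ₀ ×ˢ Ω) ∧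
          ∀ z ∈ Ω, g z.1 = 0 → fderiv ℝ g z.1 z.2 ≠ 0 →
            Ψ (0, z) = z ∧
            ∀ t ∈ Set.Ioc 0 τ₀, g (Ψ (t, z)).1 ≠ 0 ∧
              HasDerivAt (fun s => Ψ (s, z)) ((Ψ (t, z)).2, -gradient V (Ψ (t, z)).1) t) ∧
        (∃ Ψ' : ℝ × (EuclideanSpace ℝ (Fin d) × EuclideanSpace ℝ (Fin d)) →
            EuclideanSpace ℝ (Fin d) × EuclideanSpace ℝ (Fin d),
          ContDiffOn ℝ (⊤ : ℕ∞) Ψ' (Set.Icc (-τ₀) 0 ×ˢ Ω) ∧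
          ∀ z ∈ Ω, g z.1 = 0 → fderiv ℝ g z.1 z.2 ≠ 0 →
            Ψ' (0, z) = z ∧
            ∀ t ∈ Set.Ico (-τ₀) 0, g (Ψ' (t, z)).1 ≠ 0 ∧
              HasDerivAt (fun s => Ψ' (s, z)) ((Ψ' (t, z)).2, -gradient V (Ψ' (t, z)).1) t) := by
  have key := fun σ (hσ : |σ| = 1) =>
    exists_contDiffOn_brokenFlow hw hV₀ hg hV (x₀, ξ₀) hdg (σ := σ) hσ
  obtain ⟨δ, hδ, Ψ, hΨ, hsol⟩ := key 1 (by simp)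
  obtain ⟨δ', hδ', Ψ', hΨ', hsol'⟩ := key (-1) (by simp)
  have h1 := min_le_left δ δ'
  have h2 := min_le_right δ δ'
  have h3 := lt_min hδ hδ'
  refine ⟨min δ δ' / 2, half_pos h3, Metric.ball (x₀, ξ₀) (min δ δ'), Metric.isOpen_ball,
    Metric.mem_ball_self h3, ⟨Ψ, hΨ.mono (prod_mono ?_ (Metric.ball_subset_ball h1)), ?_⟩,
    ⟨Ψ', hΨ'.mono (prod_mono ?_ (Metric.ball_subset_ball h2)), ?_⟩⟩
  · intro t ht
    rw [mem_ball_zero_iff, Real.norm_eq_abs, abs_lt]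
    constructor <;> linarith [ht.1, ht.2]
  · intro z hz hgz _
    obtain ⟨hz0, hzt⟩ := hsol z (Metric.ball_subset_ball h1 hz) hgz
    refine ⟨hz0, fun t ht => hzt t ?_ (by linarith [ht.1])⟩
    rw [mem_ball_zero_iff, Real.norm_eq_abs, abs_lt]
    constructor <;> linarith [ht.1, ht.2]
  · intro t ht
    rw [mem_ball_zero_iff, Real.norm_eq_abs, abs_lt]
    constructor <;> linarith [ht.1, ht.2]
  · intro z hz hgz _
    obtain ⟨hz0, hzt⟩ := hsol' z (Metric.ball_subset_ball h2 hz) hgz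
    refine ⟨hz0, fun t ht => hzt t ?_ (by linarith [ht.2])⟩
    rw [mem_ball_zero_iff, Real.norm_eq_abs, abs_lt]
    constructor <;> linarith [ht.1, ht.2]
end

section
/- Let n ≥ 1, T > 0. Let Q₀ be a real n×n matrix with Q₀² = 0, let P : [0, T] → M_n(ℝ) and F : [0, T] → ℝ^n be continuous. Then there exist τ ∈ (0, T] and a unique continuous map Z : [0, τ] → ℝ^n with Z(0) = 0 which is differentiable on (0, τ] and satisfies, for all t ∈ (0, τ], t Z'(t) + Z(t) + Q₀ Z(t) = t P(t) Z(t) + t F(t). Equivalently, Z is the unique continuous solution of the fixed point equation Z(t) = t ∫₀¹ e^{Q₀ ln θ} ( θ P(tθ) Z(tθ) + θ F(tθ) ) dθ, where e^{Q₀ ln θ} = I + (ln θ) Q₀. -/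
open Set Filter Topology

section SingularODE

variable {E : Type*} [NormedAddCommGroup E] [NormedSpace ℝ E]

/-- The average `∫₀¹ g (t θ) dθ` of `g` over the segment from `0` to `t`. -/
noncomputable def segmentAverage (g : ℝ → E) (t : ℝ) : E :=
  ∫ θ in (0 : ℝ)..1, g (t * θ)

lemma continuous_segmentAverage {g : ℝ → E} (hg : Continuous g) :
    Continuous (segmentAverage g) :=
  intervalIntegral.continuous_parametric_intervalIntegral_of_continuous'
    (by fun_prop) 0 1

lemma norm_segmentAverage_le {g : ℝ → E} {C : ℝ} (hC : ∀ t, ‖g t‖ ≤ C) (t : ℝ) :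
    ‖segmentAverage g t‖ ≤ C := by
  simpa [segmentAverage] using intervalIntegral.norm_integral_le_of_norm_le_const
    (a := (0 : ℝ)) (b := 1) (f := fun θ => g (t * θ)) (C := C) (fun θ _ => hC _)

lemma segmentAverage_sub {g h : ℝ → E} (hg : Continuous g) (hh : Continuous h) :
    segmentAverage (fun t => g t - h t) = fun t => segmentAverage g t - segmentAverage h t := by
  funext t
  exact intervalIntegral.integral_sub
    (Continuous.intervalIntegrable (by fun_prop) _ _)
    (Continuous.intervalIntegrable (by fun_prop) _ _)

lemma ContinuousLinearMap.map_segmentAverage [CompleteSpace E] (Q : E →L[ℝ] E) {g : ℝ → E}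
    (hg : Continuous g) (t : ℝ) :
    Q (segmentAverage g t) = segmentAverage (fun s => Q (g s)) t :=
  (Q.intervalIntegral_comp_comm (Continuous.intervalIntegrable (by fun_prop) _ _)).symm

lemma smul_segmentAverage (g : ℝ → E) (t : ℝ) :
    t • segmentAverage g t = ∫ s in (0 : ℝ)..t, g s := by
  simp [segmentAverage]

lemma hasDerivAt_segmentAverage [CompleteSpace E] {g : ℝ → E} (hg : Continuous g) {t : ℝ}
    (ht : t ≠ 0) :
    HasDerivAt (segmentAverage g) (t⁻¹ • (g t - segmentAverage g t)) t := by
  have h1 : HasDerivAt (fun t => ∫ s in (0 : ℝ)..t, g s) (g t) t :=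
    intervalIntegral.integral_hasDerivAt_right (hg.intervalIntegrable _ _)
      hg.aestronglyMeasurable.stronglyMeasurableAtFilter hg.continuousAt
  have h2 := (hasDerivAt_inv ht).smul h1
  have h3 : HasDerivAt (segmentAverage g)
      (t⁻¹ • g t + (-(t ^ 2)⁻¹) • ∫ s in (0 : ℝ)..t, g s) t := by
    refine h2.congr_of_eventuallyEq ?_
    filter_upwards [isOpen_ne.mem_nhds ht] with s hs
    simp only [Pi.smul_apply', ← smul_segmentAverage, smul_smul]
    rw [inv_mul_cancel₀ hs, one_smul]
  convert h3 using 1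
  rw [← smul_segmentAverage, smul_smul, smul_sub, sub_eq_add_neg, ← neg_smul]
  congr 2
  field_simp

/-- When `Q² = 0`, the solution operator of `t Z' + Z + Q Z = g`. -/
noncomputable def nilpotentSolution (Q : E →L[ℝ] E) (g : ℝ → E) (t : ℝ) : E :=
  segmentAverage g t - segmentAverage (segmentAverage fun s => Q (g s)) t

lemma continuous_nilpotentSolution (Q : E →L[ℝ] E) {g : ℝ → E} (hg : Continuous g) :
    Continuous (nilpotentSolution Q g) :=
  (continuous_segmentAverage hg).sub
    (continuous_segmentAverage (continuous_segmentAverage (by fun_prop)))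

lemma norm_nilpotentSolution_le (Q : E →L[ℝ] E) {g : ℝ → E} {C : ℝ}
    (hC : ∀ t, ‖g t‖ ≤ C) (t : ℝ) : ‖nilpotentSolution Q g t‖ ≤ (1 + ‖Q‖) * C := by
  have h1 := norm_segmentAverage_le hC t
  have h2 : ‖segmentAverage (segmentAverage fun s => Q (g s)) t‖ ≤ ‖Q‖ * C :=
    norm_segmentAverage_le (norm_segmentAverage_le fun s => Q.le_opNorm_of_le (hC s)) t
  calc _ ≤ _ := norm_sub_le _ _
    _ ≤ C + ‖Q‖ * C := add_le_add h1 h2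
    _ = _ := by ring

lemma nilpotentSolution_sub (Q : E →L[ℝ] E) {g h : ℝ → E} (hg : Continuous g)
    (hh : Continuous h) (t : ℝ) :
    nilpotentSolution Q g t - nilpotentSolution Q h t
      = nilpotentSolution Q (fun s => g s - h s) t := by
  have hQg : Continuous fun s => Q (g s) := by fun_prop
  have hQh : Continuous fun s => Q (h s) := by fun_prop
  simp only [nilpotentSolution, map_sub, segmentAverage_sub hg hh, segmentAverage_sub hQg hQh,
    segmentAverage_sub (continuous_segmentAverage hQg) (continuous_segmentAverage hQh)]
  abel

lemma map_nilpotentSolution [CompleteSpace E] {Q : E →L[ℝ] E} (hQ : ∀ v, Q (Q v) = 0)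
    {g : ℝ → E} (hg : Continuous g) (t : ℝ) :
    Q (nilpotentSolution Q g t) = segmentAverage (fun s => Q (g s)) t := by
  have hQg : Continuous fun s => Q (g s) := by fun_prop
  rw [nilpotentSolution, map_sub, Q.map_segmentAverage hg,
    Q.map_segmentAverage (continuous_segmentAverage hQg)]
  simp only [Q.map_segmentAverage hQg, hQ]
  simp [segmentAverage]

lemma hasDerivAt_nilpotentSolution [CompleteSpace E] {Q : E →L[ℝ] E} (hQ : ∀ v, Q (Q v) = 0)
    {g : ℝ → E} (hg : Continuous g) {t : ℝ} (ht : t ≠ 0) :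
    ∃ Z' : E, HasDerivAt (nilpotentSolution Q g) Z' t ∧
      t • Z' + nilpotentSolution Q g t + Q (nilpotentSolution Q g t) = g t := by
  have hQg : Continuous fun s => Q (g s) := by fun_prop
  refine ⟨_, (hasDerivAt_segmentAverage hg ht).sub
    (hasDerivAt_segmentAverage (continuous_segmentAverage hQg) ht), ?_⟩
  rw [map_nilpotentSolution hQ hg, nilpotentSolution, smul_sub, smul_smul, smul_smul,
    mul_inv_cancel₀ ht, one_smul, one_smul]
  abel

lemma norm_le_of_hasDerivAt_smul {f g : ℝ → E} {τ C : ℝ} (hC : 0 ≤ C)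
    (hf : ContinuousOn f (Icc 0 τ)) (hf0 : f 0 = 0)
    (hd : ∀ t ∈ Ioc 0 τ, HasDerivAt (fun s => s • f s) (g t) t)
    (hg : ∀ t ∈ Ioc 0 τ, ‖g t‖ ≤ C) {t : ℝ} (ht : t ∈ Icc 0 τ) : ‖f t‖ ≤ C := by
  rcases ht.1.eq_or_lt with rfl | ht0
  · simpa [hf0] using hC
  have h := fun s hs => Convex.norm_image_sub_le_of_norm_hasDerivWithin_le (𝕜 := ℝ)
    (f := fun s => s • f s) (f' := g) (s := Ioc 0 τ) (C := C)
    (fun x hx => (hd x hx).hasDerivWithinAt) hg (convex_Ioc 0 τ) (x := s) (y := t) hs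
  have hτ : t ∈ Ioc 0 τ := ⟨ht0, ht.2⟩
  have hc : ContinuousOn (fun s => s • f s) (Icc 0 τ) := continuousOn_id.smul hf
  have hlim : Tendsto (fun s => ‖t • f t - s • f s‖) (𝓝[>] 0) (𝓝 ‖t • f t - (0 : ℝ) • f 0‖) := by
    refine (tendsto_const_nhds.sub ?_).norm
    refine (hc 0 ⟨le_rfl, ht.1.trans ht.2⟩).mono_left ?_
    rw [← nhdsWithin_Ioc_eq_nhdsGT (ht0.trans_le ht.2)]
    exact nhdsWithin_mono _ Ioc_subset_Icc_self
  have hlim' : Tendsto (fun s : ℝ => C * ‖t - s‖) (𝓝[>] 0) (𝓝 (C * ‖t - 0‖)) :=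
    (Continuous.tendsto (by fun_prop) 0).mono_left nhdsWithin_le_nhds
  have hle := le_of_tendsto_of_tendsto hlim hlim' (by
    filter_upwards [Ioc_mem_nhdsGT (ht0.trans_le ht.2)] with s hs using h s hs hτ)
  simp only [zero_smul, sub_zero, norm_smul, Real.norm_eq_abs, abs_of_pos ht0] at hle
  exact le_of_mul_le_mul_left (by linarith) ht0

/-- The homogeneous singular equation has only the zero solution on a short interval. -/
lemma eq_zero_of_singular_ode {Q : E →L[ℝ] E} (hQ : ∀ v, Q (Q v) = 0) {P : ℝ → E →L[ℝ] E}
    {D : ℝ → E} {τ p : ℝ} (hτ : 0 < τ) (hp : 0 ≤ p) (hsmall : τ * (1 + ‖Q‖) * p < 1)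
    (hP : ∀ t ∈ Icc 0 τ, ‖P t‖ ≤ p) (hD : ContinuousOn D (Icc 0 τ)) (hD0 : D 0 = 0)
    (hode : ∀ t ∈ Ioc 0 τ, ∃ D' : E, HasDerivAt D D' t ∧ t • D' + D t + Q (D t) = t • P t (D t)) :
    ∀ t ∈ Icc 0 τ, D t = 0 := by
  obtain ⟨x, hx, hmax⟩ := isCompact_Icc.exists_isMaxOn (nonempty_Icc.2 hτ.le) hD.norm
  have hM : ∀ t ∈ Icc 0 τ, ‖D t‖ ≤ ‖D x‖ := fun t ht => hmax ht
  have hPD : ∀ t ∈ Ioc 0 τ, ‖t • P t (D t)‖ ≤ τ * (p * ‖D x‖) := fun t ht => by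
    have ht' := Ioc_subset_Icc_self ht
    rw [norm_smul, Real.norm_eq_abs, abs_of_pos ht.1]
    exact mul_le_mul ht.2 ((P t).le_of_opNorm_le_of_le (hP t ht') (hM t ht')) (norm_nonneg _) hτ.le
  have hDd : ∀ t ∈ Ioc 0 τ,
      HasDerivAt (fun s => s • D s) (t • P t (D t) - Q (D t)) t := fun t ht => by
    obtain ⟨D', hD', h⟩ := hode t ht
    have h' := (hasDerivAt_id' t).smul hD'
    rwa [one_smul, eq_sub_of_add_eq h] at h'
  have hQDd : ∀ t ∈ Ioc 0 τ,
      HasDerivAt (fun s => s • Q (D s)) (Q (t • P t (D t))) t := fun t ht => by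
    have h := Q.hasFDerivAt.comp_hasDerivAt t (hDd t ht)
    simpa [Function.comp_def, hQ] using h
  have hQD : ∀ t ∈ Icc 0 τ, ‖Q (D t)‖ ≤ ‖Q‖ * (τ * (p * ‖D x‖)) := fun t ht =>
    norm_le_of_hasDerivAt_smul (by positivity) (Q.continuous.comp_continuousOn hD) (by simp [hD0])
      hQDd (fun s hs => Q.le_opNorm_of_le (hPD s hs)) ht
  have hle : ‖D x‖ ≤ τ * (p * ‖D x‖) + ‖Q‖ * (τ * (p * ‖D x‖)) :=
    norm_le_of_hasDerivAt_smul (by positivity) hD hD0 hDd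
      (fun s hs => (norm_sub_le _ _).trans
        (add_le_add (hPD s hs) (hQD s (Ioc_subset_Icc_self hs)))) hx
  have hx0 : ‖D x‖ ≤ 0 := by
    by_contra! hpos
    nlinarith [mul_lt_mul_of_pos_right hsmall hpos]
  exact fun t ht => norm_le_zero_iff.1 ((hM t ht).trans hx0)

/-- Short-time existence for the singular equation with globally defined bounded coefficients. -/
lemma exists_solution_singular_ode [CompleteSpace E] {Q : E →L[ℝ] E} (hQ : ∀ v, Q (Q v) = 0)
    {P : ℝ → E →L[ℝ] E} {F : ℝ → E} (hPc : Continuous P) (hFc : Continuous F) {τ p b : ℝ}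
    (hτ : 0 < τ) (hp : 0 ≤ p) (hsmall : τ * (1 + ‖Q‖) * p < 1)
    (hP : ∀ t, ‖P t‖ ≤ p) (hF : ∀ t, ‖F t‖ ≤ b) :
    ∃ Z : ℝ → E, Continuous Z ∧ Z 0 = 0 ∧ ∀ t ∈ Ioc 0 τ, ∃ Z' : E, HasDerivAt Z Z' t ∧
      t • Z' + Z t + Q (Z t) = t • P t (Z t) + t • F t := by
  let c : ℝ → ℝ := fun t => max 0 (min t τ)
  have hc : Continuous c := by fun_prop
  have hc0 : ∀ t, 0 ≤ c t := fun t => le_max_left _ _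
  have hcτ : ∀ t, ‖c t‖ ≤ τ := fun t => by
    rw [Real.norm_eq_abs, abs_of_nonneg (hc0 t)]
    exact max_le hτ.le (min_le_right _ _)
  let g : BoundedContinuousFunction ℝ E → ℝ → E := fun Z t => c t • (P t (Z t) + F t)
  have hg : ∀ Z, Continuous (g Z) := fun Z => by
    have := Z.continuous
    fun_prop
  have hgb : ∀ Z t, ‖g Z t‖ ≤ τ * (p * ‖Z‖ + b) := fun Z t => by
    rw [norm_smul]
    refine mul_le_mul (hcτ t) ((norm_add_le _ _).trans (add_le_add ?_ (hF t))) (norm_nonneg _) hτ.le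
    exact (P t).le_of_opNorm_le_of_le (hP t) (Z.norm_coe_le_norm t)
  let Φ : BoundedContinuousFunction ℝ E → BoundedContinuousFunction ℝ E := fun Z =>
    .ofNormedAddCommGroup (nilpotentSolution Q (g Z)) (continuous_nilpotentSolution Q (hg Z)) _
      (norm_nilpotentSolution_le Q (hgb Z))
  have hk : 0 ≤ τ * (1 + ‖Q‖) * p := by positivity
  have hΦ : ContractingWith ⟨τ * (1 + ‖Q‖) * p, hk⟩ Φ := by
    refine ⟨by exact_mod_cast hsmall, LipschitzWith.of_dist_le_mul fun Z W => ?_⟩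
    rw [BoundedContinuousFunction.dist_le (by positivity)]
    intro t
    rw [dist_eq_norm]
    change ‖nilpotentSolution Q (g Z) t - nilpotentSolution Q (g W) t‖ ≤
      τ * (1 + ‖Q‖) * p * dist Z W
    rw [nilpotentSolution_sub Q (hg Z) (hg W)]
    refine (norm_nilpotentSolution_le Q (C := τ * (p * dist Z W)) (fun s => ?_) t).trans_eq
      (by ring)
    have hs : g Z s - g W s = c s • P s (Z s - W s) := by
      simp only [g, ← smul_sub, map_sub]
      congr 1
      abel
    rw [hs, norm_smul]
    refine mul_le_mul (hcτ s) ((P s).le_of_opNorm_le_of_le (hP s) ?_) (norm_nonneg _) hτ.le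
    rw [← dist_eq_norm]
    exact BoundedContinuousFunction.dist_coe_le_dist s
  obtain ⟨Z, hZ⟩ : ∃ Z, Φ Z = Z := ⟨_, hΦ.fixedPoint_isFixedPt⟩
  have hfix : nilpotentSolution Q (g Z) = Z := congrArg DFunLike.coe hZ
  refine ⟨Z, Z.continuous, ?_, fun t ht => ?_⟩
  · rw [← hfix]
    simp [nilpotentSolution, segmentAverage, g, c, hτ.le]
  · obtain ⟨Z', hZ', h⟩ := hasDerivAt_nilpotentSolution hQ (hg Z) ht.1.ne'
    rw [hfix] at hZ' h
    refine ⟨Z', hZ', h.trans ?_⟩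
    simp [g, c, ht.2, ht.1.le]

/-- Short-time existence and uniqueness for `t Z' + Z + Q Z = t P Z + t F` when `Q² = 0`. -/
theorem exists_unique_solution_singular_ode [CompleteSpace E] {Q : E →L[ℝ] E}
    (hQ : ∀ v, Q (Q v) = 0) {P : ℝ → E →L[ℝ] E} {F : ℝ → E} {T : ℝ} (hT : 0 < T)
    (hP : ContinuousOn P (Icc 0 T)) (hF : ContinuousOn F (Icc 0 T)) :
    ∃ τ : ℝ, 0 < τ ∧ τ ≤ T ∧ ∃ Z : ℝ → E,
      (ContinuousOn Z (Icc 0 τ) ∧ Z 0 = 0 ∧ ∀ t ∈ Ioc 0 τ, ∃ Z' : E, HasDerivAt Z Z' t ∧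
        t • Z' + Z t + Q (Z t) = t • P t (Z t) + t • F t) ∧
      ∀ Z₂ : ℝ → E,
        (ContinuousOn Z₂ (Icc 0 τ) ∧ Z₂ 0 = 0 ∧ ∀ t ∈ Ioc 0 τ, ∃ Z' : E, HasDerivAt Z₂ Z' t ∧
          t • Z' + Z₂ t + Q (Z₂ t) = t • P t (Z₂ t) + t • F t) →
        ∀ t ∈ Icc 0 τ, Z₂ t = Z t := by
  obtain ⟨p, hp⟩ := isCompact_Icc.exists_bound_of_continuousOn hP
  obtain ⟨b, hb⟩ := isCompact_Icc.exists_bound_of_continuousOn hF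
  have hp0 : 0 ≤ p := (norm_nonneg _).trans (hp 0 ⟨le_rfl, hT.le⟩)
  have hK : 0 < (1 + ‖Q‖) * p + 1 := by positivity
  obtain ⟨τ, hτ, hτT, hsmall⟩ : ∃ τ : ℝ, 0 < τ ∧ τ ≤ T ∧ τ * (1 + ‖Q‖) * p < 1 := by
    refine ⟨min T ((1 + ‖Q‖) * p + 1)⁻¹, by positivity, min_le_left _ _, ?_⟩
    rw [mul_assoc]
    calc _ ≤ ((1 + ‖Q‖) * p + 1)⁻¹ * ((1 + ‖Q‖) * p) :=
          mul_le_mul_of_nonneg_right (min_le_right _ _) (by positivity)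
      _ < 1 := by
        rw [inv_mul_lt_iff₀ hK]
        linarith
  obtain ⟨Z, hZc, hZ0, hZ⟩ := exists_solution_singular_ode hQ
    (P := IccExtend hT.le ((Icc 0 T).domRestrict P)) (F := IccExtend hT.le ((Icc 0 T).domRestrict F))
    (continuous_IccExtend_iff.2 hP.domRestrict) (continuous_IccExtend_iff.2 hF.domRestrict) hτ hp0 hsmall
    (fun t => hp _ (projIcc 0 T hT.le t).2) (fun t => hb _ (projIcc 0 T hT.le t).2)
  have hZ' : ∀ t ∈ Ioc 0 τ, ∃ Z' : E, HasDerivAt Z Z' t ∧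
      t • Z' + Z t + Q (Z t) = t • P t (Z t) + t • F t := fun t ht => by
    have htT : t ∈ Icc 0 T := ⟨ht.1.le, ht.2.trans hτT⟩
    simpa [IccExtend_of_mem hT.le _ htT, domRestrict_apply] using hZ t ht
  refine ⟨τ, hτ, hτT, Z, ⟨hZc.continuousOn, hZ0, hZ'⟩, ?_⟩
  rintro Z₂ ⟨hZ₂c, hZ₂0, hZ₂⟩ t ht
  refine sub_eq_zero.1 (eq_zero_of_singular_ode (D := fun s => Z₂ s - Z s) hQ hτ hp0 hsmall
    (fun s hs => hp s ⟨hs.1, hs.2.trans hτT⟩) (hZ₂c.sub hZc.continuousOn) (by simp [hZ0, hZ₂0])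
    (fun s hs => ?_) t ht)
  obtain ⟨u, hu, h⟩ := hZ' s hs
  obtain ⟨v, hv, h₂⟩ := hZ₂ s hs
  refine ⟨v - u, hv.sub hu, ?_⟩
  have key : s • (v - u) + (Z₂ s - Z s) + Q (Z₂ s - Z s)
      = (s • v + Z₂ s + Q (Z₂ s)) - (s • u + Z s + Q (Z s)) := by
    rw [smul_sub, map_sub]
    abel
  rw [key, h, h₂, map_sub, smul_sub]
  abel

end SingularODE


/-- Existence and uniqueness of a continuous solution Z with Z(0) = 0 of the singular ODE
t Z'(t) + Z(t) + Q₀ Z(t) = t P(t) Z(t) + t F(t) on (0,τ], where Q₀² = 0 and P, F are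
continuous on [0,T]. -/
theorem stmt14 (n : ℕ) (hn : 1 ≤ n) (T : ℝ) (hT : 0 < T)
    (Q₀ : Matrix (Fin n) (Fin n) ℝ) (hQ : Q₀ * Q₀ = 0)
    (P : ℝ → Matrix (Fin n) (Fin n) ℝ) (F : ℝ → Fin n → ℝ)
    (hP : ContinuousOn P (Set.Icc 0 T)) (hF : ContinuousOn F (Set.Icc 0 T)) :
    ∃ τ : ℝ, 0 < τ ∧ τ ≤ T ∧
      ∃ Z : ℝ → Fin n → ℝ,
        (ContinuousOn Z (Set.Icc 0 τ) ∧ Z 0 = 0 ∧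
          ∀ t ∈ Set.Ioc 0 τ, ∃ Z' : Fin n → ℝ, HasDerivAt Z Z' t ∧
            t • Z' + Z t + Q₀.mulVec (Z t) = t • (P t).mulVec (Z t) + t • F t) ∧
        ∀ Z₂ : ℝ → Fin n → ℝ,
          (ContinuousOn Z₂ (Set.Icc 0 τ) ∧ Z₂ 0 = 0 ∧
            ∀ t ∈ Set.Ioc 0 τ, ∃ Z' : Fin n → ℝ, HasDerivAt Z₂ Z' t ∧
              t • Z' + Z₂ t + Q₀.mulVec (Z₂ t) = t • (P t).mulVec (Z₂ t) + t • F t) →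
          ∀ t ∈ Set.Icc 0 τ, Z₂ t = Z t := by
  let Λ : Matrix (Fin n) (Fin n) ℝ →ₗ[ℝ] (Fin n → ℝ) →L[ℝ] (Fin n → ℝ) :=
    (LinearMap.toContinuousLinearMap.toLinearMap).comp
      (Matrix.toLin' (R := ℝ) (m := Fin n) (n := Fin n)).toLinearMap
  have hΛ : Continuous Λ := Λ.continuous_of_finiteDimensional
  exact exists_unique_solution_singular_ode (Q := Λ Q₀) (P := fun t => Λ (P t))
    (fun v => by simp [Λ, hQ]) hT (hΛ.comp_continuousOn hP) hF
end
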